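/- arXiv:1801.04639 — 17 statements merged into one kernel-verified Lean document; each statement's English description precedes it below -/
import Mathlib

section
/- Let G be a one-dimensional finite abstract simplicial complex with connection Laplacian L, and let λ_1, …, λ_N (N = |G|) be the eigenvalues of L listed with multiplicity. Then for every s ∈ ℂ one has Σ_{k=1}^N (λ_k² : ℂ)^{-s} = Σ_{k=1}^N (λ_k² : ℂ)^{s}; that is, the spectral zeta function ζ_{L²}(s) = Σ_k (λ_k²)^{-s} satisfies the functional equation ζ_{L²}(-s) = ζ_{L²}(s). -/
open Matrix

/-- A finite abstract simplicial complex on a finite vertex type `V`: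
a finite set of nonempty finite subsets of `V` closed under taking nonempty subsets. -/
def IsSimplicialComplex {V : Type*} [DecidableEq V] (G : Finset (Finset V)) : Prop :=
  (∀ x ∈ G, x.Nonempty) ∧ ∀ x ∈ G, ∀ y : Finset V, y.Nonempty → y ⊆ x → y ∈ G

/-- `G` is one-dimensional: all simplices have at most 2 elements,
and some simplex has exactly 2 elements. -/
def IsOneDimensional {V : Type*} (G : Finset (Finset V)) : Prop :=
  (∀ x ∈ G, x.card ≤ 2) ∧ ∃ x ∈ G, x.card = 2

/-- The connection Laplacian of a complex: `L x y = 1` if the simplices `x, y`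
intersect and `0` otherwise. -/
def connectionLaplacian {V : Type*} [DecidableEq V] (G : Finset (Finset V)) :
    Matrix G G ℝ :=
  fun x y => if (x.1 ∩ y.1).Nonempty then 1 else 0

lemma zfe_odd_trace {n : Type*} [Fintype n] [DecidableEq n] (J M : Matrix n n ℝ)
    (hJ : J * J = 1) (hJM : M * J = -(J * M)) (m : ℕ) :
    trace (((2:ℝ) • J + (2:ℝ) • M - J * (M * M)) * (M * M) ^ (m + 1)) = 0 := by
  have h1 : ∀ k, trace (J * (M * M) ^ (k + 1)) = 0 := by
    intro k
    have e : J * (M * M) ^ (k+1) = (J * M) * (M * (M * M) ^ k) := by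
      rw [pow_succ']; simp only [mul_assoc]
    have e2 : trace (J * (M * M) ^ (k+1)) = - trace (J * (M * M) ^ (k+1)) := by
      conv_lhs => rw [e, ← neg_neg (J * M), ← hJM, neg_mul, trace_neg, mul_assoc, trace_mul_comm]
      have : J * (M * (M * M) ^ k) * M = J * (M * M) ^ (k+1) := by
        have c : Commute M ((M * M) ^ k) :=
          ((Commute.refl M).mul_right (Commute.refl M)).pow_right k
        rw [c.eq, pow_succ]; simp only [mul_assoc]
      rw [this]
    linarith
  have hc : Commute J (M * M) := by
    show J * (M * M) = M * M * J
    rw [mul_assoc, hJM, mul_neg, ← mul_assoc M J, hJM, neg_mul, neg_neg, mul_assoc]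
  have h2 : trace (M * (M * M) ^ (m + 1)) = 0 := by
    have e : trace (M * (M * M) ^ (m+1)) = - trace (M * (M * M) ^ (m+1)) := by
      conv_lhs =>
        rw [← one_mul (M * _), ← hJ, mul_assoc, trace_mul_comm, ← mul_assoc J M,
          mul_assoc, ← (hc.pow_right (m+1)).eq, ← mul_assoc, mul_assoc J M J, hJM,
          mul_neg, ← mul_assoc, hJ, one_mul, neg_mul, trace_neg]
    linarith
  have h3 : J * (M * M) * (M * M) ^ (m + 1) = J * (M * M) ^ (m + 1 + 1) := by
    rw [mul_assoc, ← pow_succ']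
  rw [sub_mul, add_mul, smul_mul_assoc, smul_mul_assoc, h3, trace_sub, trace_add, trace_smul,
    trace_smul, h1, h1, h2]
  simp

lemma zfe_inv {n : Type*} [Fintype n] [DecidableEq n] (J M L : Matrix n n ℝ)
    (hJ : J * J = 1) (hJM : M * J = -(J * M))
    (hL : (2:ℝ) • L = (2:ℝ) • J + (2:ℝ) • M + (1 - J) * (M * M)) :
    ∃ g, L * g = 1 ∧ L - g = M * M ∧ L + g = (2:ℝ) • J + (2:ℝ) • M - J * (M * M) := by
  have hc : J * (M * M) = M * M * J := by
    rw [mul_assoc, hJM, mul_neg, ← mul_assoc M J, hJM, neg_mul, neg_neg, mul_assoc]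
  refine ⟨L - M * M, ?_, by abel, ?_⟩
  · have hh : (4:ℝ) • (L * (L - M * M)) = (4:ℝ) • 1 := by
      have : (4:ℝ) • (L * (L - M * M)) = ((2:ℝ) • L) * ((2:ℝ) • L - (2:ℝ) • (M * M)) := by
        rw [← smul_sub, smul_mul_smul_comm]; norm_num
      rw [this, hL]
      have e : ∀ X : Matrix n n ℝ, J * (J * X) = X := fun X => by rw [← mul_assoc, hJ, one_mul]
      have f : ∀ X : Matrix n n ℝ, M * (J * X) = -(J * (M * X)) := fun X => by
        rw [← mul_assoc, hJM, neg_mul, mul_assoc]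
      simp only [sub_mul, add_mul, mul_add, mul_sub, one_mul, smul_mul_assoc, mul_smul_comm,
        smul_smul, mul_assoc, hJ, e, f, hJM, mul_neg, neg_neg, smul_neg]
      module
    exact smul_right_injective _ (by norm_num : (4:ℝ) ≠ 0) hh
  · have : L + (L - M * M) = (2:ℝ) • L - M * M := by module
    rw [this, hL, sub_mul, one_mul]; abel

lemma zfe_sum {n : Type*} [Fintype n] [DecidableEq n] (L g : Matrix n n ℝ)
    (hL : L.IsHermitian) (hg : L * g = 1) :
    (∀ k, hL.eigenvalues k ≠ 0) ∧
    ∀ m : ℕ, trace ((L + g) * (L - g) ^ m) =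
      ∑ k, (hL.eigenvalues k + (hL.eigenvalues k)⁻¹) *
        (hL.eigenvalues k - (hL.eigenvalues k)⁻¹) ^ m := by
  have h0 : ∀ k, hL.eigenvalues k ≠ 0 := by
    have : L.det ≠ 0 := fun h => by
      have := congrArg det hg
      rw [det_mul, h] at this; simp at this
    rw [hL.det_eq_prod_eigenvalues, Finset.prod_ne_zero_iff] at this
    intro k
    simpa using this k (Finset.mem_univ k)
  refine ⟨h0, fun m => ?_⟩
  set φ := Unitary.conjStarAlgAut ℝ (Matrix n n ℝ) hL.eigenvectorUnitary with hφ
  have e1 : L = φ (diagonal hL.eigenvalues) := hL.spectral_theorem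
  have e2 : g = φ (diagonal fun k => (hL.eigenvalues k)⁻¹) := by
    have : φ (diagonal fun k => (hL.eigenvalues k)⁻¹) * L = 1 := by
      conv_lhs => enter [2]; rw [e1]
      rw [← map_mul, diagonal_mul_diagonal]
      simp [h0]
    exact (left_inv_eq_right_inv this hg).symm
  have tr : ∀ X, trace (φ X) = trace X := by
    intro X
    rw [hφ, Unitary.conjStarAlgAut_apply, trace_mul_comm, ← mul_assoc]
    simp
  have : (L + g) * (L - g) ^ m = φ (diagonal fun k =>
      (hL.eigenvalues k + (hL.eigenvalues k)⁻¹) *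
        (hL.eigenvalues k - (hL.eigenvalues k)⁻¹) ^ m) := by
    conv_lhs => rw [e2]
    conv_lhs => enter [1, 1]; rw [e1]
    conv_lhs => enter [2, 1, 1]; rw [e1]
    rw [← map_add, ← map_sub, ← map_pow, ← map_mul, diagonal_add, diagonal_sub, diagonal_pow,
      diagonal_mul_diagonal]
    rfl
  rw [this, tr, trace_diagonal]

lemma zfe_final {n : Type*} [Fintype n] (l : n → ℝ) (h0 : ∀ k, l k ≠ 0)
    (H : ∀ m : ℕ, ∑ k, (l k + (l k)⁻¹) * (l k - (l k)⁻¹) ^ (m + 1) = 0) (s : ℂ) :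
    ∑ k, (((l k ^ 2 : ℝ) : ℂ)) ^ (-s) = ∑ k, (((l k ^ 2 : ℝ) : ℂ)) ^ s := by
  classical
  have HP : ∀ p : Polynomial ℂ, ∑ k, ((l k + (l k)⁻¹ : ℝ) : ℂ) *
      (((l k - (l k)⁻¹ : ℝ) : ℂ) * p.eval ((l k - (l k)⁻¹ : ℝ) : ℂ)) = 0 := by
    intro p
    simp_rw [Polynomial.eval_eq_sum_range, Finset.mul_sum]
    rw [Finset.sum_comm]
    refine Finset.sum_eq_zero fun m _ => ?_
    have := congrArg (fun x : ℝ => p.coeff m * (x : ℂ)) (H m)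
    simp only [Complex.ofReal_zero, mul_zero, Complex.ofReal_sum, Finset.mul_sum] at this
    rw [← this]
    refine Finset.sum_congr rfl fun k _ => ?_
    push_cast
    ring
  let f : ℝ → ℂ := fun x => ((x ^ 2 : ℝ) : ℂ) ^ s - ((x ^ 2 : ℝ) : ℂ) ^ (-s)
  have fneg : ∀ x : ℝ, x ≠ 0 → f (-x⁻¹) = - f x := by
    intro x hx
    have hp : (0:ℝ) < x ^ 2 := by positivity
    have : ∀ t : ℂ, (((-x⁻¹) ^ 2 : ℝ) : ℂ) ^ t = ((x ^ 2 : ℝ) : ℂ) ^ (-t) := by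
      intro t
      rw [neg_sq, inv_pow, Complex.ofReal_inv, Complex.inv_cpow, Complex.cpow_neg]
      rw [Complex.arg_ofReal_of_nonneg hp.le]
      exact Real.pi_pos.ne
    simp only [f, this, neg_neg, neg_sub]
  -- the root choice
  let r : ℝ → ℝ := fun y => (y + √(y ^ 2 + 4)) / 2
  have hr : ∀ x : ℝ, x ≠ 0 → r (x - x⁻¹) = x ∨ r (x - x⁻¹) = -x⁻¹ := by
    intro x hx
    have : (x - x⁻¹) ^ 2 + 4 = (x + x⁻¹) ^ 2 := by field_simp; ring
    simp only [r, this, Real.sqrt_sq_eq_abs]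
    rcases abs_choice (x + x⁻¹) with h | h <;> rw [h]
    · left; ring
    · right; ring
  let S : Finset ℝ := Finset.univ.image fun k => l k - (l k)⁻¹
  let q := Lagrange.interpolate S (fun y : ℝ => (y : ℂ))
    (fun y : ℝ => f (r y) / (((r y + (r y)⁻¹ : ℝ) : ℂ) * (y : ℂ)))
  have hq : ∀ k, q.eval ((l k - (l k)⁻¹ : ℝ) : ℂ) = f (r (l k - (l k)⁻¹)) /
      (((r (l k - (l k)⁻¹) + (r (l k - (l k)⁻¹))⁻¹ : ℝ) : ℂ) * ((l k - (l k)⁻¹ : ℝ) : ℂ)) := by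
    intro k
    exact Lagrange.eval_interpolate_at_node (v := fun y : ℝ => (y : ℂ)) _
      (Complex.ofReal_injective.injOn) (Finset.mem_image_of_mem _ (Finset.mem_univ k))
  have key : ∑ k, f (l k) = 0 := by
    rw [← HP q]
    refine Finset.sum_congr rfl fun k _ => ?_
    rw [hq]
    have hx := h0 k
    generalize l k = x at hx ⊢
    have hs : ((x + x⁻¹ : ℝ) : ℂ) ≠ 0 := by
      rw [Complex.ofReal_ne_zero]
      intro h
      have : x * (x + x⁻¹) = x ^ 2 + 1 := by field_simp
      rw [h] at this
      nlinarith [sq_nonneg x]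
    by_cases hy : x - x⁻¹ = 0
    · have : x ^ 2 = 1 := by
        have : x * (x - x⁻¹) = x ^ 2 - 1 := by field_simp
        rw [hy] at this
        linarith
      simp only [f, this, hy]
      simp
    · have hy' : ((x - x⁻¹ : ℝ) : ℂ) ≠ 0 := by rwa [Complex.ofReal_ne_zero]
      rcases hr x hx with h | h
      · rw [h]
        generalize ((x + x⁻¹ : ℝ) : ℂ) = a at hs ⊢
        generalize ((x - x⁻¹ : ℝ) : ℂ) = b at hy' ⊢
        field_simp
      · rw [h, fneg x hx]
        have : (-x⁻¹ + (-x⁻¹)⁻¹ : ℝ) = -(x + x⁻¹) := by rw [inv_neg, inv_inv]; ring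
        rw [this, Complex.ofReal_neg]
        generalize ((x + x⁻¹ : ℝ) : ℂ) = a at hs ⊢
        generalize ((x - x⁻¹ : ℝ) : ℂ) = b at hy' ⊢
        field_simp
  simp only [f, Finset.sum_sub_distrib] at key
  exact (sub_eq_zero.mp key).symm

def zfeJ {V : Type*} [DecidableEq V] (G : Finset (Finset V)) : Matrix G G ℝ :=
  diagonal fun x => if x.1.card = 1 then 1 else -1

def zfeM {V : Type*} [DecidableEq V] (G : Finset (Finset V)) : Matrix G G ℝ :=
  fun x y => if x.1.card ≠ y.1.card ∧ (x.1 ∩ y.1).Nonempty then 1 else 0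

lemma zfe_MM_edge {V : Type*} [DecidableEq V] (G : Finset (Finset V))
    (hSC : IsSimplicialComplex G) (hd : ∀ x ∈ G, x.card = 1 ∨ x.card = 2)
    (x y : G) (hx : x.1.card = 2) (hy : y.1.card = 2) :
    (zfeM G * zfeM G) x y = ((x.1 ∩ y.1).card : ℝ) := by
  rw [mul_apply]
  have : ∀ z : G, zfeM G x z * zfeM G z y =
      if z.1.card = 1 ∧ z.1 ⊆ x.1 ∩ y.1 then 1 else 0 := by
    intro z
    simp only [zfeM]
    rcases hd z.1 z.2 with hz | hz
    · obtain ⟨v, hv⟩ := Finset.card_eq_one.mp hz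
      simp only [hx, hy, hz, hv]
      by_cases h1 : v ∈ x.1 <;> by_cases h2 : v ∈ y.1 <;> simp [h1, h2]
    · simp [hx, hz]
  simp_rw [this]
  rw [Finset.sum_boole]
  congr 1
  symm
  refine Finset.card_bij (fun v hv => ⟨{v}, hSC.2 x.1 x.2 {v} (by simp) ?_⟩) ?_ ?_ ?_
  · simpa using (Finset.mem_inter.mp hv).1
  · intro v hv; simpa using hv
  · intro a _ b _ h; simpa using h
  · intro z hz
    simp only [Finset.mem_filter, Finset.mem_univ, true_and] at hz
    obtain ⟨v, hv⟩ := Finset.card_eq_one.mp hz.1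
    refine ⟨v, ?_, Subtype.ext hv.symm⟩
    have := hz.2
    rw [hv] at this
    simpa using this

lemma zfe_MM_mixed {V : Type*} [DecidableEq V] (G : Finset (Finset V))
    (hd : ∀ x ∈ G, x.card = 1 ∨ x.card = 2)
    (x y : G) (hxy : x.1.card ≠ y.1.card) :
    (zfeM G * zfeM G) x y = 0 := by
  rw [mul_apply]
  refine Finset.sum_eq_zero fun z _ => ?_
  have h1 := hd x.1 x.2
  have h2 := hd y.1 y.2
  have h3 := hd z.1 z.2
  by_cases h : x.1.card = z.1.card
  · simp [zfeM, h]
  · have : z.1.card = y.1.card := by omega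
    simp [zfeM, this]

lemma zfe_L {V : Type*} [DecidableEq V] (G : Finset (Finset V))
    (hSC : IsSimplicialComplex G) (hd : ∀ x ∈ G, x.card = 1 ∨ x.card = 2) :
    (2:ℝ) • connectionLaplacian G =
      (2:ℝ) • zfeJ G + (2:ℝ) • zfeM G + (1 - zfeJ G) * (zfeM G * zfeM G) := by
  have e : (1 - zfeJ G) = diagonal fun x : G => if x.1.card = 1 then (0:ℝ) else 2 := by
    rw [zfeJ, ← diagonal_one, diagonal_sub]
    congr 1
    ext x
    split_ifs <;> norm_num
  ext x y
  rw [e, Matrix.add_apply, Matrix.add_apply, diagonal_mul, Matrix.smul_apply, Matrix.smul_apply,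
    Matrix.smul_apply]
  rcases hd x.1 x.2 with hx | hx <;> rcases hd y.1 y.2 with hy | hy
  · obtain ⟨v, hv⟩ := Finset.card_eq_one.mp hx
    obtain ⟨w, hw⟩ := Finset.card_eq_one.mp hy
    have : x = y ↔ v = w := by rw [Subtype.ext_iff, hv, hw]; simp
    by_cases h : v = w
    · have h' := this.2 h
      subst h'
      simp [connectionLaplacian, zfeJ, zfeM, hv]
    · have h' : x ≠ y := fun h' => h (this.1 h')
      simp [connectionLaplacian, zfeJ, zfeM, hv, hw, h, h']
  · have : x ≠ y := by rintro rfl; omega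
    simp [connectionLaplacian, zfeJ, zfeM, hx, hy, this]
  · have : x ≠ y := by rintro rfl; omega
    rw [zfe_MM_mixed G hd x y (by omega)]
    simp [connectionLaplacian, zfeJ, zfeM, hx, hy, this]
  · rw [zfe_MM_edge G hSC hd x y hx hy]
    by_cases h : x = y
    · subst h
      have : x.1.Nonempty := hSC.1 _ x.2
      simp [connectionLaplacian, zfeJ, zfeM, hx, this]
      norm_num
    · have hne : x.1 ≠ y.1 := fun h' => h (Subtype.ext h')
      have hlt : (x.1 ∩ y.1).card < 2 := by
        by_contra hc
        have h1 : x.1 ∩ y.1 = x.1 := Finset.eq_of_subset_of_card_le Finset.inter_subset_left (by omega)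
        have h2 : x.1 ∩ y.1 = y.1 := Finset.eq_of_subset_of_card_le Finset.inter_subset_right (by omega)
        exact hne (h1.symm.trans h2)
      by_cases hn : (x.1 ∩ y.1).Nonempty
      · have : (x.1 ∩ y.1).card = 1 := by have := hn.card_pos; omega
        simp [connectionLaplacian, zfeJ, zfeM, hx, hy, hn, this, h]
      · have : (x.1 ∩ y.1).card = 0 := by
          rw [Finset.card_eq_zero]; exact Finset.not_nonempty_iff_eq_empty.mp hn
        simp [connectionLaplacian, zfeJ, zfeM, hx, hy, hn, this, h]

lemma zfe_J {V : Type*} [DecidableEq V] (G : Finset (Finset V)) :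
    zfeJ G * zfeJ G = 1 := by
  rw [zfeJ, diagonal_mul_diagonal, ← diagonal_one]
  congr 1
  ext x
  split_ifs <;> norm_num

lemma zfe_MJ {V : Type*} [DecidableEq V] (G : Finset (Finset V))
    (hd : ∀ x ∈ G, x.card = 1 ∨ x.card = 2) :
    zfeM G * zfeJ G = -(zfeJ G * zfeM G) := by
  ext x y
  rw [Matrix.neg_apply, zfeJ, mul_diagonal, diagonal_mul]
  rcases hd x.1 x.2 with hx | hx <;> rcases hd y.1 y.2 with hy | hy <;>
    by_cases h : (x.1 ∩ y.1).Nonempty <;> simp [zfeM, hx, hy, h]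

/-- Functional equation for one-dimensional complexes:
`ζ_{L²}(-s) = ζ_{L²}(s)`. -/
theorem zeta_functional_equation_of_one_dimensional
    {V : Type*} [Fintype V] [DecidableEq V]
    (G : Finset (Finset V))
    (hSC : IsSimplicialComplex G)
    (hdim : IsOneDimensional G)
    (hL : (connectionLaplacian G).IsHermitian)
    (s : ℂ) :
    ∑ k : G, (((hL.eigenvalues k ^ 2 : ℝ) : ℂ)) ^ (-s)
      = ∑ k : G, (((hL.eigenvalues k ^ 2 : ℝ) : ℂ)) ^ s := by
  have hd : ∀ x ∈ G, x.card = 1 ∨ x.card = 2 := by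
    intro x hx
    have h1 := hdim.1 x hx
    have h2 := (hSC.1 x hx).card_pos
    omega
  obtain ⟨g, hg, hsub, hadd⟩ := zfe_inv (zfeJ G) (zfeM G) (connectionLaplacian G)
    (zfe_J G) (zfe_MJ G hd) (zfe_L G hSC hd)
  obtain ⟨h0, hs⟩ := zfe_sum _ g hL hg
  refine zfe_final _ h0 (fun m => ?_) s
  rw [← hs, hsub, hadd]
  exact zfe_odd_trace _ _ (zfe_J G) (zfe_MJ G hd) m
end

section
/- Let G be a one-dimensional finite abstract simplicial complex with connection Laplacian L. Then the real spectrum of L² is invariant under inversion: for every μ ∈ ℝ, μ is an eigenvalue of L² if and only if μ⁻¹ is an eigenvalue of L². -/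
open Matrix

section Abstract

variable {n : Type*} [Fintype n] [DecidableEq n]

theorem aux_mem_spec (M : Matrix n n ℝ) (mu : ℝ) :
    mu ∈ spectrum ℝ M ↔ ∃ v : n → ℝ, v ≠ 0 ∧ M *ᵥ v = mu • v := by
  rw [spectrum.mem_iff, Matrix.isUnit_iff_isUnit_det, isUnit_iff_ne_zero, not_not,
    ← Matrix.exists_mulVec_eq_zero_iff]
  refine exists_congr fun v => and_congr_right fun _ => ?_
  rw [Matrix.sub_mulVec, sub_eq_zero, Algebra.algebraMap_eq_smul_one, Matrix.smul_mulVec,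
    Matrix.one_mulVec, eq_comm]

theorem aux_forward (L T : Matrix n n ℝ) (h1 : L * T * L = -T) (h2 : L * (T * T) = 1 - L ^ 2)
    (mu : ℝ) (h : mu ∈ spectrum ℝ (L ^ 2)) : mu⁻¹ ∈ spectrum ℝ (L ^ 2) := by
  by_cases h0 : mu = 0
  · subst h0; simpa using h
  by_cases hm : mu = 1
  · subst hm; simpa using h
  rw [aux_mem_spec] at h ⊢
  obtain ⟨v, hv, hLv⟩ := h
  have h3 : L ^ 2 * T * L ^ 2 = T := by
    calc L ^ 2 * T * L ^ 2 = L * (L * T * L) * L := by noncomm_ring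
      _ = -(L * T * L) := by rw [h1, Matrix.mul_neg, Matrix.neg_mul, h1]
      _ = T := by rw [h1, neg_neg]
  refine ⟨T *ᵥ v, fun hT => ?_, ?_⟩
  · have h4 : (L * (T * T)) *ᵥ v = 0 := by
      rw [← Matrix.mulVec_mulVec, ← Matrix.mulVec_mulVec, hT]; simp
    rw [h2, Matrix.sub_mulVec, Matrix.one_mulVec, hLv, sub_eq_zero] at h4
    have h5 : (1 - mu) • v = 0 := by rw [sub_smul, one_smul, sub_eq_zero]; exact h4
    rcases smul_eq_zero.mp h5 with h6 | h6
    · exact hm (by linarith)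
    · exact hv h6
  · have h4 : mu • (L ^ 2 *ᵥ (T *ᵥ v)) = T *ᵥ v := by
      conv_rhs => rw [← h3]
      rw [← Matrix.mulVec_mulVec, hLv, Matrix.mulVec_smul, Matrix.mulVec_mulVec]
    rw [← h4, smul_smul, inv_mul_cancel₀ h0, one_smul, h4]

theorem aux_block {a c : Type*} [Fintype a] [DecidableEq a] [Fintype c] [DecidableEq c]
    (B : Matrix a c ℝ) (mu : ℝ)
    (h : mu ∈ spectrum ℝ ((fromBlocks 1 B Bᵀ (Bᵀ * B - 1)) ^ 2)) :
    mu⁻¹ ∈ spectrum ℝ ((fromBlocks 1 B Bᵀ (Bᵀ * B - 1)) ^ 2) := by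
  refine aux_forward _ (fromBlocks 0 B (-Bᵀ) 0) ?_ ?_ mu h
  · simp only [fromBlocks_multiply, fromBlocks_neg]
    congr 1 <;> simp [Matrix.mul_sub, Matrix.sub_mul, Matrix.mul_assoc] <;> abel
  · rw [← fromBlocks_one, sq]
    simp only [fromBlocks_multiply, sub_eq_add_neg, fromBlocks_neg, fromBlocks_add]
    congr 1 <;> simp [Matrix.mul_add, Matrix.add_mul, Matrix.mul_assoc] <;> abel

end Abstract

theorem aux_sum {V : Type*} [DecidableEq V] (G : Finset (Finset V))
    (hSC : IsSimplicialComplex G) (x y : G) :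
    ∑ a : {z : G // z.1.card = 1}, connectionLaplacian G a.1 x * connectionLaplacian G a.1 y
      = ((x.1 ∩ y.1).card : ℝ) := by
  have h : ∀ a : {z : G // z.1.card = 1},
      connectionLaplacian G a.1 x * connectionLaplacian G a.1 y
        = if a.1.1 ⊆ x.1 ∩ y.1 then 1 else 0 := by
    rintro ⟨⟨z, hz⟩, h1⟩
    obtain ⟨v, rfl⟩ := Finset.card_eq_one.mp h1
    have key : ∀ w : Finset V, ({v} ∩ w).Nonempty ↔ v ∈ w := by
      intro w
      constructor
      · rintro ⟨u, hu⟩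
        simp only [Finset.mem_inter, Finset.mem_singleton] at hu
        exact hu.1 ▸ hu.2
      · intro hv
        exact ⟨v, by simp [hv]⟩
    simp only [connectionLaplacian, key, Finset.singleton_subset_iff, Finset.mem_inter]
    by_cases h2 : v ∈ x.1 <;> by_cases h3 : v ∈ y.1 <;> simp [h2, h3]
  rw [Finset.sum_congr rfl fun a _ => h a, Finset.sum_boole]
  congr 1
  symm
  refine Finset.card_bij (fun v hv => ⟨⟨{v}, hSC.2 x.1 x.2 {v} (by simp)
    (by simpa using (Finset.mem_inter.mp hv).1)⟩, by simp⟩) ?_ ?_ ?_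
  · intro v hv
    simpa using hv
  · intro v _ w _ hvw
    simpa using hvw
  · rintro ⟨⟨z, hz⟩, h1⟩ h2
    obtain ⟨v, rfl⟩ := Finset.card_eq_one.mp h1
    refine ⟨v, ?_, rfl⟩
    simpa using h2

theorem aux_L {V : Type*} [DecidableEq V] (G : Finset (Finset V))
    (hSC : IsSimplicialComplex G) (hdim : IsOneDimensional G) :
    ∃ B : Matrix {z : G // z.1.card = 1} {z : G // ¬ z.1.card = 1} ℝ,
      (connectionLaplacian G) = Matrix.reindexAlgEquiv ℝ ℝ
        (Equiv.sumCompl fun z : G => z.1.card = 1) (fromBlocks 1 B Bᵀ (Bᵀ * B - 1)) := by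
  obtain ⟨B, hB⟩ : ∃ B : Matrix {z : G // z.1.card = 1} {z : G // ¬ z.1.card = 1} ℝ,
      ∀ a c, B a c = connectionLaplacian G a.1 c.1 :=
    ⟨Matrix.of fun a c => connectionLaplacian G a.1 c.1, fun _ _ => rfl⟩
  refine ⟨B, ?_⟩
  rw [← AlgEquiv.symm_apply_eq]
  ext i j
  change connectionLaplacian G (Equiv.sumCompl (fun z : G => z.1.card = 1) i)
    (Equiv.sumCompl (fun z : G => z.1.card = 1) j) = _
  rcases i with i | i <;> rcases j with j | j
  · simp only [Equiv.sumCompl_apply_inl, fromBlocks_apply₁₁, Matrix.one_apply]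
    obtain ⟨⟨x, hx⟩, h1⟩ := i
    obtain ⟨⟨y, hy⟩, h2⟩ := j
    obtain ⟨v, rfl⟩ := Finset.card_eq_one.mp h1
    obtain ⟨w, rfl⟩ := Finset.card_eq_one.mp h2
    by_cases hvw : v = w <;> simp [connectionLaplacian, hvw]
  · simp [hB]
  · simp only [Equiv.sumCompl_apply_inl, Equiv.sumCompl_apply_inr, fromBlocks_apply₂₁,
      Matrix.transpose_apply, hB]
    simp only [connectionLaplacian, Finset.inter_comm]
  · simp only [Equiv.sumCompl_apply_inr, fromBlocks_apply₂₂, Matrix.sub_apply, Matrix.mul_apply,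
      Matrix.transpose_apply, hB]
    rw [aux_sum G hSC]
    have hc : ∀ z : {z : G // ¬ z.1.card = 1}, z.1.1.card = 2 := by
      intro z
      have a1 := hdim.1 z.1.1 z.1.2
      have a2 := Finset.card_pos.mpr (hSC.1 z.1.1 z.1.2)
      have a3 := z.2
      omega
    have hi := hc i
    have hj := hc j
    rw [Matrix.one_apply]
    by_cases hij : i = j
    · subst hij
      have hne := hSC.1 i.1.1 i.1.2
      simp [connectionLaplacian, hi, hne]
      norm_num
    · have hlt : (i.1.1 ∩ j.1.1).card ≤ 1 := by
        by_contra hcon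
        have e1 : i.1.1 ∩ j.1.1 = i.1.1 :=
          Finset.eq_of_subset_of_card_le Finset.inter_subset_left (by omega)
        have e2 : i.1.1 ∩ j.1.1 = j.1.1 :=
          Finset.eq_of_subset_of_card_le Finset.inter_subset_right (by omega)
        exact hij (Subtype.ext (Subtype.ext (e1.symm.trans e2)))
      simp only [connectionLaplacian, hij, if_false, sub_zero, ← Finset.card_pos]
      interval_cases (i.1.1 ∩ j.1.1).card <;> simp

/-- For a one-dimensional complex, the real spectrum of `L²` is invariant under
`μ ↦ μ⁻¹`. -/
theorem spectrum_sq_inv_invariant_of_one_dimensional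
    {V : Type*} [Fintype V] [DecidableEq V]
    (G : Finset (Finset V))
    (hSC : IsSimplicialComplex G)
    (hdim : IsOneDimensional G)
    (mu : ℝ) :
    mu ∈ spectrum ℝ ((connectionLaplacian G) ^ 2) ↔
      mu⁻¹ ∈ spectrum ℝ ((connectionLaplacian G) ^ 2) := by
  obtain ⟨B, hB⟩ := aux_L G hSC hdim
  rw [hB, ← map_pow, AlgEquiv.spectrum_eq]
  refine ⟨aux_block B mu, fun h => ?_⟩
  simpa using aux_block B mu⁻¹ h
end

section
/- Let G be a one-dimensional finite abstract simplicial complex with N = |G| elements, and let L be its connection Laplacian regarded as an N × N integer matrix. Then the characteristic polynomial p = charpoly(L²) = det(X·I − L²) is palindromic up to sign: for every k ≤ N, p.coeff(k) = (−1)^N · p.coeff(N − k). -/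
open Matrix

/-- The connection Laplacian of a complex, with integer entries. -/
def connectionLaplacianInt {V : Type*} [DecidableEq V] (G : Finset (Finset V)) :
    Matrix G G ℤ :=
  fun x y => if (x.1 ∩ y.1).Nonempty then 1 else 0

section Helpers
open Polynomial

lemma sylvester_aux {m n R : Type*} [Fintype m] [Fintype n] [DecidableEq m] [DecidableEq n]
    [CommRing R] (B : Matrix m n R) (c t : R) :
    t ^ Fintype.card n * (t • (1 : Matrix m m R) + c • (B * Bᵀ)).det
      = t ^ Fintype.card m * (t • (1 : Matrix n n R) + c • (Bᵀ * B)).det := by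
  have h := congrArg (Polynomial.eval t) (Matrix.charpoly_mul_comm' ((-c) • B) Bᵀ)
  simp only [eval_mul, eval_pow, eval_X, Matrix.eval_charpoly] at h
  have e1 : t • (1 : Matrix m m R) + c • (B * Bᵀ) = scalar m t - ((-c) • B) * Bᵀ := by
    rw [Matrix.smul_mul, Matrix.smul_one_eq_diagonal, neg_smul, sub_neg_eq_add]; rfl
  have e2 : t • (1 : Matrix n n R) + c • (Bᵀ * B) = scalar n t - Bᵀ * ((-c) • B) := by
    rw [Matrix.mul_smul, Matrix.smul_one_eq_diagonal, neg_smul, sub_neg_eq_add]; rfl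
  rw [e1, e2]; exact h

lemma det_S_aux {m n R : Type*} [Fintype m] [Fintype n] [DecidableEq m] [DecidableEq n]
    [CommRing R] [IsDomain R] (B : Matrix m n R) (c t : R) (Z : Matrix n n R) (W : Matrix n n R)
    (hW : -(t ^ 2) • (Bᵀ * B) + Z * (t • 1 + c • (Bᵀ * B)) = W)
    (h0 : (t • (1 : Matrix n n R) + c • (Bᵀ * B)).det ≠ 0) :
    t ^ Fintype.card n * (fromBlocks (t • 1 + c • (B * Bᵀ)) (t • B) (t • Bᵀ) Z).det
      = t ^ Fintype.card m * W.det := by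
  have key : fromBlocks (t • 1 + c • (B * Bᵀ)) (t • B) (t • Bᵀ) Z
      * fromBlocks 1 (-t • B) 0 (t • 1 + c • (Bᵀ * B))
      = fromBlocks (t • 1 + c • (B * Bᵀ)) 0 (t • Bᵀ) W := by
    rw [fromBlocks_multiply, ← hW]
    congr 1
    · simp
    · simp only [Matrix.add_mul, Matrix.mul_add, Matrix.smul_mul, Matrix.mul_smul, Matrix.one_mul,
        Matrix.mul_one, Matrix.mul_assoc]
      module
    · simp
    · simp only [Matrix.smul_mul, Matrix.mul_smul]
      module
  have h := congrArg Matrix.det key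
  rw [det_mul, det_fromBlocks_zero₂₁, det_fromBlocks_zero₁₂, det_one, one_mul] at h
  apply mul_right_cancel₀ h0
  linear_combination t ^ Fintype.card n * h + W.det * sylvester_aux B c t

lemma main_aux {m n R : Type*} [Fintype m] [Fintype n] [DecidableEq m] [DecidableEq n]
    [CommRing R] [IsDomain R] (B : Matrix m n R) (x t : R) (hx : x = t + 1) (ht : t ≠ 0)
    (h1 : (t • (1 : Matrix n n R) + (1 : R) • (Bᵀ * B)).det ≠ 0)
    (h2 : (t • (1 : Matrix n n R) + (-x) • (Bᵀ * B)).det ≠ 0)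
    (L : Matrix (m ⊕ n) (m ⊕ n) R) (hL : L = fromBlocks 1 B Bᵀ (Bᵀ * B - 1)) :
    (x • 1 - L ^ 2).det = (x • L ^ 2 - 1).det := by
  have d1 := det_S_aux B 1 t (x • (Bᵀ * B) - t • 1) (x • ((Bᵀ * B) * (Bᵀ * B)) - t ^ 2 • 1)
    (by
      subst hx
      simp only [Matrix.sub_mul, Matrix.mul_add, Matrix.smul_mul, Matrix.mul_smul, Matrix.one_mul,
        Matrix.mul_one]
      module) h1
  have d2 := det_S_aux B (-x) t (-(t • 1) - Bᵀ * B) (x • ((Bᵀ * B) * (Bᵀ * B)) - t ^ 2 • 1)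
    (by
      subst hx
      simp only [Matrix.sub_mul, Matrix.mul_add, Matrix.smul_mul, Matrix.mul_smul, Matrix.one_mul,
        Matrix.mul_one, Matrix.neg_mul]
      module) h2
  have e := mul_left_cancel₀ (pow_ne_zero _ ht) (d1.trans d2.symm)
  have one : (1 : Matrix (m ⊕ n) (m ⊕ n) R) = fromBlocks 1 0 0 1 := fromBlocks_one.symm
  have f1 : x • L ^ 2 - 1 = fromBlocks (t • 1 + (1 : R) • (B * Bᵀ)) (t • B) (t • Bᵀ)
      (x • (Bᵀ * B) - t • 1) * L := by
    subst hx hL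
    rw [one, pow_two, fromBlocks_multiply, fromBlocks_multiply, fromBlocks_smul, sub_eq_add_neg,
      fromBlocks_neg, fromBlocks_add]
    congr 1 <;>
    · simp only [Matrix.sub_mul, Matrix.add_mul, Matrix.mul_sub, Matrix.mul_add, Matrix.smul_mul,
        Matrix.mul_smul, Matrix.one_mul, Matrix.mul_one, Matrix.neg_mul, Matrix.mul_assoc]
      module
  have f2 : x • 1 - L ^ 2 = fromBlocks (t • 1 + (-x) • (B * Bᵀ)) (t • B) (t • Bᵀ)
      (-(t • 1) - Bᵀ * B) * L := by
    subst hx hL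
    rw [one, pow_two, fromBlocks_multiply, fromBlocks_multiply, fromBlocks_smul, sub_eq_add_neg,
      fromBlocks_neg, fromBlocks_add]
    congr 1 <;>
    · simp only [Matrix.sub_mul, Matrix.add_mul, Matrix.mul_sub, Matrix.mul_add, Matrix.smul_mul,
        Matrix.mul_smul, Matrix.one_mul, Matrix.mul_one, Matrix.neg_mul, Matrix.mul_assoc]
      module
  rw [f1, f2, det_mul, det_mul, e]

lemma charpoly_aux {m n : Type*} [Fintype m] [Fintype n] [DecidableEq m] [DecidableEq n]
    (B : Matrix m n ℤ)
    (L : Matrix (m ⊕ n) (m ⊕ n) ℤ) (hL : L = fromBlocks 1 B Bᵀ (Bᵀ * B - 1)) :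
    (L ^ 2).charpoly = (-1) ^ Fintype.card (m ⊕ n) * (L ^ 2).charpolyRev := by
  have hK : (B.map (C : ℤ →+* ℤ[X]))ᵀ * B.map (C : ℤ →+* ℤ[X])
      = (Bᵀ * B).map (C : ℤ →+* ℤ[X]) := by
    rw [Matrix.map_mul, Matrix.transpose_map]
  have h := main_aux (B.map (C : ℤ →+* ℤ[X])) X (X - 1) (by ring)
    (by simpa using X_sub_C_ne_zero (1 : ℤ)) ?_ ?_ (L.map (C : ℤ →+* ℤ[X])) ?_
  · have hs : (L ^ 2).map (C : ℤ →+* ℤ[X]) = (L.map (C : ℤ →+* ℤ[X])) ^ 2 := by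
      rw [pow_two, pow_two, Matrix.map_mul]
    rw [Matrix.charpoly, Matrix.charmatrix, Matrix.charpolyRev]
    rw [← Matrix.det_neg]
    simp only [RingHom.mapMatrix_apply]
    rw [hs, neg_sub, ← h, Matrix.smul_one_eq_diagonal]
    rfl
  · rw [hK]
    generalize Bᵀ * B = K
    intro h0
    have hm := (Matrix.charpoly_monic (-K)).ne_zero
    apply hm
    rw [Matrix.charpoly, ← Polynomial.zero_comp (p := (X + 1 : ℤ[X])), ← h0]
    rw [← Polynomial.coe_compRingHom_apply, RingHom.map_det]
    congr 1
    ext i j : 1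
    by_cases hij : i = j
    · subst hij; simp [charmatrix]
    · simp [charmatrix, hij]
  · rw [hK]
    intro h0
    have h1 := congrArg (Polynomial.evalRingHom (0 : ℤ)) h0
    rw [RingHom.map_det] at h1
    have : (evalRingHom (0 : ℤ)).mapMatrix ((X - 1 : ℤ[X]) • (1 : Matrix n n ℤ[X])
        + (-X : ℤ[X]) • (Bᵀ * B).map (C : ℤ →+* ℤ[X])) = -1 := by
      ext i j : 1
      by_cases hij : i = j
      · subst hij; simp
      · simp [hij]
    rw [this, det_neg] at h1
    simp at h1
  · subst hL
    rw [fromBlocks_map, hK, Matrix.map_sub _ (by simp), Matrix.transpose_map]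
    simp

end Helpers

lemma gram_aux {V : Type*} [DecidableEq V] (G : Finset (Finset V))
    (hSC : IsSimplicialComplex G) (e f : G) :
    ∑ v : {x : G // x.1.card = 1}, connectionLaplacianInt G v.1 e * connectionLaplacianInt G v.1 f
      = ((e.1 ∩ f.1).card : ℤ) := by
  simp only [connectionLaplacianInt, mul_ite, mul_one, mul_zero, ← ite_and]
  rw [Finset.sum_boole]
  norm_cast
  symm
  refine Finset.card_bij (fun a ha => ⟨⟨{a}, hSC.2 e.1 e.2 _ (by simp) (by
    simpa using (Finset.mem_inter.1 ha).1)⟩, by simp⟩) ?_ ?_ ?_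
  · intro a ha
    have := Finset.mem_inter.1 ha
    simp [Finset.Nonempty, this.1, this.2]
  · intro a _ b _ h
    simpa using h
  · rintro ⟨⟨v, hv⟩, hc⟩ h
    obtain ⟨a, rfl⟩ := Finset.card_eq_one.1 hc
    refine ⟨a, ?_, rfl⟩
    simp [Finset.Nonempty] at h
    simp [h]

theorem charpoly_sq_palindromic_of_one_dimensional
    {V : Type*} [Fintype V] [DecidableEq V]
    (G : Finset (Finset V))
    (hSC : IsSimplicialComplex G)
    (hdim : IsOneDimensional G)
    (k : ℕ) (hk : k ≤ G.card) :
    ((connectionLaplacianInt G ^ 2).charpoly).coeff k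
      = (-1) ^ G.card * ((connectionLaplacianInt G ^ 2).charpoly).coeff (G.card - k) := by
  classical
  set σ := (Equiv.sumCompl (fun x : G => x.1.card = 1)).symm with hσ
  set L := connectionLaplacianInt G with hLdef
  have hred : (reindex σ σ L) ^ 2 = reindex σ σ (L ^ 2) := by
    have := map_pow (Matrix.reindexAlgEquiv ℤ ℤ σ) L 2
    simpa using this.symm
  have hmain := charpoly_aux (fun (v : {x : G // x.1.card = 1}) (e : {x : G // ¬ x.1.card = 1}) =>
    L v.1 e.1) (reindex σ σ L) (by
      ext i j
      rcases i with v | e <;> rcases j with w | f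
      · have : L v.1 w.1 = if v = w then 1 else 0 := by
          obtain ⟨⟨v, hv⟩, hc⟩ := v
          obtain ⟨⟨w, hw⟩, hd⟩ := w
          obtain ⟨a, rfl⟩ := Finset.card_eq_one.1 hc
          obtain ⟨b, rfl⟩ := Finset.card_eq_one.1 hd
          simp [L, connectionLaplacianInt, Finset.Nonempty, eq_comm]
        rw [← Matrix.one_apply] at this
        exact this
      · rfl
      · change L e.1 w.1 = L w.1 e.1
        simp only [L, connectionLaplacianInt, Finset.inter_comm]
      · have h := gram_aux G hSC e.1 f.1
        have : L e.1 f.1 = ((e.1.1 ∩ f.1.1).card : ℤ) - if e = f then 1 else 0 := by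
          obtain ⟨⟨e, he⟩, hc⟩ := e
          obtain ⟨⟨f, hf⟩, hd⟩ := f
          have p1 := (hSC.1 e he).card_pos
          have p2 := (hSC.1 f hf).card_pos
          have q1 := hdim.1 e he
          have q2 := hdim.1 f hf
          have c1 : e.card = 2 := by simp at hc; omega
          have c2 : f.card = 2 := by simp at hd; omega
          simp only [L, connectionLaplacianInt, Subtype.mk.injEq]
          by_cases hef : e = f
          · subst hef
            simp [hSC.1 e he, c1]
          · have hlt : (e ∩ f).card ≠ 2 := by
              intro h2
              have a1 := Finset.eq_of_subset_of_card_le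
                (Finset.inter_subset_left (s₁ := e) (s₂ := f)) (by omega)
              have a2 := Finset.eq_of_subset_of_card_le
                (Finset.inter_subset_right (s₁ := e) (s₂ := f)) (by omega)
              exact hef (a1.symm.trans a2)
            have hle := Finset.card_le_card (Finset.inter_subset_left (s₁ := e) (s₂ := f))
            rw [if_neg hef]
            split_ifs with hn
            · have := hn.card_pos
              have : (e ∩ f).card = 1 := by omega
              simp [this]
            · simp [Finset.not_nonempty_iff_eq_empty.1 hn]
        rw [← h] at this
        rw [← Matrix.one_apply] at this
        exact this)
  rw [hred, Matrix.charpoly_reindex, ← Matrix.reverse_charpoly, Matrix.charpoly_reindex,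
    ← Fintype.card_congr σ, Fintype.card_coe] at hmain
  conv_lhs => rw [hmain]
  have hd : (L ^ 2).charpoly.natDegree = G.card := by
    rw [Matrix.charpoly_natDegree_eq_dim, Fintype.card_coe]
  have hC : ((-1 : Polynomial ℤ)) ^ G.card = Polynomial.C ((-1) ^ G.card) := by simp
  rw [hC, Polynomial.coeff_C_mul, Polynomial.coeff_reverse, hd, Polynomial.revAt_le hk]
end

section
/- Let G be a finite abstract simplicial complex with connection Laplacian L, and let λ_1, …, λ_N (N = |G|) be the eigenvalues of L listed with multiplicity (all nonzero). Define ζ_L : ℂ → ℂ by ζ_L(s) = Σ_{k=1}^N ((λ_k : ℂ))^{-s}, using the principal branch of the complex power. Then the complex derivative of ζ_L at s = 0 equals −iπ·n(G), where n(G) is the number of indices k with λ_k < 0. -/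
open Matrix

theorem connLap_abs_det {V : Type*} [DecidableEq V] (G : Finset (Finset V))
    (hSC : IsSimplicialComplex G) : |(connectionLaplacian G).det| = 1 := by
  classical
  obtain ⟨A, hAapp⟩ : ∃ A : Matrix G G ℝ, ∀ x z, A x z = if z.1 ⊆ x.1 then 1 else 0 :=
    ⟨Matrix.of fun x z => if z.1 ⊆ x.1 then 1 else 0, fun _ _ => rfl⟩
  let d : G → ℝ := fun z => - (-1) ^ z.1.card
  have hfac : connectionLaplacian G = A * Matrix.diagonal d * Aᵀ := by
    ext x y
    rw [Matrix.mul_apply]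
    simp only [Matrix.mul_diagonal, Matrix.transpose_apply]
    have h1 : ∀ z : G, A x z * d z * A y z =
        (fun z : Finset V => if z ⊆ x.1 ∩ y.1 then -(-1 : ℝ) ^ z.card else 0) z.1 := by
      intro z
      simp only [hAapp, d, Finset.subset_inter_iff]
      by_cases h : z.1 ⊆ x.1 <;> by_cases h' : z.1 ⊆ y.1 <;> simp [h, h']
    rw [Finset.sum_congr rfl (fun z _ => h1 z), Finset.sum_coe_sort G
      (fun z : Finset V => if z ⊆ x.1 ∩ y.1 then -(-1 : ℝ) ^ z.card else 0), ← Finset.sum_filter]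
    have h2 : G.filter (fun z => z ⊆ x.1 ∩ y.1) = (x.1 ∩ y.1).powerset.erase ∅ := by
      ext z
      simp only [Finset.mem_filter, Finset.mem_erase, Finset.mem_powerset]
      constructor
      · rintro ⟨h, h'⟩
        exact ⟨(hSC.1 z h).ne_empty, h'⟩
      · rintro ⟨h, h'⟩
        exact ⟨hSC.2 x.1 x.2 z (Finset.nonempty_iff_ne_empty.mpr h)
          (h'.trans Finset.inter_subset_left), h'⟩
    rw [h2, Finset.sum_neg_distrib]
    have h3 := Finset.sum_erase_eq_sub (f := fun z : Finset V => (-1 : ℝ) ^ z.card)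
      (Finset.empty_mem_powerset (x.1 ∩ y.1))
    have h4 : ∑ m ∈ (x.1 ∩ y.1).powerset, (-1 : ℝ) ^ m.card
        = if x.1 ∩ y.1 = ∅ then 1 else 0 := by
      have := Finset.sum_powerset_neg_one_pow_card (x := x.1 ∩ y.1)
      exact_mod_cast this
    rw [h3, h4]
    simp only [connectionLaplacian, Finset.nonempty_iff_ne_empty]
    by_cases h : x.1 ∩ y.1 = ∅ <;> simp [h]
  have hA : Aᵀ.det = 1 := by
    have hT : Aᵀ.BlockTriangular (fun z : G => z.1.card) := by
      intro i j hij
      simp only [hAapp, Matrix.transpose_apply]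
      rw [if_neg]
      intro h
      exact absurd (Finset.card_le_card h) (not_le.mpr hij)
    rw [hT.det]
    refine Finset.prod_eq_one fun k _ => ?_
    have : Aᵀ.toSquareBlock (fun z : G => z.1.card) k = 1 := by
      ext i j
      simp only [Matrix.toSquareBlock_def, Matrix.of_apply, Matrix.transpose_apply, hAapp,
        Matrix.one_apply]
      by_cases h : i = j
      · simp [h]
      · rw [if_neg h, if_neg]
        intro h'
        exact h (Subtype.ext (Subtype.ext
          (Finset.eq_of_subset_of_card_le h' (by rw [i.2, j.2]))))
    rw [this, Matrix.det_one]
  have hA' : A.det = 1 := by rw [← Matrix.det_transpose]; exact hA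
  rw [hfac, Matrix.det_mul, Matrix.det_mul, hA, hA', Matrix.det_diagonal, one_mul, mul_one,
    Finset.abs_prod]
  exact Finset.prod_eq_one fun z _ => by simp [d]

/-- The derivative of the connection zeta function `ζ_L(s) = Σ_k λ_k^{-s}`
(principal branch) at `s = 0` is `-iπ · n(G)`, where `n(G)` is the number of
negative eigenvalues of `L`. -/
theorem zeta_deriv_at_zero
    {V : Type*} [Fintype V] [DecidableEq V]
    (G : Finset (Finset V))
    (hSC : IsSimplicialComplex G)
    (hL : (connectionLaplacian G).IsHermitian) :
    HasDerivAt (fun s : ℂ => ∑ k : G, ((hL.eigenvalues k : ℝ) : ℂ) ^ (-s))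
      (-(Real.pi : ℂ) * Complex.I *
        ((Finset.univ.filter fun k : G => hL.eigenvalues k < 0).card : ℂ))
      0 := by
  have hdet := connLap_abs_det G hSC
  rw [hL.det_eq_prod_eigenvalues] at hdet
  simp only [RCLike.ofReal_real_eq_id, id_eq] at hdet
  rw [Finset.abs_prod] at hdet
  have hne : ∀ k, hL.eigenvalues k ≠ 0 := by
    intro k hk
    rw [Finset.prod_eq_zero (Finset.mem_univ k) (by simp [hk])] at hdet
    exact zero_ne_one hdet
  have hlog : ∑ k, Real.log |hL.eigenvalues k| = 0 := by
    rw [← Real.log_prod (fun k _ => abs_ne_zero.mpr (hne k)), hdet, Real.log_one]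
  have hder : HasDerivAt (fun s : ℂ => ∑ k : G, ((hL.eigenvalues k : ℝ) : ℂ) ^ (-s))
      (∑ k : G, -Complex.log (hL.eigenvalues k : ℂ)) 0 := by
    refine HasDerivAt.fun_sum fun k _ => ?_
    have := (hasDerivAt_neg (0 : ℂ)).const_cpow (c := (hL.eigenvalues k : ℂ))
      (Or.inl (by exact_mod_cast hne k))
    simpa using this
  convert hder using 1
  have hk : ∀ k, -Complex.log (hL.eigenvalues k : ℂ) = -((Real.log |hL.eigenvalues k| : ℝ) : ℂ)
      + (if hL.eigenvalues k < 0 then -(Real.pi : ℂ) * Complex.I else 0) := by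
    intro k
    rw [Complex.log, Complex.norm_real, Real.norm_eq_abs]
    split_ifs with h
    · rw [Complex.arg_ofReal_of_neg h]; ring
    · rw [Complex.arg_ofReal_of_nonneg (not_lt.mp h)]; simp
  rw [Finset.sum_congr rfl (fun k _ => hk k), Finset.sum_add_distrib, Finset.sum_neg_distrib,
    ← Complex.ofReal_sum, hlog, ← Finset.sum_filter, Finset.sum_const, nsmul_eq_mul]
  simp only [Complex.ofReal_zero, neg_zero, zero_add]
  ring
end

section
/- Let G be a finite abstract simplicial complex with connection Laplacian L, eigenvalues λ_1, …, λ_N of L listed with multiplicity, and ζ_L(s) = Σ_{k=1}^N ((λ_k : ℂ))^{-s} (principal branch). Then the Euler characteristic χ(G) = Σ_{x ∈ G} (−1)^{|x|−1} satisfies (χ(G) : ℂ) = ζ_L(0) − (2i/π)·ζ_L'(0), where ζ_L'(0) is the complex derivative of ζ_L at 0. -/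
open Matrix

/-- The Sylvester law of inertia for congruent diagonal matrices. -/
lemma inertia_aux {n : Type*} [Fintype n] [DecidableEq n] (P : Matrix n n ℝ) (hP : IsUnit P.det)
    (w l : n → ℝ) (h : diagonal l = Pᵀ * diagonal w * P) :
    {i | l i < 0}.ncard = {i | w i < 0}.ncard := by
  have hinv : Invertible P := P.invertibleOfIsUnitDet hP
  have heq : QuadraticMap.Equivalent (QuadraticMap.weightedSumSquares ℝ l)
      (QuadraticMap.weightedSumSquares ℝ w) := by
    refine ⟨⟨P.toLinearEquiv' hinv, ?_⟩⟩
    intro v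
    have key : ∀ (d v : n → ℝ),
        QuadraticMap.weightedSumSquares ℝ d v = v ⬝ᵥ (diagonal d *ᵥ v) := by
      intro d v
      rw [QuadraticMap.weightedSumSquares_apply]
      simp only [dotProduct, mulVec_diagonal, smul_eq_mul]
      exact Finset.sum_congr rfl fun i _ => by ring
    have hv : (P.toLinearEquiv' hinv) v = P *ᵥ v := by
      rw [← Matrix.toLin'_apply, ← Matrix.toLinearEquiv'_apply P hinv]; rfl
    change QuadraticMap.weightedSumSquares ℝ w ((P.toLinearEquiv' hinv) v) = _
    rw [hv, key, key, h, ← mulVec_mulVec, ← mulVec_mulVec, dotProduct_mulVec v,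
      vecMul_transpose]
  rw [← QuadraticForm.sigNeg_weightedSumSquares, ← QuadraticForm.sigNeg_weightedSumSquares]
  exact heq.sigNeg_eq

/-- Incidence matrix. -/
def incid {V : Type*} [DecidableEq V] (G : Finset (Finset V)) : Matrix G G ℝ :=
  fun z x => if z.1 ⊆ x.1 then 1 else 0

/-- signs -/
def sgnw {V : Type*} (G : Finset (Finset V)) : G → ℝ :=
  fun z => (-1) ^ (z.1.card - 1)

lemma incid_det {V : Type*} [DecidableEq V] (G : Finset (Finset V)) : (incid G).det = 1 := by
  have hB : (incid G).BlockTriangular (fun z : G => z.1.card) := by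
    intro i j hij
    simp only [incid]
    rw [if_neg]
    intro hs
    exact absurd (Finset.card_le_card hs) (not_le.mpr hij)
  rw [hB.det]
  refine Finset.prod_eq_one fun k _ => ?_
  have : (incid G).toSquareBlock (fun z : G => z.1.card) k = 1 := by
    ext ⟨i, hi⟩ ⟨j, hj⟩
    simp only [toSquareBlock_def, of_apply, incid, one_apply, Subtype.mk.injEq]
    congr 1
    simp only [eq_iff_iff]
    constructor
    · intro hs
      exact Subtype.ext (Finset.eq_of_subset_of_card_le hs (by rw [hi, hj]))
    · rintro rfl; exact subset_rfl
  rw [this, det_one]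

lemma lap_factor {V : Type*} [DecidableEq V] (G : Finset (Finset V))
    (hSC : IsSimplicialComplex G) :
    connectionLaplacian G = (incid G)ᵀ * diagonal (sgnw G) * incid G := by
  ext x y
  rw [Matrix.mul_assoc, Matrix.mul_apply]
  simp only [diagonal_mul, transpose_apply, incid, connectionLaplacian, sgnw]
  have h1 : ∀ z : G, (if z.1 ⊆ x.1 then (1 : ℝ) else 0) *
      ((-1) ^ (z.1.card - 1) * if z.1 ⊆ y.1 then (1 : ℝ) else 0) =
      if z.1 ⊆ x.1 ∩ y.1 then -(-1 : ℝ) ^ z.1.card else 0 := by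
    intro z
    have hc := (hSC.1 z.1 z.2).card_pos
    obtain ⟨m, hm⟩ := Nat.exists_eq_succ_of_ne_zero hc.ne'
    rw [hm]
    simp only [Finset.subset_inter_iff, Nat.succ_eq_add_one, Nat.add_sub_cancel, pow_succ]
    split_ifs <;> simp_all
  rw [Finset.sum_congr rfl fun z _ => h1 z]
  rw [Finset.sum_coe_sort G (fun z => if z ⊆ x.1 ∩ y.1 then -(-1 : ℝ) ^ z.card else 0),
    ← Finset.sum_filter]
  have h2 : G.filter (fun z => z ⊆ x.1 ∩ y.1) = (x.1 ∩ y.1).powerset.erase ∅ := by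
    ext z
    simp only [Finset.mem_filter, Finset.mem_erase, Finset.mem_powerset]
    constructor
    · rintro ⟨hz, hs⟩
      exact ⟨(hSC.1 z hz).ne_empty, hs⟩
    · rintro ⟨hz, hs⟩
      exact ⟨hSC.2 x.1 x.2 z (Finset.nonempty_iff_ne_empty.mpr hz)
        (hs.trans Finset.inter_subset_left), hs⟩
  have h3 : (∑ m ∈ (x.1 ∩ y.1).powerset, (-1 : ℝ) ^ m.card)
      = if x.1 ∩ y.1 = ∅ then 1 else 0 := by
    exact_mod_cast congrArg (Int.cast : ℤ → ℝ)
      (Finset.sum_powerset_neg_one_pow_card (x := x.1 ∩ y.1))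
  rw [h2, Finset.sum_neg_distrib]
  rw [← Finset.add_sum_erase _ _ (Finset.empty_mem_powerset _)] at h3
  simp only [Finset.card_empty, pow_zero] at h3
  by_cases he : x.1 ∩ y.1 = ∅
  · rw [if_pos he] at h3
    rw [if_neg (by rw [he]; exact Finset.not_nonempty_empty)]
    linarith
  · rw [if_neg he] at h3
    rw [if_pos (Finset.nonempty_iff_ne_empty.mpr he)]
    linarith

lemma neg_count {V : Type*} [DecidableEq V] (G : Finset (Finset V))
    (hSC : IsSimplicialComplex G) (hL : (connectionLaplacian G).IsHermitian) :
    {i | hL.eigenvalues i < 0}.ncard = {i | sgnw G i < 0}.ncard := by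
  have hU := hL.conjStarAlgAut_star_eigenvectorUnitary
  rw [Unitary.conjStarAlgAut_star_apply, star_eq_conjTranspose,
    conjTranspose_eq_transpose_of_trivial] at hU
  refine inertia_aux (incid G * (hL.eigenvectorUnitary : Matrix G G ℝ)) ?_ _ _ ?_
  · rw [det_mul, incid_det, one_mul]
    exact (Matrix.isUnit_iff_isUnit_det _).1 (Unitary.isUnit_coe (U := hL.eigenvectorUnitary))
  · have : diagonal hL.eigenvalues = diagonal (RCLike.ofReal ∘ hL.eigenvalues : G → ℝ) := rfl
    rw [this, ← hU]
    nth_rewrite 2 [lap_factor G hSC]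
    simp only [transpose_mul, Matrix.mul_assoc]

lemma abs_det {V : Type*} [DecidableEq V] (G : Finset (Finset V))
    (hSC : IsSimplicialComplex G) (hL : (connectionLaplacian G).IsHermitian) :
    ∏ i, |hL.eigenvalues i| = 1 := by
  have h := hL.det_eq_prod_eigenvalues
  rw [← Finset.abs_prod]
  have h' : ∏ i, hL.eigenvalues i = (connectionLaplacian G).det := h.symm
  rw [h', lap_factor G hSC, det_mul, det_mul, det_transpose, incid_det, det_diagonal,
    one_mul, mul_one, Finset.abs_prod]
  exact Finset.prod_eq_one fun i _ => by simp [sgnw]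

lemma clog_real (r : ℝ) :
    Complex.log (r : ℂ) = (Real.log |r| : ℝ) + (if r < 0 then (1 : ℂ) else 0) * (Real.pi * Complex.I) := by
  rw [Complex.log]
  rw [Complex.norm_real, Real.norm_eq_abs]
  split_ifs with h
  · rw [Complex.arg_ofReal_of_neg h]; ring
  · rw [Complex.arg_ofReal_of_nonneg (not_lt.mp h)]; simp

/-- Euler characteristic from the connection zeta function:
`χ(G) = ζ_L(0) - (2i/π)·ζ_L'(0)`. -/
theorem euler_characteristic_from_zeta
    {V : Type*} [Fintype V] [DecidableEq V]
    (G : Finset (Finset V))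
    (hSC : IsSimplicialComplex G)
    (hL : (connectionLaplacian G).IsHermitian) :
    ((∑ x ∈ G, (-1 : ℤ) ^ (x.card - 1) : ℤ) : ℂ)
      = (∑ k : G, ((hL.eigenvalues k : ℝ) : ℂ) ^ (-(0 : ℂ)))
        - (2 * Complex.I / (Real.pi : ℂ)) *
          deriv (fun s : ℂ => ∑ k : G, ((hL.eigenvalues k : ℝ) : ℂ) ^ (-s)) 0 := by
  have hprod := abs_det G hSC hL
  have hne : ∀ k, hL.eigenvalues k ≠ 0 := by
    intro k hk
    rw [Finset.prod_eq_zero (Finset.mem_univ k) (by simp [hk])] at hprod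
    exact zero_ne_one hprod
  have hd : HasDerivAt (fun s : ℂ => ∑ k : G, ((hL.eigenvalues k : ℝ) : ℂ) ^ (-s))
      (∑ k : G, -Complex.log (hL.eigenvalues k : ℝ)) 0 := by
    refine HasDerivAt.fun_sum fun k _ => ?_
    have := (hasDerivAt_neg (0 : ℂ)).const_cpow (c := ((hL.eigenvalues k : ℝ) : ℂ))
      (Or.inl (by exact_mod_cast hne k))
    simpa using this
  have hlog : ∑ k : G, Real.log |hL.eigenvalues k| = 0 := by
    rw [← Real.log_prod fun k _ => abs_ne_zero.mpr (hne k), hprod, Real.log_one]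
  have hcard : ∀ f : G → ℝ, (∑ k : G, if f k < 0 then (1 : ℂ) else 0) =
      ({i | f i < 0}.ncard : ℂ) := by
    intro f
    rw [Finset.sum_boole, Set.ncard_eq_toFinset_card']
    simp
  have hsum : ∑ k : G, -Complex.log (hL.eigenvalues k : ℝ) =
      -(({i | sgnw G i < 0}.ncard : ℂ) * (Real.pi * Complex.I)) := by
    rw [Finset.sum_neg_distrib]
    simp only [clog_real]
    rw [Finset.sum_add_distrib, ← Finset.sum_mul, hcard, neg_count G hSC hL,
      ← Complex.ofReal_sum, hlog]
    simp
  have hchi : ((∑ x ∈ G, (-1 : ℤ) ^ (x.card - 1) : ℤ) : ℂ) =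
      ∑ k : G, (1 - 2 * (if sgnw G k < 0 then (1 : ℂ) else 0)) := by
    rw [← Finset.sum_coe_sort, Int.cast_sum]
    refine Finset.sum_congr rfl fun k _ => ?_
    rcases neg_one_pow_eq_or ℤ (k.1.card - 1) with h | h
    · have h' : sgnw G k = 1 := by
        simpa [sgnw] using congrArg (Int.cast : ℤ → ℝ) h
      rw [h, if_neg (by rw [h']; norm_num)]; norm_num
    · have h' : sgnw G k = -1 := by
        simpa [sgnw] using congrArg (Int.cast : ℤ → ℝ) h
      rw [h, if_pos (by rw [h']; norm_num)]; norm_num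
  rw [hd.deriv, hsum, hchi, Finset.sum_sub_distrib, ← Finset.mul_sum, hcard]
  have hpi : (Real.pi : ℂ) ≠ 0 := by exact_mod_cast Real.pi_ne_zero
  simp only [neg_zero, Complex.cpow_zero]
  field_simp
  linear_combination (-2 * ({i | sgnw G i < 0}.ncard : ℂ)) * Complex.I_sq
end

section
/- Let G be a finite abstract simplicial complex with connection Laplacian L. Then the number of negative eigenvalues of L, counted with multiplicity, equals the number of odd-dimensional simplices of G, i.e. the number of x ∈ G with |x| even. -/
open Matrix

/-- A matrix congruent to a diagonal one has the quadratic form of a weighted sum of squares. -/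
lemma equivalent_of_congr {n : Type*} [Fintype n] [DecidableEq n] (A P : Matrix n n ℝ)
    (w : n → ℝ) (hP : IsUnit P.det) (hA : A = Pᵀ * diagonal w * P) :
    QuadraticMap.Equivalent A.toQuadraticForm' (QuadraticMap.weightedSumSquares ℝ w) := by
  have := P.invertibleOfIsUnitDet hP
  refine ⟨⟨P.toLinearEquiv' this, fun x => ?_⟩⟩
  have h1 : A.toQuadraticForm' x = x ⬝ᵥ (A *ᵥ x) := by
    simp [Matrix.toQuadraticForm', Matrix.toLinearMap₂'_apply']
  have h2 : (P.toLinearEquiv' this) x = P *ᵥ x := rfl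
  change QuadraticMap.weightedSumSquares ℝ w ((P.toLinearEquiv' this) x) = A.toQuadraticForm' x
  rw [h1, h2, hA, ← mulVec_mulVec, ← mulVec_mulVec, dotProduct_mulVec, vecMul_transpose,
    QuadraticMap.weightedSumSquares_apply]
  simp only [dotProduct, mulVec_diagonal, smul_eq_mul]
  exact Finset.sum_congr rfl fun i _ => by ring

/-- Uniqueness in Sylvester's law, in terms of eigenvalues. -/
lemma ncard_neg_eigenvalues {n : Type*} [Fintype n] [DecidableEq n] (A P : Matrix n n ℝ)
    (w : n → ℝ) (hP : IsUnit P.det) (hA : A = Pᵀ * diagonal w * P) (hH : A.IsHermitian) :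
    {i | hH.eigenvalues i < 0}.ncard = {i | w i < 0}.ncard := by
  rw [← QuadraticForm.sigNeg_of_equiv_weightedSumSquares (equivalent_of_congr A P w hP hA)]
  symm
  apply QuadraticForm.sigNeg_of_equiv_weightedSumSquares
  refine equivalent_of_congr A (star (hH.eigenvectorUnitary : Matrix n n ℝ)) _ ?_ ?_
  · exact (Matrix.isUnit_iff_isUnit_det _).1 (Unitary.isUnit_coe (U := star hH.eigenvectorUnitary))
  · have h := hH.spectral_theorem
    rw [Unitary.conjStarAlgAut_apply] at h
    have h3 : (star (hH.eigenvectorUnitary : Matrix n n ℝ))ᵀ = hH.eigenvectorUnitary := by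
      ext i j; simp [Matrix.star_apply]
    rw [h3]
    exact h

/-- The incidence matrix of inclusion. -/
def inclMatrix {V : Type*} [DecidableEq V] (G : Finset (Finset V)) : Matrix G G ℝ :=
  fun z x => if z.1 ⊆ x.1 then 1 else 0

lemma det_inclMatrix {V : Type*} [DecidableEq V] (G : Finset (Finset V)) :
    (inclMatrix G).det = 1 := by
  have hb : (inclMatrix G).BlockTriangular (fun x : G => x.1.card) := by
    intro i j hij
    have : ¬ i.1 ⊆ j.1 := fun h => absurd (Finset.card_le_card h) (not_le.2 hij)
    simp [inclMatrix, this]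
  rw [hb.det]
  refine Finset.prod_eq_one fun k _ => ?_
  have : (inclMatrix G).toSquareBlock (fun x : G => x.1.card) k = 1 := by
    ext i j
    have hi := i.2
    have hj := j.2
    have : i.1.1 ⊆ j.1.1 ↔ i = j := by
      constructor
      · intro h
        exact Subtype.ext (Subtype.ext (Finset.eq_of_subset_of_card_le h (by
          rw [show i.1.1.card = k from hi, show j.1.1.card = k from hj])))
      · rintro rfl
        exact subset_rfl
    simp only [Matrix.toSquareBlock_def, inclMatrix, Matrix.one_apply, Matrix.of_apply, this]
  rw [this, det_one]

lemma connectionLaplacian_eq {V : Type*} [DecidableEq V] (G : Finset (Finset V))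
    (hSC : IsSimplicialComplex G) :
    connectionLaplacian G =
      (inclMatrix G)ᵀ * diagonal (fun z : G => -(-1 : ℝ) ^ z.1.card) * inclMatrix G := by
  ext x y
  have hG : ∀ z : Finset V, z ∈ (x.1 ∩ y.1).powerset.erase ∅ ↔
      z ∈ G.filter (fun z => z ⊆ x.1 ∧ z ⊆ y.1) := by
    intro z
    simp only [Finset.mem_erase, Finset.mem_powerset, Finset.mem_filter, Finset.subset_inter_iff]
    constructor
    · rintro ⟨h0, h1, h2⟩
      exact ⟨hSC.2 x.1 x.2 z (Finset.nonempty_iff_ne_empty.2 h0) h1, h1, h2⟩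
    · rintro ⟨h0, h1, h2⟩
      exact ⟨(hSC.1 z h0).ne_empty, h1, h2⟩
  have key : ∑ z ∈ (x.1 ∩ y.1).powerset.erase ∅, (-1 : ℝ) ^ z.card
      = (if x.1 ∩ y.1 = ∅ then 1 else 0) - 1 := by
    have h := Finset.sum_powerset_neg_one_pow_card (x := x.1 ∩ y.1)
    have h' := congrArg (Int.cast : ℤ → ℝ) h
    push_cast at h'
    rw [← Finset.add_sum_erase _ _ (Finset.empty_mem_powerset _)] at h'
    simp only [Finset.card_empty, pow_zero] at h'
    linarith
  rw [Finset.ext hG, Finset.sum_filter, ← Finset.sum_coe_sort] at key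
  rw [Matrix.mul_apply]
  simp only [mul_diagonal, transpose_apply, inclMatrix, connectionLaplacian]
  have h4 : ∀ z : G, (if z.1 ⊆ x.1 then (1 : ℝ) else 0) * -(-1 : ℝ) ^ z.1.card *
      (if z.1 ⊆ y.1 then 1 else 0)
      = -(if z.1 ⊆ x.1 ∧ z.1 ⊆ y.1 then (-1 : ℝ) ^ z.1.card else 0) := by
    intro z
    by_cases h1 : z.1 ⊆ x.1 <;> by_cases h2 : z.1 ⊆ y.1 <;> simp [h1, h2]
  rw [Finset.sum_congr rfl fun z _ => h4 z, Finset.sum_neg_distrib, key]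
  by_cases h : x.1 ∩ y.1 = ∅
  · simp [h]
  · simp [h, Finset.nonempty_iff_ne_empty]

/-- The number of negative eigenvalues of the connection Laplacian (with
multiplicity) equals the number of odd-dimensional simplices of `G`,
i.e. those `x ∈ G` with `|x|` even. -/
theorem card_negative_eigenvalues_eq_card_odd_dimensional
    {V : Type*} [Fintype V] [DecidableEq V]
    (G : Finset (Finset V))
    (hSC : IsSimplicialComplex G)
    (hL : (connectionLaplacian G).IsHermitian) :
    (Finset.univ.filter fun k : G => hL.eigenvalues k < 0).card
      = (G.filter fun x => Even x.card).card := by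
  have h := ncard_neg_eigenvalues _ _ _ (by rw [det_inclMatrix]; exact isUnit_one)
    (connectionLaplacian_eq G hSC) hL
  have h5 : ∀ n : ℕ, -(-1 : ℝ) ^ n < 0 ↔ Even n := by
    intro n
    rcases Nat.even_or_odd n with hn | hn
    · simp [hn, hn.neg_one_pow]
    · simp only [hn.neg_one_pow, Nat.not_even_iff_odd.2 hn, iff_false]
      norm_num
  simp only [h5] at h
  rw [← Set.ncard_coe_finset, Finset.coe_filter]
  simp only [Finset.mem_univ, true_and]
  rw [h, ← Set.ncard_coe_finset, Finset.coe_filter,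
    ← Set.ncard_image_of_injective _ Subtype.val_injective]
  congr 1
  ext x
  simp [and_comm]
end

section
/- Let G be a finite abstract simplicial complex with connection Laplacian L. Then det(L) = (−1)^{f(G)}, where f(G) is the number of odd-dimensional simplices of G, i.e. the number of x ∈ G with |x| even. In particular |det(L)| = 1. -/
open Matrix

/-- The zeta matrix of the complex. -/
def zetaMat {V : Type*} [DecidableEq V] (G : Finset (Finset V)) : Matrix G G ℝ :=
  fun z x => if z.1 ⊆ x.1 then 1 else 0

theorem zetaMat_det {V : Type*} [DecidableEq V] (G : Finset (Finset V)) :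
    (zetaMat G).det = 1 := by
  have hb : (zetaMat G).BlockTriangular (fun x : G => x.1.card) := by
    intro i j hij
    have : ¬ i.1 ⊆ j.1 := fun h => absurd (Finset.card_le_card h) (not_le.mpr hij)
    simp [zetaMat, this]
  rw [hb.det]
  refine Finset.prod_eq_one fun a _ => ?_
  have : (zetaMat G).toSquareBlock (fun x : G => x.1.card) a = 1 := by
    ext i j
    by_cases h : i = j
    · subst h
      simp [Matrix.toSquareBlock_def, zetaMat]
    · have h2 : ¬ i.1.1 ⊆ j.1.1 := by
        intro hs
        apply h
        apply Subtype.ext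
        apply Subtype.ext
        exact Finset.eq_of_subset_of_card_le hs (le_of_eq (j.2.trans i.2.symm))
      rw [Matrix.one_apply_ne h]
      exact if_neg h2
  rw [this, Matrix.det_one]

theorem connection_factor {V : Type*} [DecidableEq V] (G : Finset (Finset V))
    (hSC : IsSimplicialComplex G) :
    connectionLaplacian G =
      (zetaMat G)ᵀ * Matrix.diagonal (fun z : G => (-1 : ℝ) ^ (z.1.card + 1)) * zetaMat G := by
  ext x y
  rw [Matrix.mul_apply]
  simp only [Matrix.mul_diagonal, Matrix.transpose_apply]
  have h1 : ∑ z : G, zetaMat G z x * (-1 : ℝ) ^ (z.1.card + 1) * zetaMat G z y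
      = ∑ z ∈ G, if z ⊆ x.1 ∩ y.1 then (-1 : ℝ) ^ (z.card + 1) else 0 := by
    rw [← Finset.sum_coe_sort G]
    refine Finset.sum_congr rfl fun z _ => ?_
    by_cases ha : z.1 ⊆ x.1 <;> by_cases hb : z.1 ⊆ y.1 <;>
      simp [zetaMat, Finset.subset_inter_iff, ha, hb]
  have h2 : G.filter (fun z => z ⊆ x.1 ∩ y.1) = (x.1 ∩ y.1).powerset.erase ∅ := by
    ext z
    simp only [Finset.mem_filter, Finset.mem_erase, Finset.mem_powerset]
    constructor
    · rintro ⟨hz, hs⟩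
      exact ⟨(hSC.1 z hz).ne_empty, hs⟩
    · rintro ⟨hz, hs⟩
      exact ⟨hSC.2 x.1 x.2 z (Finset.nonempty_iff_ne_empty.mpr hz)
        (hs.trans Finset.inter_subset_left), hs⟩
  rw [h1, ← Finset.sum_filter, h2]
  have h3 := Finset.sum_powerset_neg_one_pow_card (x := x.1 ∩ y.1)
  have h4 : ∑ m ∈ (x.1 ∩ y.1).powerset, (-1 : ℝ) ^ m.card
      = if x.1 ∩ y.1 = ∅ then 1 else 0 := by exact_mod_cast h3
  rw [← Finset.add_sum_erase _ _ (Finset.empty_mem_powerset _)] at h4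
  simp only [pow_succ, mul_neg, mul_one, Finset.sum_neg_distrib]
  simp only [Finset.card_empty, pow_zero] at h4
  simp only [connectionLaplacian, Finset.nonempty_iff_ne_empty]
  split_ifs at h4 ⊢ <;> first | contradiction | linarith

/-- Unimodularity theorem: `det L = (-1)^{f(G)}`, where `f(G)` is the number of
odd-dimensional simplices of `G` (those with an even number of vertices);
in particular `|det L| = 1`. -/
theorem det_connectionLaplacian
    {V : Type*} [Fintype V] [DecidableEq V]
    (G : Finset (Finset V))
    (hSC : IsSimplicialComplex G) :
    (connectionLaplacian G).det = (-1) ^ (G.filter fun x => Even x.card).card ∧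
      |(connectionLaplacian G).det| = 1 := by
  have hdet : (connectionLaplacian G).det = (-1) ^ (G.filter fun x => Even x.card).card := by
    rw [connection_factor G hSC, Matrix.det_mul, Matrix.det_mul, Matrix.det_transpose,
      zetaMat_det, Matrix.det_diagonal, one_mul, mul_one,
      Finset.prod_coe_sort G (fun z => (-1 : ℝ) ^ (z.card + 1)), ← Finset.prod_const,
      Finset.prod_filter]
    refine Finset.prod_congr rfl fun z _ => ?_
    split_ifs with h
    · exact h.add_one.neg_one_pow
    · exact (Nat.not_even_iff_odd.mp h).add_one.neg_one_pow
  refine ⟨hdet, ?_⟩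
  rw [hdet, abs_pow, abs_neg, abs_one, one_pow]
end

section
/- Let G be a finite abstract simplicial complex with connection Laplacian L. Then the Euler characteristic satisfies the spectral formula χ(G) = Σ_{x ∈ G} (−1)^{|x|−1} = p(G) − n(G), where p(G) is the number of positive eigenvalues of L and n(G) is the number of negative eigenvalues of L, both counted with multiplicity. -/
open Matrix

/-- The quadratic form of `Pᵀ diag(w) P` is equivalent to the weighted sum of squares. -/
lemma equiv_weighted_of_factor {ι : Type*} [Fintype ι] [DecidableEq ι]
    (A P : Matrix ι ι ℝ) (w : ι → ℝ) (hP : Function.Injective P.mulVec)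
    (hA : A = Pᵀ * diagonal w * P) :
    QuadraticMap.Equivalent A.toQuadraticForm' (QuadraticMap.weightedSumSquares ℝ w) := by
  refine ⟨⟨LinearEquiv.ofInjectiveEndo (Matrix.toLin' P) hP, fun v => ?_⟩⟩
  have h1 : A.toQuadraticForm' v = v ⬝ᵥ (A *ᵥ v) := by
    simp [Matrix.toQuadraticForm', LinearMap.BilinMap.toQuadraticMap_apply, Matrix.toLinearMap₂'_apply']
  have h2 : v ⬝ᵥ (A *ᵥ v) = (P *ᵥ v) ⬝ᵥ (diagonal w *ᵥ (P *ᵥ v)) := by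
    rw [hA, ← Matrix.mulVec_mulVec, ← Matrix.mulVec_mulVec, Matrix.dotProduct_mulVec,
      Matrix.vecMul_transpose]
  rw [h1, h2]
  change QuadraticMap.weightedSumSquares ℝ w (P *ᵥ v) = _
  simp only [QuadraticMap.weightedSumSquares_apply, dotProduct, Matrix.mulVec_diagonal,
    smul_eq_mul]
  exact Finset.sum_congr rfl fun i _ => by ring

/-- The containment matrix of a set of sets. -/
def containMatrix {V : Type*} [DecidableEq V] (G : Finset (Finset V)) : Matrix G G ℝ :=
  fun z x => if z.1 ⊆ x.1 then 1 else 0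

lemma containMatrix_injective {V : Type*} [DecidableEq V] (G : Finset (Finset V)) :
    Function.Injective (containMatrix G).mulVec := by
  have key : ∀ v : G → ℝ, containMatrix G *ᵥ v = 0 → v = 0 := by
    intro v hv
    by_contra hne
    obtain ⟨a, ha⟩ := Function.ne_iff.mp hne
    obtain ⟨x, hx, hmax⟩ := Finset.exists_max_image
      (Finset.univ.filter fun x : G => v x ≠ 0) (fun x => x.1.card) ⟨a, by simpa using ha⟩
    have hvx := congrFun hv x
    simp only [Matrix.mulVec, dotProduct, containMatrix, Pi.zero_apply] at hvx
    rw [Finset.sum_eq_single x] at hvx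
    · simp_all
    · intro y _ hyx
      by_cases hy : v y = 0
      · simp [hy]
      · have h := hmax y (by simpa using hy)
        have : ¬ x.1 ⊆ y.1 := fun hs =>
          hyx (Subtype.ext (Finset.eq_of_subset_of_card_le hs h).symm)
        simp [this]
    · simp
  intro v u h
  have := key (v - u) (by
    rw [Matrix.mulVec_sub]
    exact sub_eq_zero.mpr h)
  exact sub_eq_zero.mp this

lemma sum_nonempty_subsets {V : Type*} [DecidableEq V] (s : Finset V) :
    (∑ z ∈ s.powerset.erase ∅, (-1 : ℤ) ^ (z.card - 1)) = if s.Nonempty then 1 else 0 := by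
  have h := Finset.sum_powerset_neg_one_pow_card (x := s)
  rw [← Finset.add_sum_erase _ _ (Finset.empty_mem_powerset s)] at h
  have h2 : (∑ z ∈ s.powerset.erase ∅, (-1 : ℤ) ^ z.card)
      = - ∑ z ∈ s.powerset.erase ∅, (-1 : ℤ) ^ (z.card - 1) := by
    rw [← Finset.sum_neg_distrib]
    refine Finset.sum_congr rfl fun z hz => ?_
    have hz' : z.card ≠ 0 := by
      simpa using (Finset.mem_erase.mp hz).1
    obtain ⟨k, hk⟩ := Nat.exists_eq_succ_of_ne_zero hz'
    rw [hk]
    simp [pow_succ]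
  rw [h2] at h
  rcases s.eq_empty_or_nonempty with rfl | hs
  · simp
  · simp [hs, hs.ne_empty] at h ⊢
    linarith

lemma connectionLaplacian_factor {V : Type*} [DecidableEq V] (G : Finset (Finset V))
    (hSC : IsSimplicialComplex G) :
    connectionLaplacian G = (containMatrix G)ᵀ *
      diagonal (fun z : G => (-1 : ℝ) ^ (z.1.card - 1)) * containMatrix G := by
  ext x y
  rw [Matrix.mul_apply]
  simp only [Matrix.mul_diagonal, Matrix.transpose_apply, containMatrix, connectionLaplacian]
  have h := congrArg (Int.cast : ℤ → ℝ) (sum_nonempty_subsets (x.1 ∩ y.1))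
  push_cast at h
  rw [← h]
  have hset : (x.1 ∩ y.1).powerset.erase ∅ = G.filter fun z => z ⊆ x.1 ∧ z ⊆ y.1 := by
    ext z
    simp only [Finset.mem_erase, Finset.mem_powerset, Finset.mem_filter, Finset.subset_inter_iff]
    constructor
    · rintro ⟨hz, h1, h2⟩
      exact ⟨hSC.2 x.1 x.2 z (Finset.nonempty_iff_ne_empty.mpr hz) h1, h1, h2⟩
    · rintro ⟨hz, h1, h2⟩
      exact ⟨(hSC.1 z hz).ne_empty, h1, h2⟩
  rw [hset, Finset.sum_filter, ← Finset.sum_coe_sort G]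
  refine Finset.sum_congr rfl fun z _ => ?_
  by_cases h1 : z.1 ⊆ x.1 <;> by_cases h2 : z.1 ⊆ y.1 <;> simp [h1, h2]

/-- The spectral formula for the Euler characteristic:
`χ(G) = p(G) - n(G)` where `p(G)` (resp. `n(G)`) is the number of positive
(resp. negative) eigenvalues of the connection Laplacian, with multiplicity. -/
theorem euler_characteristic_eq_pos_sub_neg
    {V : Type*} [Fintype V] [DecidableEq V]
    (G : Finset (Finset V))
    (hSC : IsSimplicialComplex G)
    (hL : (connectionLaplacian G).IsHermitian) :
    (∑ x ∈ G, (-1 : ℤ) ^ (x.card - 1))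
      = ((Finset.univ.filter fun k : G => 0 < hL.eigenvalues k).card : ℤ)
        - ((Finset.univ.filter fun k : G => hL.eigenvalues k < 0).card : ℤ) := by
  have e1 := equiv_weighted_of_factor _ _ _ (containMatrix_injective G)
    (connectionLaplacian_factor G hSC)
  have e2 : QuadraticMap.Equivalent (connectionLaplacian G).toQuadraticForm'
      (QuadraticMap.weightedSumSquares ℝ hL.eigenvalues) := by
    refine equiv_weighted_of_factor _ (star (hL.eigenvectorUnitary : Matrix G G ℝ)) _ ?_ ?_
    · intro v u h
      have h' := congrArg (fun t => (hL.eigenvectorUnitary : Matrix G G ℝ) *ᵥ t) h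
      simpa [Matrix.mulVec_mulVec] using h'
    · have h := hL.spectral_theorem
      rw [Unitary.conjStarAlgAut_apply] at h
      have ht : (star (hL.eigenvectorUnitary : Matrix G G ℝ))ᵀ
          = (hL.eigenvectorUnitary : Matrix G G ℝ) := by
        ext i j
        simp [Matrix.star_apply]
      rw [ht]
      exact h
  have hp := (QuadraticForm.sigPos_of_equiv_weightedSumSquares e1).symm.trans
    (QuadraticForm.sigPos_of_equiv_weightedSumSquares e2)
  have hn := (QuadraticForm.sigNeg_of_equiv_weightedSumSquares e1).symm.trans
    (QuadraticForm.sigNeg_of_equiv_weightedSumSquares e2)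
  have conv : ∀ p : G → Prop, ∀ [DecidablePred p],
      {i | p i}.ncard = (Finset.univ.filter p).card := by
    intro p _
    rw [← Set.ncard_coe_finset]
    simp
  rw [← conv, ← conv, ← hp, ← hn, conv, conv, ← Finset.sum_coe_sort G,
    Finset.card_filter, Finset.card_filter]
  push_cast
  rw [← Finset.sum_sub_distrib]
  refine Finset.sum_congr rfl fun z _ => ?_
  rcases neg_one_pow_eq_or ℤ (z.1.card - 1) with h | h
  · have h' : (-1 : ℝ) ^ (z.1.card - 1) = 1 := by exact_mod_cast h
    rw [h, h']; norm_num
  · have h' : (-1 : ℝ) ^ (z.1.card - 1) = -1 := by exact_mod_cast h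
    rw [h, h']; norm_num
end

section
/- Fix n ≥ 3 and let G be the cycle complex C_n on vertex set ZMod n, consisting of the singletons {k} and the edges {k, k+1} for k ∈ ZMod n; let L be its connection Laplacian, the 2n × 2n real matrix indexed by ZMod n ⊕ ZMod n (left summands representing singletons, right summands representing edges) with entry 1 when the corresponding simplices intersect and 0 otherwise. Then the real spectrum of L is exactly { λ ∈ ℝ | ∃ k ∈ {0,1,…,n−1}, λ² − 4·cos²(πk/n)·λ − 1 = 0 }; equivalently, the eigenvalues of L are the numbers f^±(4cos²(πk/n)) where f^±(y) = (y ± √(y²+4))/2. -/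
open Matrix

/-- The simplices of the cycle complex `C_n` on `ZMod n`: left summands are the
singletons `{k}`, right summands are the edges `{k, k+1}`. -/
def cycleSimplex (n : ℕ) : ZMod n ⊕ ZMod n → Finset (ZMod n)
  | Sum.inl k => {k}
  | Sum.inr k => {k, k + 1}

/-- The connection Laplacian of the cycle complex `C_n`, a `2n × 2n` real
matrix indexed by `ZMod n ⊕ ZMod n`, with entry `1` when the corresponding
simplices intersect and `0` otherwise. -/
def cycleConnection (n : ℕ) : Matrix (ZMod n ⊕ ZMod n) (ZMod n ⊕ ZMod n) ℝ :=
  fun x y => if (cycleSimplex n x ∩ cycleSimplex n y).Nonempty then 1 else 0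

lemma cc_sum_ll (n : ℕ) [NeZero n] (k j : ZMod n) :
    cycleConnection n (Sum.inl k) (Sum.inl j) = if j = k then 1 else 0 := by
  simp only [cycleConnection, cycleSimplex]
  congr 1
  simp only [Finset.Nonempty, Finset.mem_inter, Finset.mem_singleton, eq_iff_iff]
  constructor
  · rintro ⟨x, rfl, rfl⟩; rfl
  · rintro rfl; exact ⟨j, rfl, rfl⟩

lemma cc_one_ne (n : ℕ) (hn : 3 ≤ n) : (1 : ZMod n) ≠ 0 := by
  intro h
  have h1 : ((1 : ℕ) : ZMod n) = 0 := by exact_mod_cast h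
  rw [ZMod.natCast_eq_zero_iff] at h1
  have := Nat.le_of_dvd (by norm_num) h1
  omega

lemma cc_two_ne (n : ℕ) (hn : 3 ≤ n) : (2 : ZMod n) ≠ 0 := by
  intro h
  have h1 : ((2 : ℕ) : ZMod n) = 0 := by exact_mod_cast h
  rw [ZMod.natCast_eq_zero_iff] at h1
  have := Nat.le_of_dvd (by norm_num) h1
  omega

lemma cc_sum_lr (n : ℕ) [NeZero n] (hn : 3 ≤ n) (k j : ZMod n) :
    cycleConnection n (Sum.inl k) (Sum.inr j)
      = (if j = k then 1 else 0) + (if j = k - 1 then 1 else 0) := by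
  have h1 := cc_one_ne n hn
  have : (cycleSimplex n (Sum.inl k) ∩ cycleSimplex n (Sum.inr j)).Nonempty ↔
      (j = k ∨ j = k - 1) := by
    simp only [cycleSimplex, Finset.Nonempty, Finset.mem_inter, Finset.mem_singleton,
      Finset.mem_insert]
    constructor
    · rintro ⟨x, rfl, rfl | rfl⟩ <;> simp
    · rintro (rfl | rfl)
      · exact ⟨j, by simp⟩
      · exact ⟨k, by simp⟩
  simp only [cycleConnection, this]
  have hne : k ≠ k - 1 := by
    intro h; apply h1; linear_combination h
  by_cases ha : j = k
  · subst ha; simp [hne]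
  · simp [ha]

lemma cc_sum_rl (n : ℕ) [NeZero n] (hn : 3 ≤ n) (k j : ZMod n) :
    cycleConnection n (Sum.inr k) (Sum.inl j)
      = (if j = k then 1 else 0) + (if j = k + 1 then 1 else 0) := by
  have h1 := cc_one_ne n hn
  have : (cycleSimplex n (Sum.inr k) ∩ cycleSimplex n (Sum.inl j)).Nonempty ↔
      (j = k ∨ j = k + 1) := by
    simp only [cycleSimplex, Finset.Nonempty, Finset.mem_inter, Finset.mem_singleton,
      Finset.mem_insert]
    constructor
    · rintro ⟨x, h, rfl⟩; exact h
    · intro h; exact ⟨j, h, rfl⟩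
  simp only [cycleConnection, this]
  have hne : k ≠ k + 1 := by
    intro h; apply h1; linear_combination -h
  by_cases ha : j = k
  · subst ha; simp [h1]
  · simp [ha]

lemma cc_sum_rr (n : ℕ) [NeZero n] (hn : 3 ≤ n) (k j : ZMod n) :
    cycleConnection n (Sum.inr k) (Sum.inr j)
      = (if j = k then 1 else 0) + (if j = k + 1 then 1 else 0)
        + (if j = k - 1 then 1 else 0) := by
  have h1 := cc_one_ne n hn
  have h2 := cc_two_ne n hn
  have : (cycleSimplex n (Sum.inr k) ∩ cycleSimplex n (Sum.inr j)).Nonempty ↔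
      (j = k ∨ j = k + 1 ∨ j = k - 1) := by
    simp only [cycleSimplex, Finset.Nonempty, Finset.mem_inter, Finset.mem_singleton,
      Finset.mem_insert]
    constructor
    · rintro ⟨x, rfl | rfl, h | h⟩
      · left; exact h.symm
      · right; right; rw [h]; ring
      · right; left; exact h.symm
      · left; linear_combination -h
    · rintro (rfl | rfl | rfl)
      · exact ⟨j, by simp⟩
      · exact ⟨k + 1, by simp⟩
      · exact ⟨k, by simp⟩
  simp only [cycleConnection, this]
  have hne1 : k ≠ k + 1 := by
    intro h; apply h1; linear_combination -h
  have hne2 : k ≠ k - 1 := by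
    intro h; apply h1; linear_combination h
  have hne3 : k + 1 ≠ k - 1 := by
    intro h; apply h2; linear_combination h
  by_cases ha : j = k
  · rw [if_pos (Or.inl ha), if_pos ha, if_neg (ha ▸ hne1), if_neg (ha ▸ hne2)]; norm_num
  · by_cases hb : j = k + 1
    · rw [if_pos (Or.inr (Or.inl hb)), if_neg ha, if_pos hb, if_neg (hb ▸ hne3)]; norm_num
    · simp [ha, hb]

/-- Membership in the spectrum in terms of a pair of functions. -/
lemma cc_mem_spectrum (n : ℕ) [NeZero n] (hn : 3 ≤ n) (lam : ℝ) :
    lam ∈ spectrum ℝ (cycleConnection n) ↔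
      ∃ v e : ZMod n → ℝ, ((∃ k, v k ≠ 0) ∨ (∃ k, e k ≠ 0)) ∧
        (∀ k, v k + e k + e (k - 1) = lam * v k) ∧
        (∀ k, v k + v (k + 1) + e k + e (k + 1) + e (k - 1) = lam * e k) := by
  have key : ∀ w : ZMod n ⊕ ZMod n → ℝ, ((cycleConnection n) *ᵥ w = lam • w) ↔
      (∀ k, w (.inl k) + w (.inr k) + w (.inr (k - 1)) = lam * w (.inl k)) ∧
      (∀ k, w (.inl k) + w (.inl (k + 1)) + w (.inr k) + w (.inr (k + 1)) + w (.inr (k - 1))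
        = lam * w (.inr k)) := by
    intro w
    rw [funext_iff, Sum.forall]
    simp [Matrix.mulVec, dotProduct, Fintype.sum_sum_type, cc_sum_ll, cc_sum_lr n hn,
      cc_sum_rl n hn, cc_sum_rr n hn, add_mul, Finset.sum_add_distrib, add_assoc]
  rw [← Matrix.spectrum_toLin', ← Module.End.hasEigenvalue_iff_mem_spectrum]
  constructor
  · intro h
    obtain ⟨w, hw⟩ := h.exists_hasEigenvector
    have h1 := hw.apply_eq_smul
    rw [Matrix.toLin'_apply, key] at h1
    refine ⟨fun k => w (.inl k), fun k => w (.inr k), ?_, h1.1, h1.2⟩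
    by_contra! hc
    apply hw.2
    funext x
    rcases x with x | x
    · exact hc.1 x
    · exact hc.2 x
  · rintro ⟨v, e, hne, h1, h2⟩
    apply Module.End.hasEigenvalue_of_hasEigenvector (x := Sum.elim v e)
    rw [Module.End.hasEigenvector_iff, Module.End.mem_eigenspace_iff]
    constructor
    · rw [Matrix.toLin'_apply, key]
      exact ⟨h1, h2⟩
    · intro h0
      rcases hne with ⟨k, hk⟩ | ⟨k, hk⟩
      · exact hk (congrFun h0 (.inl k))
      · exact hk (congrFun h0 (.inr k))

/-- Eigenvalues of the shift-symmetrised operator on `ZMod n`. -/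
lemma cc_circulant (n : ℕ) [NeZero n] (w : ZMod n → ℝ) (hw : ∃ k, w k ≠ 0) (c : ℝ)
    (h : ∀ k, w (k - 1) + w (k + 1) = c * w k) :
    ∃ k : Fin n, c = 2 * Real.cos (2 * (Real.pi * (k : ℝ) / (n : ℝ))) := by
  let W : ZMod n → ℂ := fun k => (w k : ℂ)
  have hW : W ≠ 0 := by
    obtain ⟨k, hk⟩ := hw
    intro h0
    have : (w k : ℂ) = 0 := congrFun h0 k
    exact hk (by exact_mod_cast this)
  have hF : ZMod.dft W ≠ 0 := by
    intro h0
    exact hW ((LinearEquiv.map_eq_zero_iff _).1 h0)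
  obtain ⟨k, hk⟩ := Function.ne_iff.1 hF
  have e1 : ∑ j : ZMod n, ZMod.stdAddChar (-(j * k)) • W (j + 1)
      = ZMod.stdAddChar k * ZMod.dft W k := by
    rw [ZMod.dft_apply, Finset.mul_sum, ← Equiv.sum_comp (Equiv.addRight (1 : ZMod n))
      (fun j => ZMod.stdAddChar k * (ZMod.stdAddChar (-(j * k)) • W j))]
    refine Finset.sum_congr rfl fun j _ => ?_
    simp only [Equiv.coe_addRight, smul_eq_mul]
    rw [← mul_assoc, ← AddChar.map_add_eq_mul]
    congr 2; ring
  have e2 : ∑ j : ZMod n, ZMod.stdAddChar (-(j * k)) • W (j - 1)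
      = ZMod.stdAddChar (-k) * ZMod.dft W k := by
    rw [ZMod.dft_apply, Finset.mul_sum, ← Equiv.sum_comp (Equiv.subRight (1 : ZMod n))
      (fun j => ZMod.stdAddChar (-k) * (ZMod.stdAddChar (-(j * k)) • W j))]
    refine Finset.sum_congr rfl fun j _ => ?_
    simp only [Equiv.subRight_apply, smul_eq_mul]
    rw [← mul_assoc, ← AddChar.map_add_eq_mul]
    congr 2; ring
  have e3 : ZMod.stdAddChar (-k) * ZMod.dft W k + ZMod.stdAddChar k * ZMod.dft W k
      = (c : ℂ) * ZMod.dft W k := by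
    rw [← e1, ← e2, ZMod.dft_apply, Finset.mul_sum, ← Finset.sum_add_distrib]
    refine Finset.sum_congr rfl fun j _ => ?_
    have : W (j - 1) + W (j + 1) = c * W j := by
      simp only [W]; exact_mod_cast h j
    simp only [smul_eq_mul]
    linear_combination (ZMod.stdAddChar (-(j * k)) : ℂ) * this
  have e4 : (ZMod.stdAddChar (-k) : ℂ) + ZMod.stdAddChar k = c := by
    apply mul_right_cancel₀ hk
    linear_combination e3
  refine ⟨⟨k.val, ZMod.val_lt k⟩, ?_⟩
  have e5 : (ZMod.stdAddChar k : ℂ)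
      = Complex.exp (((2 * (Real.pi * (k.val : ℝ) / (n : ℝ)) : ℝ) : ℂ) * Complex.I) := by
    rw [ZMod.stdAddChar_apply, ZMod.toCircle_apply]
    congr 1; push_cast; ring
  rw [AddChar.map_neg_eq_inv, e5, ← Complex.exp_neg] at e4
  have e6 : ((2 * Real.cos (2 * (Real.pi * (k.val : ℝ) / (n : ℝ))) : ℝ) : ℂ) = c := by
    rw [← e4, Complex.ofReal_mul, Complex.ofReal_cos, Complex.ofReal_ofNat,
      Complex.two_cos, neg_mul]
    ring
  exact_mod_cast e6.symm

lemma cc_cos_mod (n : ℕ) [NeZero n] (k m : ℕ) (p : ℝ) :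
    Real.cos (2 * (Real.pi * k / n) * ((m % n : ℕ) : ℝ) + p)
      = Real.cos (2 * (Real.pi * k / n) * (m : ℝ) + p) := by
  have hn : (n : ℝ) ≠ 0 := by exact_mod_cast NeZero.ne n
  have hm : (m : ℝ) = ((m % n : ℕ) : ℝ) + n * ((m / n : ℕ) : ℝ) := by
    exact_mod_cast (Nat.mod_add_div m n).symm
  rw [hm, ← Real.cos_add_nat_mul_two_pi _ (k * (m / n))]
  congr 1
  push_cast
  field_simp
  ring

lemma cc_cos_succ (n : ℕ) [NeZero n] (hn : 3 ≤ n) (k : ℕ) (p : ℝ) (j : ZMod n) :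
    Real.cos (2 * (Real.pi * k / n) * ((j + 1).val : ℝ) + p)
      = Real.cos (2 * (Real.pi * k / n) * (j.val : ℝ) + 2 * (Real.pi * k / n) + p) := by
  have : Fact (1 < n) := ⟨by omega⟩
  rw [ZMod.val_add, ZMod.val_one, cc_cos_mod]
  congr 1
  push_cast
  ring

lemma cc_cos_pred (n : ℕ) [NeZero n] (hn : 3 ≤ n) (k : ℕ) (p : ℝ) (j : ZMod n) :
    Real.cos (2 * (Real.pi * k / n) * ((j - 1).val : ℝ) + p)
      = Real.cos (2 * (Real.pi * k / n) * (j.val : ℝ) - 2 * (Real.pi * k / n) + p) := by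
  have := cc_cos_succ n hn k (p - 2 * (Real.pi * k / n)) (j - 1)
  rw [sub_add_cancel] at this
  convert this.symm using 2 <;> ring

/-- Explicit spectrum of the connection Laplacian of `C_n`: the eigenvalues are
precisely the solutions of `λ² - 4cos²(πk/n)·λ - 1 = 0` for `k = 0, …, n-1`,
i.e. the numbers `f^±(4cos²(πk/n))` with `f^±(y) = (y ± √(y²+4))/2`. -/
theorem spectrum_cycleConnection (n : ℕ) [NeZero n] (hn : 3 ≤ n) :
    spectrum ℝ (cycleConnection n)
      = {lam : ℝ | ∃ k : Fin n,
          lam ^ 2 - 4 * Real.cos (Real.pi * (k : ℝ) / (n : ℝ)) ^ 2 * lam - 1 = 0} := by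
  ext lam
  rw [cc_mem_spectrum n hn, Set.mem_ofPred_eq]
  constructor
  · rintro ⟨v, e, hne, h1, h2⟩
    have h3 : ∀ k, lam * (v k + v (k + 1)) = (lam + 1) * e k := by
      intro k
      have a := h1 k
      have b := h1 (k + 1)
      rw [add_sub_cancel_right] at b
      linear_combination h2 k - a - b
    have hl : lam ≠ 0 := by
      rintro rfl
      have he : ∀ k, e k = 0 := fun k => by linarith [h3 k]
      have hv : ∀ k, v k = 0 := fun k => by linarith [h1 k, he k, he (k - 1)]
      rcases hne with ⟨k, hk⟩ | ⟨k, hk⟩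
      · exact hk (hv k)
      · exact hk (he k)
    have fin : ∀ w : ZMod n → ℝ, (∃ k, w k ≠ 0) →
        (∀ k, lam * (w (k - 1) + w (k + 1) + 2 * w k) = (lam ^ 2 - 1) * w k) →
        ∃ k : Fin n,
          lam ^ 2 - 4 * Real.cos (Real.pi * (k : ℝ) / (n : ℝ)) ^ 2 * lam - 1 = 0 := by
      intro w hw h
      obtain ⟨k, hk⟩ := cc_circulant n w hw ((lam ^ 2 - 1) / lam - 2) (fun k => by
        apply mul_left_cancel₀ hl
        have : lam * (((lam ^ 2 - 1) / lam - 2) * w k) = (lam ^ 2 - 1 - 2 * lam) * w k := by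
          field_simp
        rw [this]
        linear_combination h k)
      refine ⟨k, ?_⟩
      rw [Real.cos_two_mul] at hk
      field_simp at hk
      linear_combination hk
    rcases hne with hv | he
    · refine fin v hv fun k => ?_
      have a := h3 (k - 1)
      rw [sub_add_cancel] at a
      linear_combination h3 k + a + (lam + 1) * h1 k
    · refine fin e he fun k => ?_
      have a := h1 (k + 1)
      rw [add_sub_cancel_right] at a
      linear_combination lam * h1 k + lam * a + (lam - 1) * h3 k
  · rintro ⟨k, hk⟩
    set t : ℝ := Real.pi * (k : ℝ) / (n : ℝ) with ht
    have S := cc_cos_succ n hn k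
    have P := cc_cos_pred n hn k
    rw [← ht] at S P
    have T : ∀ x : ℝ, Real.cos x + Real.cos (x + 2 * t)
        = 2 * Real.cos t * Real.cos (x + t) := by
      intro x
      have a : Real.cos x = Real.cos ((x + t) - t) := by congr 1; ring
      have b : Real.cos (x + 2 * t) = Real.cos ((x + t) + t) := by congr 1; ring
      rw [a, b, Real.cos_sub, Real.cos_add (x + t) t]
      ring
    by_cases hl : lam = 1
    · subst hl
      have hc : Real.cos t = 0 := by
        have : Real.cos t ^ 2 = 0 := by linarith
        exact pow_eq_zero_iff (two_ne_zero) |>.1 this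
      have key : ∀ j : ZMod n, Real.cos (2 * t * (j.val : ℝ) + 0)
          + Real.cos (2 * t * ((j + 1).val : ℝ) + 0) = 0 := by
        intro j
        have := T (2 * t * (j.val : ℝ))
        rw [hc] at this
        rw [S]
        simp only [add_zero]
        linarith
      refine ⟨fun j => Real.cos (2 * t * (j.val : ℝ) + 0), fun _ => 0, Or.inl ⟨0, ?_⟩, ?_, ?_⟩
      · simp
      · intro j; simp
      · intro j
        simpa using key j
    · refine ⟨fun j => 2 * Real.cos t * Real.cos (2 * t * (j.val : ℝ) + (-t)),
        fun j => (lam - 1) * Real.cos (2 * t * (j.val : ℝ) + 0), Or.inr ⟨0, ?_⟩, ?_, ?_⟩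
      · simpa [sub_eq_zero] using hl
      · intro j
        simp only [P]
        simp only [add_zero]
        have a := T (2 * t * (j.val : ℝ) - 2 * t)
        rw [sub_add_cancel, show 2 * t * (j.val : ℝ) - 2 * t + t
          = 2 * t * (j.val : ℝ) + -t by ring] at a
        linear_combination (lam - 1) * a
      · intro j
        simp only [P, S]
        simp only [add_zero]
        have a := T (2 * t * (j.val : ℝ) + -t)
        rw [show 2 * t * (j.val : ℝ) + -t + 2 * t
          = 2 * t * (j.val : ℝ) + 2 * t + -t by ring, neg_add_cancel_right] at a
        rw [Real.cos_add _ (2 * t), Real.cos_sub _ (2 * t), Real.cos_two_mul]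
        linear_combination 2 * Real.cos t * a - Real.cos (2 * t * (j.val : ℝ)) * hk
end

section
/- Let A be an n × n real matrix and k ≤ n. Then the characteristic polynomial of AᵀA satisfies charpoly(AᵀA).coeff(n − k) = (−1)^k · Σ over all pairs (I, J) of subsets of {1,…,n} with |I| = |J| = k of det(A_{I,J})², where A_{I,J} is the k × k submatrix of A obtained by selecting the rows in I and the columns in J (via their monotone enumerations). -/
open Matrix

/-- Coefficients of the characteristic polynomial as sums of principal minors, indexed by
monotone enumerations. -/
theorem charpoly_coeff_minors_aux (n k : ℕ) (hk : k ≤ n) (M : Matrix (Fin n) (Fin n) ℝ) :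
    M.charpoly.coeff (n - k) = (-1 : ℝ) ^ k *
      ∑ I : {s : Finset (Fin n) // s.card = k},
        (M.submatrix (I.1.orderEmbOfFin I.2) (I.1.orderEmbOfFin I.2)).det := by
  have h := M.charpoly_coeff_eq_sum_minors k (by simpa using hk)
  rw [Fintype.card_fin] at h
  rw [h]
  congr 1
  rw [Finset.sum_subtype (p := fun s : Finset (Fin n) => s.card = k) _
    (fun s => by simp [Finset.mem_powersetCard])]
  refine Finset.sum_congr rfl fun I _ => ?_
  rw [← Matrix.det_submatrix_equiv_self (I.1.orderIsoOfFin I.2).toEquiv]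
  rfl

/-- Cauchy–Binet for `BᵀB`. -/
theorem det_transpose_mul_self_aux (n k : ℕ) (hk : k ≤ n) (B : Matrix (Fin n) (Fin k) ℝ) :
    (Bᵀ * B).det = ∑ I : {s : Finset (Fin n) // s.card = k},
        (B.submatrix (I.1.orderEmbOfFin I.2) id).det ^ 2 := by
  have h1 := charpoly_coeff_minors_aux n k hk (B * Bᵀ)
  rw [Matrix.charpoly_mul_comm_of_le B Bᵀ (by simpa using hk), Fintype.card_fin,
    Fintype.card_fin, Polynomial.coeff_X_pow_mul', if_pos le_rfl, Nat.sub_self] at h1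
  rw [Matrix.det_eq_sign_charpoly_coeff, h1, Fintype.card_fin, ← mul_assoc, ← mul_pow]
  norm_num
  refine Finset.sum_congr rfl fun I _ => ?_
  have : (B * Bᵀ).submatrix (I.1.orderEmbOfFin I.2) (I.1.orderEmbOfFin I.2)
      = B.submatrix (I.1.orderEmbOfFin I.2) id * (B.submatrix (I.1.orderEmbOfFin I.2) id)ᵀ := by
    ext i j
    simp [Matrix.mul_apply]
  rw [this, Matrix.det_mul, Matrix.det_transpose, sq]

/-- Generalized Cauchy–Binet / Pythagoras identity: every coefficient of the
characteristic polynomial of `AᵀA` is, up to sign, a sum of squares of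
`k × k` minors of `A`:
`charpoly(AᵀA).coeff (n-k) = (-1)^k · Σ_{|I|=|J|=k} det(A_{I,J})²`. -/
theorem charpoly_transpose_mul_self_coeff
    (n k : ℕ) (hk : k ≤ n) (A : Matrix (Fin n) (Fin n) ℝ) :
    (Aᵀ * A).charpoly.coeff (n - k)
      = (-1 : ℝ) ^ k *
        ∑ I : {s : Finset (Fin n) // s.card = k},
          ∑ J : {s : Finset (Fin n) // s.card = k},
            (A.submatrix (I.1.orderEmbOfFin I.2) (J.1.orderEmbOfFin J.2)).det ^ 2 := by
  rw [charpoly_coeff_minors_aux n k hk, Finset.sum_comm]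
  congr 1
  refine Finset.sum_congr rfl fun J _ => ?_
  have : (Aᵀ * A).submatrix (J.1.orderEmbOfFin J.2) (J.1.orderEmbOfFin J.2)
      = (A.submatrix id (J.1.orderEmbOfFin J.2))ᵀ * A.submatrix id (J.1.orderEmbOfFin J.2) := by
    ext i j
    simp [Matrix.mul_apply]
  rw [this, det_transpose_mul_self_aux n k hk]
  rfl
end

section
/- Let G be a one-dimensional finite abstract simplicial complex on vertex set V, let a ≠ b be vertices with {a}, {b} ∈ G and e = {a,b} ∉ G, and let H = G ∪ {e} (again a simplicial complex) with N = |H|. For t ∈ ℝ let K(t) be the real matrix indexed by H with K(t)(x,y) = 0 if x ∩ y = ∅; K(t)(x,y) = t if x ∩ y ≠ ∅ and exactly one of x, y equals e; and K(t)(x,y) = 1 otherwise (so K(1) is the connection Laplacian of H). Write p_k(M) = (−1)^k · charpoly(M).coeff(N − k). Then for every k ≤ N there exists an integer C such that for all t ∈ ℝ, p_k(K(t)²) − p_{N−k}(K(t)²) = C · t² · (1 − t²). -/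
open Matrix

/-- The deformed connection matrix `K(t)` indexed by the simplices of `H`: the
entry is `0` if the simplices are disjoint, `t` if they intersect and exactly
one of them equals the marked simplex `e`, and `1` otherwise. -/
def deformedK {V : Type*} [DecidableEq V] (H : Finset (Finset V)) (e : Finset V) (t : ℝ) :
    Matrix H H ℝ :=
  fun x y =>
    if (x.1 ∩ y.1).Nonempty then
      if (x.1 = e ∧ y.1 ≠ e) ∨ (x.1 ≠ e ∧ y.1 = e) then t else 1
    else 0


section ArtilleryHelpers

open Polynomial

/-- Scaling the off-diagonal part of one row and one column by `t`. -/
lemma art_det_scale {n R : Type*} [Fintype n] [DecidableEq n] [CommRing R] (e : n)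
    (A : Matrix n n R) (t : R) :
    det (Matrix.of fun i j => (if (i = e ∧ j ≠ e) ∨ (i ≠ e ∧ j = e) then t else 1) * A i j)
      = (1 - t ^ 2) *
        det (Matrix.of fun i j => (if (i = e ∧ j ≠ e) ∨ (i ≠ e ∧ j = e) then 0 else 1) * A i j)
        + t ^ 2 * det A := by
  have key : ∀ (s : R) (σ : Equiv.Perm n),
      (∏ i, (if (σ i = e ∧ i ≠ e) ∨ (σ i ≠ e ∧ i = e) then s else 1))
        = if σ e = e then 1 else s ^ 2 := by
    intro s σ
    split_ifs with h
    · apply Finset.prod_eq_one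
      intro i _
      rw [if_neg]
      rintro (⟨h1, h2⟩ | ⟨h1, h2⟩)
      · exact h2 (σ.injective (h1.trans h.symm))
      · exact h1 (h2 ▸ h)
    · have : ∀ i, (if (σ i = e ∧ i ≠ e) ∨ (σ i ≠ e ∧ i = e) then s else 1)
          = (if i = e then s else 1) * (if i = σ.symm e then s else 1) := by
        intro i
        have h3 : i = σ.symm e ↔ σ i = e := by
          rw [Equiv.eq_symm_apply]
        by_cases h1 : i = e
        · subst h1
          simp [h3, h]
        · by_cases h2 : σ i = e <;> simp [h1, h2, h3]
      simp_rw [this]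
      rw [Finset.prod_mul_distrib]
      simp [sq]
  simp only [det_apply, Matrix.of_apply, Finset.prod_mul_distrib, key, Finset.mul_sum]
  rw [← Finset.sum_add_distrib]
  refine Finset.sum_congr rfl fun σ _ => ?_
  split_ifs
  · simp only [Units.smul_def, zsmul_eq_mul]; ring
  · simp only [Units.smul_def, zsmul_eq_mul]; ring

/-- The characteristic polynomial of a square, at `X²`. -/
lemma art_charpoly_sq {n : Type*} [Fintype n] [DecidableEq n] (K : Matrix n n ℝ) :
    expand ℝ 2 (K ^ 2).charpoly
      = C ((-1) ^ Fintype.card n) * (K.charpoly * K.charpoly.comp (-X)) := by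
  apply Polynomial.funext
  intro x
  simp only [expand_eval, eval_mul, eval_C, eval_comp, eval_neg, eval_X, Matrix.eval_charpoly]
  rw [mul_left_comm, ← det_neg, ← det_mul]
  congr 1
  have h : Commute (scalar n x) K := scalar_commute x (fun r => Commute.all _ _) K
  have h2 : scalar n (-x) = - scalar n x := by simp
  rw [h2, map_pow, neg_sub, sub_neg_eq_add, add_comm K, sub_mul, mul_add, mul_add, h.eq, sq, sq]
  abel

lemma art_pal {n : Type*} [Fintype n] [DecidableEq n] (S : Matrix n n ℝ)
    (h : ∀ l : ℝ, 0 < l → l < 1 → det (1 - (l ^ 2) • S) = det (S - scalar n (l ^ 2)))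
    (k : ℕ) (hk : k ≤ Fintype.card n) :
    (-1 : ℝ) ^ k * S.charpoly.coeff (Fintype.card n - k)
      = (-1 : ℝ) ^ (Fintype.card n - k) * S.charpoly.coeff k := by
  have h1 : S.charpolyRev = C ((-1) ^ Fintype.card n) * S.charpoly := by
    apply Polynomial.eq_of_infinite_eval_eq
    refine Set.Infinite.mono ?_ (Set.Ioo_infinite (show (0 : ℝ) < 1 by norm_num))
    intro x hx
    have hx' := h (Real.sqrt x) (Real.sqrt_pos.2 hx.1)
      (by rw [Real.sqrt_lt' one_pos]; simpa using hx.2)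
    rw [Real.sq_sqrt hx.1.le] at hx'
    simp only [Set.mem_ofPred_eq, eval_mul, eval_C, Matrix.eval_charpoly]
    rw [← det_neg, neg_sub, ← hx', Matrix.charpolyRev, ← coe_evalRingHom, RingHom.map_det]
    congr 1
    ext i j
    simp [Matrix.one_apply, apply_ite]
    ring
  have h2 : S.charpoly.coeff (Fintype.card n - k) = (-1) ^ Fintype.card n * S.charpoly.coeff k := by
    have := congrArg (fun p => coeff p k) h1
    simp only [coeff_C_mul] at this
    rw [← this, ← Matrix.reverse_charpoly, coeff_reverse, Matrix.charpoly_natDegree_eq_dim,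
      revAt_le hk]
  rw [h2]
  obtain ⟨m, hm⟩ := Nat.exists_eq_add_of_le hk
  rw [hm, Nat.add_sub_cancel_left, pow_add, ← mul_assoc, ← mul_assoc, ← pow_add, ← two_mul]
  simp

lemma art_blocks {m n : Type*} [Fintype m] [DecidableEq m] [Fintype n] [DecidableEq n]
    (B : Matrix m n ℝ) (M : Matrix (m ⊕ n) (m ⊕ n) ℝ)
    (hM : M = fromBlocks 1 B Bᵀ (Bᵀ * B - 1)) (l : ℝ) (h0 : 0 < l) (h1 : l < 1) :
    det (1 - (l ^ 2) • M ^ 2) = det (M ^ 2 - scalar (m ⊕ n) (l ^ 2)) := by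
  have e1 : ∀ x : ℝ, 1 - x ≠ 0 → det (1 - x • M)
      = (1 - x) ^ Fintype.card m * det ((1 + x) • 1 - (x / (1 - x)) • (Bᵀ * B)) := by
    intro x hx
    have : 1 - x • M = fromBlocks ((1 - x) • 1) ((-x) • B) ((-x) • Bᵀ)
        (1 - x • (Bᵀ * B - 1)) := by
      rw [hM, ← fromBlocks_one, fromBlocks_smul, sub_eq_add_neg, fromBlocks_neg, fromBlocks_add]
      congr 1 <;> module
    let _inv : Invertible ((1 - x) • (1 : Matrix m m ℝ)) :=
      ⟨(1 - x)⁻¹ • 1, by simp [smul_smul, hx], by simp [smul_smul, hx]⟩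
    have hinv : ⅟ ((1 - x) • (1 : Matrix m m ℝ)) = (1 - x)⁻¹ • 1 := rfl
    rw [this, det_fromBlocks₁₁, hinv]
    congr 1
    · simp
    · congr 1
      simp only [Matrix.smul_mul, Matrix.mul_smul, smul_smul, Matrix.mul_one]
      match_scalars <;> field_simp <;> ring
  have e2 : ∀ x : ℝ, 1 - x ≠ 0 → det (M - x • 1)
      = (1 - x) ^ Fintype.card m * det (-((1 + x) • 1 + (x / (1 - x)) • (Bᵀ * B))) := by
    intro x hx
    have : M - x • 1 = fromBlocks ((1 - x) • 1) B Bᵀ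
        ((Bᵀ * B - 1) - x • 1) := by
      rw [hM, ← fromBlocks_one, fromBlocks_smul, sub_eq_add_neg, fromBlocks_neg, fromBlocks_add]
      congr 1 <;> module
    let _inv : Invertible ((1 - x) • (1 : Matrix m m ℝ)) :=
      ⟨(1 - x)⁻¹ • 1, by simp [smul_smul, hx], by simp [smul_smul, hx]⟩
    have hinv : ⅟ ((1 - x) • (1 : Matrix m m ℝ)) = (1 - x)⁻¹ • 1 := rfl
    rw [this, det_fromBlocks₁₁, hinv]
    congr 1
    · simp
    · congr 1
      simp only [Matrix.smul_mul, Matrix.mul_smul, Matrix.mul_one]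
      match_scalars <;> field_simp <;> ring
  have f1 : 1 - (l ^ 2) • M ^ 2 = (1 - l • M) * (1 - (-l) • M) := by
    simp only [sub_mul, mul_sub, smul_mul_assoc, mul_smul_comm, one_mul, mul_one, pow_two M]
    module
  have f2 : M ^ 2 - scalar (m ⊕ n) (l ^ 2) = (M - l • 1) * (M - (-l) • 1) := by
    have : scalar (m ⊕ n) (l ^ 2) = (l ^ 2) • (1 : Matrix (m ⊕ n) (m ⊕ n) ℝ) := by
      rw [smul_one_eq_diagonal]; rfl
    rw [this]
    simp only [sub_mul, mul_sub, smul_mul_assoc, mul_smul_comm, one_mul, mul_one, pow_two M]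
    module
  have hl : 1 - l ≠ 0 := by linarith
  have hl' : 1 - -l ≠ 0 := by linarith
  have hl'' : 1 + l ≠ 0 := by linarith
  have hkey : det ((1 + l) • 1 - (l / (1 - l)) • (Bᵀ * B))
        * det ((1 + -l) • 1 - (-l / (1 - -l)) • (Bᵀ * B))
      = det (-((1 + l) • 1 + (l / (1 - l)) • (Bᵀ * B)))
        * det (-((1 + -l) • 1 + (-l / (1 - -l)) • (Bᵀ * B))) := by
    rw [← det_mul, ← det_mul]
    congr 1
    simp only [sub_mul, mul_sub, add_mul, mul_add, smul_mul_assoc, mul_smul_comm, one_mul, mul_one,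
      neg_mul, mul_neg]
    match_scalars <;> simp <;> field_simp <;> ring
  rw [f1, f2, det_mul, det_mul, e1 l hl, e1 (-l) hl', e2 l hl, e2 (-l) hl']
  linear_combination (1 - l) ^ Fintype.card m * (1 - -l) ^ Fintype.card m * hkey

lemma art_blocks' {n : Type*} [Fintype n] [DecidableEq n] (p : n → Prop) [DecidablePred p]
    (M : Matrix n n ℝ)
    (h11 : ∀ x y, p x → p y → M x y = if x = y then 1 else 0)
    (hs : ∀ x y, M x y = M y x)
    (h22 : ∀ x y, ¬ p x → ¬ p y → M x y
      = (∑ z : {z // p z}, M z x * M z y) - if x = y then 1 else 0)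
    (l : ℝ) (h0 : 0 < l) (h1 : l < 1) :
    det (1 - (l ^ 2) • M ^ 2) = det (M ^ 2 - scalar n (l ^ 2)) := by
  have key := art_blocks (Matrix.of fun (x : {x // p x}) (y : {x // ¬ p x}) => M x y)
    (M.submatrix (Equiv.sumCompl p) (Equiv.sumCompl p)) (by
      ext (x | x) (y | y)
      · simp [h11 x y x.2 y.2, Matrix.one_apply, Subtype.ext_iff]
      · simp
      · simp [hs x y]
      · simp [h22 x y x.2 y.2, Matrix.one_apply, Subtype.ext_iff, Matrix.mul_apply]) l h0 h1
  rw [← det_submatrix_equiv_self (Equiv.sumCompl p) (1 - (l ^ 2) • M ^ 2),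
    ← det_submatrix_equiv_self (Equiv.sumCompl p) (M ^ 2 - scalar n (l ^ 2))]
  convert key using 2
  · rw [pow_two M, pow_two (M.submatrix _ _), submatrix_mul_equiv]
    ext x y
    simp [Matrix.one_apply]
  · rw [pow_two M, pow_two (M.submatrix _ _), submatrix_mul_equiv]
    ext x y
    simp [Matrix.diagonal_apply]

lemma art_charpoly_t {V : Type*} [DecidableEq V] (H : Finset (Finset V)) (e : Finset V)
    (he : e ∈ H) (t : ℝ) :
    (deformedK H e t).charpoly = (1 - (C t) ^ 2) * (deformedK H e 0).charpoly
      + (C t) ^ 2 * (deformedK H e 1).charpoly := by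
  have h : ∀ s : ℝ, charmatrix (deformedK H e s) = Matrix.of fun i j =>
      (if (i = ⟨e, he⟩ ∧ j ≠ ⟨e, he⟩) ∨ (i ≠ ⟨e, he⟩ ∧ j = ⟨e, he⟩) then C s else 1)
        * charmatrix (deformedK H e 1) i j := by
    intro s
    ext1 i j
    rw [Matrix.of_apply]
    by_cases hij : i = j
    · subst hij
      rw [if_neg (by tauto), one_mul, charmatrix_apply_eq, charmatrix_apply_eq]
      have : ∀ s, deformedK H e s i i = if (i.1 ∩ i.1).Nonempty then 1 else 0 := by
        intro s
        unfold deformedK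
        rw [if_neg (show ¬ ((i.1 = e ∧ i.1 ≠ e) ∨ (i.1 ≠ e ∧ i.1 = e)) by tauto)]
      rw [this s, this 1]
    · rw [charmatrix_apply_ne _ _ _ hij, charmatrix_apply_ne _ _ _ hij]
      unfold deformedK
      simp only [Subtype.ext_iff, ne_eq]
      split_ifs <;> simp
  have := art_det_scale (⟨e, he⟩ : H) (charmatrix (deformedK H e 1)) (C t)
  rw [← h t] at this
  have h0 := h 0
  rw [C_0] at h0
  rw [← h0] at this
  exact this

/-- Coefficients of the characteristic polynomial of the square are integral quadratics in `t²`. -/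
lemma art_coeff {V : Type*} [DecidableEq V] (H : Finset (Finset V)) (e : Finset V)
    (he : e ∈ H) (k : ℕ) : ∃ c0 c1 c2 : ℤ, ∀ t : ℝ,
      (deformedK H e t ^ 2).charpoly.coeff k = c0 + c1 * t ^ 2 + c2 * t ^ 4 := by
  have hint : ∀ s : ℤ, ∃ A : Matrix H H ℤ, deformedK H e (s : ℝ) = A.map (Int.castRingHom ℝ) := by
    intro s
    refine ⟨Matrix.of fun x y => if (x.1 ∩ y.1).Nonempty then
      if (x.1 = e ∧ y.1 ≠ e) ∨ (x.1 ≠ e ∧ y.1 = e) then s else 1 else 0, ?_⟩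
    ext x y
    simp only [deformedK, Matrix.map_apply, Matrix.of_apply, apply_ite (Int.castRingHom ℝ)]
    simp
  obtain ⟨A, hA⟩ := hint 0
  obtain ⟨B, hB⟩ := hint 1
  rw [Int.cast_zero] at hA
  rw [Int.cast_one] at hB
  set a := A.charpoly with ha
  set c := B.charpoly - A.charpoly with hc
  let s : ℤ := (-1) ^ Fintype.card H
  refine ⟨s * (a * a.comp (-X)).coeff (k * 2), s * (a * c.comp (-X) + c * a.comp (-X)).coeff (k * 2),
    s * (c * c.comp (-X)).coeff (k * 2), fun t => ?_⟩
  have h1 := congrArg (fun p => coeff p (k * 2)) (art_charpoly_sq (deformedK H e t))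
  rw [coeff_expand_mul (by norm_num)] at h1
  have h2 : (deformedK H e t).charpoly
      = a.map (Int.castRingHom ℝ) + C (t ^ 2) * c.map (Int.castRingHom ℝ) := by
    rw [art_charpoly_t H e he t, hA, hB, charpoly_map, charpoly_map, hc, Polynomial.map_sub, C_pow]
    ring
  have h3 : ∀ q : ℤ[X], (q.map (Int.castRingHom ℝ)).comp (-X)
      = (q.comp (-X)).map (Int.castRingHom ℝ) := by
    intro q
    simp [Polynomial.map_comp]
  rw [h1, h2]
  have h4 : (a.map (Int.castRingHom ℝ) + C (t ^ 2) * c.map (Int.castRingHom ℝ))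
      * (a.map (Int.castRingHom ℝ) + C (t ^ 2) * c.map (Int.castRingHom ℝ)).comp (-X)
      = (a * a.comp (-X)).map (Int.castRingHom ℝ)
        + C (t ^ 2) * (a * c.comp (-X) + c * a.comp (-X)).map (Int.castRingHom ℝ)
        + C (t ^ 4) * (c * c.comp (-X)).map (Int.castRingHom ℝ) := by
    rw [add_comp, mul_comp, C_comp, h3, h3]
    simp only [Polynomial.map_mul, Polynomial.map_add]
    rw [show t ^ 4 = t ^ 2 * t ^ 2 by ring, C_mul (a := t ^ 2) (b := t ^ 2)]
    ring
  rw [h4, coeff_C_mul, coeff_add, coeff_add, coeff_C_mul, coeff_C_mul, coeff_map, coeff_map,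
    coeff_map]
  simp only [s, eq_intCast]
  push_cast
  ring

lemma art_endpoint {V : Type*} [DecidableEq V] (H : Finset (Finset V)) (e : Finset V)
    (he2 : e.card = 2)
    (hne : ∀ x ∈ H, x.Nonempty) (hc : ∀ x ∈ H, x.card ≤ 2)
    (hv : ∀ x ∈ H, ∀ v ∈ x, ({v} : Finset V) ∈ H)
    (s : ℝ) (hs : s = 0 ∨ s = 1) (l : ℝ) (h0 : 0 < l) (h1 : l < 1) :
    det (1 - (l ^ 2) • deformedK H e s ^ 2) = det (deformedK H e s ^ 2 - scalar H (l ^ 2)) := by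
  let M : Matrix H H ℝ := Matrix.of fun x y =>
    if x.1 = e ∧ y.1 = e then 2 * s - 1 else deformedK H e s x y
  have hne' : ∀ x : H, (x.1 ∩ x.1).Nonempty := fun x => by simpa using hne x.1 x.2
  have hM : deformedK H e s ^ 2 = M ^ 2 := by
    ext x y
    rw [sq, sq, Matrix.mul_apply, Matrix.mul_apply]
    refine Finset.sum_congr rfl fun z _ => ?_
    simp only [M, Matrix.of_apply]
    by_cases hz : z.1 = e
    · have hez : e.Nonempty := hz ▸ hne z.1 z.2
      by_cases hx : x.1 = e <;> by_cases hy : y.1 = e <;>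
        rcases hs with rfl | rfl <;> simp [deformedK, hx, hy, hz, hez]
      all_goals norm_num
    · simp [hz]
  rw [hM]
  have hsymm : ∀ x y, deformedK H e s x y = deformedK H e s y x := by
    intro x y
    unfold deformedK
    rw [Finset.inter_comm]
    congr 2
    exact propext (by tauto)
  refine art_blocks' (fun x : H => x.1.card = 1) M ?_ ?_ ?_ l h0 h1
  · intro x y hx hy
    have hxe : x.1 ≠ e := fun h => by rw [h] at hx; omega
    have hye : y.1 ≠ e := fun h => by rw [h] at hy; omega
    obtain ⟨u, hu⟩ := Finset.card_eq_one.1 hx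
    obtain ⟨v, hv⟩ := Finset.card_eq_one.1 hy
    simp only [M, Matrix.of_apply, deformedK, hxe, hye, Subtype.ext_iff]
    simp only [hu, hv]
    by_cases huv : u = v
    · simp [huv]
    · simp [huv]
  · intro x y
    simp only [M, Matrix.of_apply, hsymm x y, and_comm]
  · intro x y hx hy
    have hx2 : x.1.card = 2 := by
      have := hc x.1 x.2
      have := Finset.card_pos.2 (hne x.1 x.2)
      omega
    have hy2 : y.1.card = 2 := by
      have := hc y.1 y.2
      have := Finset.card_pos.2 (hne y.1 y.2)
      omega
    let w : Finset V → ℝ := fun x => if x = e then s else 1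
    have hrow : ∀ (z : {z : H // z.1.card = 1}) (x : H),
        M z.1 x = w x.1 * if (z.1.1 ∩ x.1).Nonempty then 1 else 0 := by
      intro z x
      have hze : z.1.1 ≠ e := fun h => by have := z.2; rw [h] at this; omega
      simp only [M, Matrix.of_apply, deformedK, hze, w]
      by_cases h : x.1 = e <;> simp [h, hze]
    have hsum : (∑ z : {z : H // z.1.card = 1}, M z.1 x * M z.1 y)
        = w x.1 * w y.1 * ((x.1 ∩ y.1).card : ℝ) := by
      simp only [hrow]
      have hterm : ∀ z : {z : H // z.1.card = 1},
          (w x.1 * if (z.1.1 ∩ x.1).Nonempty then (1 : ℝ) else 0)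
            * (w y.1 * if (z.1.1 ∩ y.1).Nonempty then 1 else 0)
          = w x.1 * w y.1 * if (z.1.1 ∩ x.1).Nonempty ∧ (z.1.1 ∩ y.1).Nonempty then 1 else 0 := by
        intro z
        by_cases h : (z.1.1 ∩ x.1).Nonempty <;> by_cases h' : (z.1.1 ∩ y.1).Nonempty <;>
          simp [h, h']
      simp only [hterm]
      rw [← Finset.mul_sum, Finset.sum_boole]
      congr 2
      symm
      refine Finset.card_bij
        (fun v hvv => ⟨⟨{v}, hv x.1 x.2 v (Finset.mem_inter.1 hvv).1⟩, Finset.card_singleton v⟩)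
        ?_ ?_ ?_
      · intro v hvv
        have := Finset.mem_inter.1 hvv
        simp [this.1, this.2]
      · intro u hu v hvv huv
        simpa using huv
      · rintro ⟨⟨z, hzH⟩, hz⟩ hzz
        obtain ⟨v, rfl⟩ := Finset.card_eq_one.1 hz
        refine ⟨v, ?_, rfl⟩
        simpa [Finset.Nonempty, Finset.mem_inter] using hzz
    rw [hsum]
    by_cases hxy : x = y
    · subst hxy
      simp only [Finset.inter_self, hx2, if_true, M, Matrix.of_apply, deformedK, w]
      have := hne x.1 x.2
      by_cases h : x.1 = e <;> rcases hs with rfl | rfl <;> simp_all <;> norm_num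
    · have hcard : (x.1 ∩ y.1).card = if (x.1 ∩ y.1).Nonempty then 1 else 0 := by
        split_ifs with h
        · have h3 := Finset.card_pos.2 h
          have h4 : (x.1 ∩ y.1).card < 2 := by
            by_contra h5
            push Not at h5
            have h6 : x.1 ∩ y.1 = x.1 :=
              Finset.eq_of_subset_of_card_le Finset.inter_subset_left (by omega)
            have h7 : x.1 ∩ y.1 = y.1 :=
              Finset.eq_of_subset_of_card_le Finset.inter_subset_right (by omega)
            exact hxy (Subtype.ext (h6.symm.trans h7))
          omega
        · simpa [Finset.not_nonempty_iff_eq_empty] using h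
      have hxy' : x.1 ≠ y.1 := fun h => hxy (Subtype.ext h)
      rw [hcard, if_neg hxy]
      simp only [M, Matrix.of_apply, deformedK, w]
      by_cases h : x.1 = e <;> by_cases h' : y.1 = e
      · exact absurd (h.trans h'.symm) hxy'
      all_goals simp [h, h']

end ArtilleryHelpers

/-- Artillery proposition: adding a new edge `e = {a,b}` to a one-dimensional
complex `G` and deforming via `K(t)`, each palindrome difference
`p_k(K(t)²) - p_{N-k}(K(t)²)` (with `p_k(M) = (-1)^k·charpoly(M).coeff (N-k)`)
equals `C·t²·(1-t²)` for an integer `C`. -/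
theorem artillery_proposition
    {V : Type*} [Fintype V] [DecidableEq V]
    (G : Finset (Finset V))
    (hSC : IsSimplicialComplex G)
    (hdim : IsOneDimensional G)
    (a b : V) (hab : a ≠ b)
    (ha : ({a} : Finset V) ∈ G) (hb : ({b} : Finset V) ∈ G)
    (he : ({a, b} : Finset V) ∉ G)
    (k : ℕ) (hk : k ≤ (insert ({a, b} : Finset V) G).card) :
    ∃ C : ℤ, ∀ t : ℝ,
      ((-1 : ℝ) ^ k *
          ((deformedK (insert ({a, b} : Finset V) G) ({a, b} : Finset V) t ^ 2).charpoly.coeff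
            ((insert ({a, b} : Finset V) G).card - k)))
        - ((-1 : ℝ) ^ ((insert ({a, b} : Finset V) G).card - k) *
            ((deformedK (insert ({a, b} : Finset V) G) ({a, b} : Finset V) t ^ 2).charpoly.coeff
              k))
        = (C : ℝ) * t ^ 2 * (1 - t ^ 2) := by
  set e : Finset V := {a, b} with hedef
  set H := insert e G with hH
  have heH : e ∈ H := Finset.mem_insert_self _ _
  have he2 : e.card = 2 := Finset.card_pair hab
  have hne : ∀ x ∈ H, x.Nonempty := by
    intro x hx
    rcases Finset.mem_insert.1 hx with rfl | hx
    · exact ⟨a, by simp [hedef]⟩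
    · exact hSC.1 x hx
  have hc : ∀ x ∈ H, x.card ≤ 2 := by
    intro x hx
    rcases Finset.mem_insert.1 hx with rfl | hx
    · exact he2.le
    · exact hdim.1 x hx
  have hv : ∀ x ∈ H, ∀ v ∈ x, ({v} : Finset V) ∈ H := by
    intro x hx v hvx
    apply Finset.mem_insert_of_mem
    rcases Finset.mem_insert.1 hx with rfl | hx
    · rw [hedef, Finset.mem_insert, Finset.mem_singleton] at hvx
      rcases hvx with rfl | rfl
      · exact ha
      · exact hb
    · exact hSC.2 x hx {v} (Finset.singleton_nonempty v) (Finset.singleton_subset_iff.2 hvx)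
  have hend : ∀ s : ℝ, s = 0 ∨ s = 1 →
      (-1 : ℝ) ^ k * (deformedK H e s ^ 2).charpoly.coeff (H.card - k)
        = (-1 : ℝ) ^ (H.card - k) * (deformedK H e s ^ 2).charpoly.coeff k := by
    intro s hs
    have := art_pal (deformedK H e s ^ 2) (art_endpoint H e he2 hne hc hv s hs) k
    rw [Fintype.card_coe] at this
    exact this hk
  obtain ⟨p0, p1, p2, hp⟩ := art_coeff H e heH (H.card - k)
  obtain ⟨q0, q1, q2, hq⟩ := art_coeff H e heH k
  have e0 := hend 0 (Or.inl rfl)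
  have e1 := hend 1 (Or.inr rfl)
  rw [hp, hq] at e0 e1
  refine ⟨(-1) ^ k * p1 - (-1) ^ (H.card - k) * q1, fun t => ?_⟩
  rw [hp, hq]
  push_cast
  linear_combination (1 - t ^ 4) * e0 + t ^ 4 * e1
end

section
/- Let G be a one-dimensional finite abstract simplicial complex on vertex set V, let a ≠ b be vertices with {a}, {b} ∈ G and e = {a,b} ∉ G, let H = G ∪ {e} with N = |H|, and let K(t) be the deformed connection matrix indexed by H (entries: 0 if the simplices are disjoint, t if they intersect and exactly one of them equals e, and 1 otherwise). Then for every k, each coefficient of charpoly(K(t)) is an even quadratic polynomial in t (there exist reals a, b with charpoly(K(t)).coeff k = a + b·t² for all t), and each coefficient of charpoly(K(t)²) is an even quartic polynomial in t (there exist reals a', b', c' with charpoly(K(t)²).coeff k = a' + b'·t² + c'·t⁴ for all t). -/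
open Matrix

/-- Multiply the off-diagonal part of row and column `e` by `t`. -/
def scaleCross {n R : Type*} [DecidableEq n] [CommRing R] (e : n) (t : R) (M : Matrix n n R) :
    Matrix n n R :=
  fun i j => if (i = e ∧ j ≠ e) ∨ (i ≠ e ∧ j = e) then t * M i j else M i j

theorem prod_scaleCross {n R : Type*} [Fintype n] [DecidableEq n] [CommRing R] (e : n) (t : R)
    (M : Matrix n n R) (σ : Equiv.Perm n) :
    ∏ i, scaleCross e t M (σ i) i = (if σ e = e then 1 else t ^ 2) * ∏ i, M (σ i) i := by
  have h : ∀ i, scaleCross e t M (σ i) i =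
      ((if i = e then (if σ e = e then 1 else t) else 1) *
       (if i = σ.symm e then (if σ e = e then 1 else t) else 1)) * M (σ i) i := by
    intro i
    have h1 : i = σ.symm e ↔ σ i = e := by rw [Equiv.eq_symm_apply]
    simp only [scaleCross, h1]
    by_cases hi : i = e
    · subst hi
      by_cases hs : σ i = i <;> simp [hs]
    · by_cases hs : σ i = e
      · have : σ e ≠ e := fun h => hi (σ.injective (hs.trans h.symm))
        simp [hi, hs, this]
      · simp [hi, hs]
  simp only [h, Finset.prod_mul_distrib, Finset.prod_ite_eq', Finset.mem_univ, if_true]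
  split_ifs <;> ring

theorem det_scaleCross {n R : Type*} [Fintype n] [DecidableEq n] [CommRing R] (e : n)
    (M : Matrix n n R) : ∃ P Q : R, ∀ t : R, (scaleCross e t M).det = P + t ^ 2 * Q := by
  refine ⟨∑ σ : Equiv.Perm n, if σ e = e then (Equiv.Perm.sign σ : ℤ) * ∏ i, M (σ i) i else 0,
    ∑ σ : Equiv.Perm n, if σ e = e then 0 else (Equiv.Perm.sign σ : ℤ) * ∏ i, M (σ i) i, ?_⟩
  intro t
  rw [Matrix.det_apply', Finset.mul_sum, ← Finset.sum_add_distrib]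
  refine Finset.sum_congr rfl fun σ _ => ?_
  rw [prod_scaleCross]
  split_ifs <;> ring

theorem charmatrix_scaleCross {n : Type*} [Fintype n] [DecidableEq n] (e : n) (t : ℝ)
    (M : Matrix n n ℝ) :
    (scaleCross e t M).charmatrix = scaleCross e (Polynomial.C t) M.charmatrix := by
  ext1 i j
  by_cases hij : i = j
  · subst hij
    have : ¬ ((i = e ∧ i ≠ e) ∨ (i ≠ e ∧ i = e)) := by tauto
    simp [scaleCross, Matrix.charmatrix_apply_eq]
  · rw [Matrix.charmatrix_apply_ne _ _ _ hij]
    simp only [scaleCross, Matrix.charmatrix_apply_ne _ _ _ hij]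
    split_ifs <;> simp

theorem charpoly_scaleCross {n : Type*} [Fintype n] [DecidableEq n] (e : n)
    (M : Matrix n n ℝ) : ∃ P Q : Polynomial ℝ, ∀ t : ℝ,
      (scaleCross e t M).charpoly = P + Polynomial.C (t ^ 2) * Q := by
  obtain ⟨P, Q, h⟩ := det_scaleCross e M.charmatrix
  refine ⟨P, Q, fun t => ?_⟩
  rw [Matrix.charpoly, charmatrix_scaleCross, h, Polynomial.C_pow]

theorem expand_charpoly_sq {n : Type*} [Fintype n] [DecidableEq n] (K : Matrix n n ℝ) :
    Polynomial.expand ℝ 2 (K ^ 2).charpoly = K.charpoly * (-K).charpoly := by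
  rw [Matrix.charpoly, Matrix.charpoly, Matrix.charpoly, ← Matrix.det_mul, AlgHom.map_det]
  congr 1
  have h1 : (Polynomial.expand ℝ 2).mapMatrix (K ^ 2).charmatrix =
      Matrix.scalar n (Polynomial.X ^ 2) - (Polynomial.C.mapMatrix K) ^ 2 := by
    rw [← map_pow]
    ext1 i j
    by_cases hij : i = j
    · subst hij
      simp [Matrix.charmatrix_apply_eq]
    · simp [Matrix.charmatrix_apply_ne _ _ _ hij, hij]
  rw [h1, Matrix.charmatrix, Matrix.charmatrix, map_neg, map_pow, sub_neg_eq_add]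
  have hc : Commute (Matrix.scalar n (Polynomial.X : Polynomial ℝ)) (Polynomial.C.mapMatrix K) :=
    Matrix.scalar_commute _ (fun r => Commute.all _ _) _
  rw [sub_mul, mul_add, mul_add, hc.eq, pow_two, pow_two]
  abel

/-- The coefficients of `charpoly(K(t))` are even quadratic polynomials in `t`,
and the coefficients of `charpoly(K(t)²)` are even quartic polynomials in `t`. -/
theorem charpoly_deformedK_coeff_polynomial_in_t
    {V : Type*} [Fintype V] [DecidableEq V]
    (G : Finset (Finset V))
    (hSC : IsSimplicialComplex G)
    (hdim : IsOneDimensional G)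
    (vA vB : V) (hab : vA ≠ vB)
    (ha : ({vA} : Finset V) ∈ G) (hb : ({vB} : Finset V) ∈ G)
    (he : ({vA, vB} : Finset V) ∉ G)
    (k : ℕ) :
    (∃ a b : ℝ, ∀ t : ℝ,
        ((deformedK (insert ({vA, vB} : Finset V) G) ({vA, vB} : Finset V) t).charpoly).coeff k
          = a + b * t ^ 2) ∧
    (∃ a' b' c' : ℝ, ∀ t : ℝ,
        ((deformedK (insert ({vA, vB} : Finset V) G) ({vA, vB} : Finset V) t ^ 2).charpoly).coeff k
          = a' + b' * t ^ 2 + c' * t ^ 4) := by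
  classical
  set e : Finset V := {vA, vB} with he'
  set H := insert e G with hH
  let e0 : H := ⟨e, Finset.mem_insert_self _ _⟩
  have key : ∀ t, deformedK H e t = scaleCross e0 t (deformedK H e 1) := by
    intro t
    ext x y
    have hx : x = e0 ↔ x.1 = e := Subtype.ext_iff
    have hy : y = e0 ↔ y.1 = e := Subtype.ext_iff
    simp only [scaleCross, deformedK, ne_eq, hx, hy]
    split_ifs <;> simp
  have keyn : ∀ t, -deformedK H e t = scaleCross e0 t (-deformedK H e 1) := by
    intro t
    rw [key t]
    ext x y
    simp only [scaleCross, Matrix.neg_apply]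
    split_ifs <;> simp
  obtain ⟨P, Q, h⟩ := charpoly_scaleCross e0 (deformedK H e 1)
  obtain ⟨P', Q', h'⟩ := charpoly_scaleCross e0 (-deformedK H e 1)
  refine ⟨⟨P.coeff k, Q.coeff k, fun t => ?_⟩,
    ⟨(P * P').coeff (k * 2), (P * Q' + Q * P').coeff (k * 2), (Q * Q').coeff (k * 2),
      fun t => ?_⟩⟩
  · rw [key, h, Polynomial.coeff_add, Polynomial.coeff_C_mul]
    ring
  · rw [← Polynomial.coeff_expand_mul (p := 2) (by norm_num), expand_charpoly_sq, keyn, key, h, h']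
    have : (P + Polynomial.C (t ^ 2) * Q) * (P' + Polynomial.C (t ^ 2) * Q') =
        P * P' + Polynomial.C (t ^ 2) * (P * Q' + Q * P') + Polynomial.C (t ^ 4) * (Q * Q') := by
      simp only [Polynomial.C_pow]
      ring
    rw [this, Polynomial.coeff_add, Polynomial.coeff_add, Polynomial.coeff_C_mul,
      Polynomial.coeff_C_mul]
    ring
end

section
/- Let G be a finite abstract simplicial complex on vertex set V with connection Laplacian L, let a ≠ b be vertices with {a}, {b} ∈ G and e = {a,b} ∉ G, let H = G ∪ {e}, and let K(t) be the deformed connection matrix indexed by H (entries: 0 if the simplices are disjoint, t if they intersect and exactly one of them equals e, and 1 otherwise). Then for all t ∈ ℝ, det(K(t)) = (1 − 2t²) · det(L). -/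
open Matrix

/-- Deformation of the determinant when attaching a new edge `e = {a,b}`:
`det K(t) = (1 - 2t²)·det L`. -/
theorem det_deformedK
    {V : Type*} [Fintype V] [DecidableEq V]
    (G : Finset (Finset V))
    (hSC : IsSimplicialComplex G)
    (a b : V) (hab : a ≠ b)
    (ha : ({a} : Finset V) ∈ G) (hb : ({b} : Finset V) ∈ G)
    (he : ({a, b} : Finset V) ∉ G)
    (t : ℝ) :
    (deformedK (insert ({a, b} : Finset V) G) ({a, b} : Finset V) t).det
      = (1 - 2 * t ^ 2) * (connectionLaplacian G).det := by
  classical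
  have hnot : ∀ x ∈ G, ¬ (a ∈ x ∧ b ∈ x) := by
    rintro x hx ⟨h1, h2⟩
    apply he
    apply hSC.2 x hx _ ⟨a, by simp⟩
    intro y hy
    simp only [Finset.mem_insert, Finset.mem_singleton] at hy
    rcases hy with rfl | rfl <;> assumption
  have hne : ∀ x : G, x.1 ≠ ({a, b} : Finset V) := fun x h => he (h ▸ x.2)
  let g : G ⊕ Unit → (insert ({a, b} : Finset V) G : Finset (Finset V)) :=
    Sum.elim (fun x => ⟨x.1, Finset.mem_insert_of_mem x.2⟩)
      (fun _ => ⟨{a, b}, Finset.mem_insert_self _ _⟩)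
  have hg : Function.Bijective g := by
    constructor
    · rintro (x | x) (y | y) h
      · have h1 : (g (Sum.inl x)).1 = (g (Sum.inl y)).1 := congrArg Subtype.val h
        have h2 : x.1 = y.1 := h1
        rw [Subtype.ext h2]
      · exact absurd (congrArg Subtype.val h) (hne x)
      · exact absurd (congrArg Subtype.val h).symm (hne y)
      · rfl
    · rintro ⟨x, hx⟩
      rcases Finset.mem_insert.1 hx with h | h
      · exact ⟨Sum.inr (), Subtype.ext h.symm⟩
      · exact ⟨Sum.inl ⟨x, h⟩, rfl⟩
  let v : G → ℝ := fun x => (if a ∈ x.1 then 1 else 0) + (if b ∈ x.1 then 1 else 0)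
  have hv : ∀ x : G, v x = if (x.1 ∩ {a, b}).Nonempty then 1 else 0 := by
    intro x
    have h0 := hnot x.1 x.2
    have h1 : (x.1 ∩ {a, b}).Nonempty ↔ a ∈ x.1 ∨ b ∈ x.1 := by
      constructor
      · rintro ⟨y, hy⟩
        simp only [Finset.mem_inter, Finset.mem_insert, Finset.mem_singleton] at hy
        rcases hy with ⟨hy, rfl | rfl⟩ <;> simp [hy]
      · rintro (h | h)
        · exact ⟨a, by simp [h]⟩
        · exact ⟨b, by simp [h]⟩
    simp only [v, h1]
    by_cases p : a ∈ x.1 <;> by_cases q : b ∈ x.1 <;> simp_all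
  let w : G → ℝ := fun x => (if x = ⟨{a}, ha⟩ then 1 else 0) + (if x = ⟨{b}, hb⟩ then 1 else 0)
  have hs : ∀ (c : V) (x : Finset V), (x ∩ {c}).Nonempty ↔ c ∈ x := by
    intro c x
    constructor
    · rintro ⟨y, hy⟩
      simp only [Finset.mem_inter, Finset.mem_singleton] at hy
      exact hy.2 ▸ hy.1
    · intro h
      exact ⟨c, by simp [h]⟩
  have hLw : ∀ x : G, ∑ y, connectionLaplacian G x y * w y = v x := by
    intro x
    simp only [w, mul_add, Finset.sum_add_distrib, mul_ite, mul_one, mul_zero,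
      Finset.sum_ite_eq', Finset.mem_univ, if_true, connectionLaplacian, hs, v]
  have hvw : ∑ y, v y * w y = 2 := by
    simp only [w, mul_add, Finset.sum_add_distrib, mul_ite, mul_one, mul_zero,
      Finset.sum_ite_eq', Finset.mem_univ, if_true, v, Finset.mem_singleton, hab, hab.symm,
      if_false]
    norm_num
  have hK : (deformedK (insert ({a, b} : Finset V) G) ({a, b} : Finset V) t).submatrix g g
      = fromBlocks (connectionLaplacian G) (Matrix.of fun x (_ : Unit) => t * v x)
        (Matrix.of fun (_ : Unit) x => t * v x) 1 := by
    ext (x | x) (y | y)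
    · simp [g, deformedK, connectionLaplacian, hne]
    · simp [g, deformedK, hne, hv]
    · simp [g, deformedK, hne, hv, Finset.inter_comm]
    · simp [g, deformedK]
  have hmul : (fromBlocks (connectionLaplacian G) (Matrix.of fun x (_ : Unit) => t * v x)
        (Matrix.of fun (_ : Unit) x => t * v x) 1) *
      (fromBlocks 1 (Matrix.of fun x (_ : Unit) => -t * w x) 0 1)
      = fromBlocks (connectionLaplacian G) 0 (Matrix.of fun (_ : Unit) x => t * v x)
        (Matrix.of fun (_ _ : Unit) => 1 - 2 * t ^ 2) := by
    rw [fromBlocks_multiply]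
    congr 1
    · simp
    · ext x y
      simp only [Matrix.mul_one, Matrix.add_apply, Matrix.mul_apply, Matrix.of_apply,
        Matrix.zero_apply]
      have : ∀ y, connectionLaplacian G x y * (-t * w y)
        = -t * (connectionLaplacian G x y * w y) := fun y => by ring
      simp only [this, ← Finset.mul_sum, hLw]
      ring
    · simp
    · ext x y
      simp only [Matrix.mul_one, Matrix.add_apply, Matrix.mul_apply, Matrix.of_apply]
      have : ∀ y, t * v y * (-t * w y) = -t ^ 2 * (v y * w y) := fun y => by ring
      simp only [this, ← Finset.mul_sum, hvw]
      simp
      ring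
  have h1 := Matrix.det_submatrix_equiv_self (Equiv.ofBijective g hg)
    (deformedK (insert ({a, b} : Finset V) G) ({a, b} : Finset V) t)
  rw [← h1]
  have h2 := congrArg Matrix.det hmul
  rw [det_mul, det_fromBlocks_zero₂₁, det_fromBlocks_zero₁₂] at h2
  simp only [det_one, mul_one, det_unique, Matrix.of_apply, Matrix.one_apply_eq] at h2
  change ((deformedK (insert ({a, b} : Finset V) G) ({a, b} : Finset V) t).submatrix g g).det = _
  rw [hK, h2, mul_comm]
end

section
/- For n ≥ 3 let L_n be the connection Laplacian of the cycle complex C_n (the 2n × 2n real symmetric matrix indexed by the singletons and edges of the n-cycle, with entry 1 when the simplices intersect and 0 otherwise), and let λ^{(n)}_1, …, λ^{(n)}_{2n} be its eigenvalues with multiplicity. Define c : [0,1] → ℝ by c(x) = 2cos²(πx) + √(4cos⁴(πx) + 1). Then for every s ∈ ℂ, the normalized zeta values converge: lim_{n→∞} (1/n) · Σ_{i=1}^{2n} ((λ^{(n)}_i)² : ℂ)^{s} = ∫_0^1 [ (c(x)² : ℂ)^{s} + (c(x)² : ℂ)^{−s} ] dx. -/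
open Matrix

lemma cycleConnection_isHermitian (n : ℕ) : (cycleConnection n).IsHermitian := by
  ext x y
  simp only [cycleConnection, Matrix.conjTranspose_apply, star_trivial]
  rw [Finset.inter_comm]

/-- The limiting function `c(x) = 2cos²(πx) + √(4cos⁴(πx)+1)`. -/
noncomputable def climit (x : ℝ) : ℝ :=
  2 * Real.cos (Real.pi * x) ^ 2 + Real.sqrt (4 * Real.cos (Real.pi * x) ^ 4 + 1)

lemma climit_pos (x : ℝ) : 0 < climit x := by
  unfold climit
  have h : 0 < 4 * Real.cos (Real.pi * x) ^ 4 + 1 := by positivity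
  have := Real.sqrt_pos.mpr h
  positivity

lemma climit_sub_inv (x : ℝ) : climit x - (climit x)⁻¹ = 4 * Real.cos (Real.pi * x) ^ 2 := by
  have hp := climit_pos x
  have h : 0 ≤ 4 * Real.cos (Real.pi * x) ^ 4 + 1 := by positivity
  have hs := Real.sq_sqrt h
  have hi : (climit x)⁻¹ =
      Real.sqrt (4 * Real.cos (Real.pi * x) ^ 4 + 1) - 2 * Real.cos (Real.pi * x) ^ 2 := by
    refine inv_eq_of_mul_eq_one_right ?_
    unfold climit
    linear_combination hs
  rw [hi]
  unfold climit
  ring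

lemma continuous_climit : Continuous climit := by
  unfold climit
  fun_prop

/-- The complex shift matrix. -/
def shiftM (n : ℕ) : Matrix (ZMod n) (ZMod n) ℂ := fun i j => if i = j + 1 then 1 else 0

lemma conn_blocks (n : ℕ) (hn : 3 ≤ n) :
    (cycleConnection n).map (Complex.ofRealHom : ℝ →+* ℂ) =
      Matrix.fromBlocks 1 (1 + shiftM n) (1 + (shiftM n)ᵀ) (1 + shiftM n + (shiftM n)ᵀ) := by
  have h1 : (1 : ZMod n) ≠ 0 := by
    intro h
    have := (ZMod.natCast_eq_zero_iff 1 n).mp (by simpa using h)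
    have := Nat.le_of_dvd (by norm_num) this
    omega
  have h2 : (1 : ZMod n) + 1 ≠ 0 := by
    intro h
    have := (ZMod.natCast_eq_zero_iff 2 n).mp (by push_cast; rw [← h]; ring)
    have := Nat.le_of_dvd (by norm_num) this
    omega
  ext x y
  rcases x with i | i <;> rcases y with j | j
  · simp [cycleConnection, cycleSimplex, Matrix.one_apply, Finset.Nonempty]
  · by_cases a : i = j
    · subst a
      simp [cycleConnection, cycleSimplex, Matrix.one_apply, Finset.Nonempty, shiftM, h1]
    · simp [cycleConnection, cycleSimplex, Matrix.one_apply, Finset.Nonempty, shiftM, a]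
  · by_cases a : i = j
    · subst a
      simp [cycleConnection, cycleSimplex, Matrix.one_apply, Finset.Nonempty, shiftM, h1]
    · simp [cycleConnection, cycleSimplex, Matrix.one_apply, Finset.Nonempty, shiftM, a, Ne.symm a, eq_comm]
  · have key : (∃ z, z ∈ ({i, i+1} : Finset (ZMod n)) ∩ {j, j+1}) ↔ (i = j ∨ i = j + 1 ∨ j = i + 1) := by
      constructor
      · rintro ⟨z, hz⟩
        simp only [Finset.mem_inter, Finset.mem_insert, Finset.mem_singleton] at hz
        grind
      · rintro (h | h | h)
        · exact ⟨i, by simp [h]⟩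
        · exact ⟨i, by simp [h]⟩
        · exact ⟨j, by simp [h]⟩
    simp only [cycleConnection, cycleSimplex, Finset.Nonempty, Matrix.map_apply, key,
      Matrix.fromBlocks_apply₂₂, Matrix.add_apply, Matrix.transpose_apply, shiftM, Matrix.one_apply]
    by_cases a : i = j
    · subst a
      simp [h1]
    · by_cases b : i = j + 1
      · subst b
        have : ¬ j = j + 1 + 1 := by
          intro h
          apply h2
          linear_combination -h
        simp [this, h1]
      · simp [a, b, apply_ite]

lemma shift_orth (n : ℕ) [NeZero n] : (shiftM n)ᵀ * shiftM n = 1 := by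
  ext i j
  simp [Matrix.mul_apply, shiftM, Matrix.one_apply, eq_comm]

/-- Fourier matrix. -/
noncomputable def fourierM (n : ℕ) [NeZero n] : Matrix (ZMod n) (ZMod n) ℂ :=
  fun i k => ZMod.stdAddChar (i * k)

lemma fourier_det (n : ℕ) [NeZero n] : (fourierM n).det ≠ 0 := by
  have h : (fourierM n) * (Matrix.of fun k l => (ZMod.stdAddChar (-(k * l)) : ℂ)) =
      (n : ℂ) • (1 : Matrix (ZMod n) (ZMod n) ℂ) := by
    ext j l
    simp only [Matrix.mul_apply, fourierM, Matrix.of_apply, ← AddChar.map_add_eq_mul]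
    have : ∀ k : ZMod n, j * k + -(k * l) = k * (j - l) := fun k => by ring
    simp only [this, AddChar.sum_mulShift _ (ZMod.isPrimitive_stdAddChar n), sub_eq_zero]
    simp [Matrix.one_apply]
  intro h0
  have := congrArg Matrix.det h
  rw [Matrix.det_mul, h0, zero_mul, Matrix.det_smul, Matrix.det_one, mul_one] at this
  exact pow_ne_zero _ (Nat.cast_ne_zero.mpr (NeZero.ne n)) this.symm

lemma det_circ (n : ℕ) [NeZero n] (a b : ℂ) :
    (a • (1 : Matrix (ZMod n) (ZMod n) ℂ) - b • (2 + shiftM n + (shiftM n)ᵀ)).det =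
      ∏ k : ZMod n, (a - b * (2 + ZMod.stdAddChar (-k) + ZMod.stdAddChar k)) := by
  have h1 : shiftM n * fourierM n =
      fourierM n * Matrix.diagonal (fun k => (ZMod.stdAddChar (-k) : ℂ)) := by
    ext i k
    rw [Matrix.mul_diagonal]
    simp only [Matrix.mul_apply, shiftM, fourierM, ← AddChar.map_add_eq_mul]
    rw [Finset.sum_eq_single (i - 1)]
    · simp
      congr 1
      ring
    · intro c _ hc
      have : ¬ i = c + 1 := by
        rintro rfl
        simp at hc
      simp [this]
    · simp
  have h2 : (shiftM n)ᵀ * fourierM n =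
      fourierM n * Matrix.diagonal (fun k => (ZMod.stdAddChar k : ℂ)) := by
    ext i k
    rw [Matrix.mul_diagonal]
    simp [Matrix.mul_apply, shiftM, fourierM, ← AddChar.map_add_eq_mul]
    congr 1
    ring
  have h3 : (a • (1 : Matrix (ZMod n) (ZMod n) ℂ) - b • (2 + shiftM n + (shiftM n)ᵀ)) * fourierM n
      = fourierM n * Matrix.diagonal
        (fun k => a - b * (2 + ZMod.stdAddChar (-k) + ZMod.stdAddChar k)) := by
    rw [sub_mul, smul_mul_assoc, smul_mul_assoc, add_mul, add_mul, h1, h2, one_mul]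
    ext i k
    have e2 : (2 : Matrix (ZMod n) (ZMod n) ℂ) * fourierM n = (2 : ℂ) • fourierM n := by
      rw [two_mul, two_smul]
    rw [e2]
    simp only [Matrix.sub_apply, Matrix.smul_apply, Matrix.add_apply, Matrix.mul_diagonal,
      smul_eq_mul]
    ring
  have := congrArg Matrix.det h3
  rw [Matrix.det_mul, Matrix.det_mul, Matrix.det_diagonal, mul_comm] at this
  exact mul_left_cancel₀ (fourier_det n) this

lemma char_sum (n : ℕ) [NeZero n] (k : ZMod n) :
    (2 + ZMod.stdAddChar (-k) + ZMod.stdAddChar k : ℂ) =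
      ((climit (k.val / n) - (climit (k.val / n))⁻¹ : ℝ) : ℂ) := by
  rw [climit_sub_inv]
  have e : ∀ j : ℤ, (ZMod.stdAddChar (j : ZMod n) : ℂ) =
      Complex.exp (2 * Real.pi * Complex.I * j / n) := fun j => ZMod.stdAddChar_coe j
  have hk : k = ((k.val : ℤ) : ZMod n) := by simp
  have hk' : -k = ((-(k.val : ℤ) : ℤ) : ZMod n) := by simp
  have e1 := e k.val
  have e2 := e (-k.val)
  rw [← hk] at e1
  rw [← hk'] at e2
  rw [e1, e2]
  have hc := Complex.cos_sq ((Real.pi * ((k.val : ℝ) / n) : ℝ) : ℂ)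
  push_cast at hc ⊢
  rw [hc, Complex.cos]
  have a1 : 2 * ((Real.pi : ℂ) * (k.val / n)) * Complex.I = 2 * Real.pi * Complex.I * k.val / n := by
    ring
  have a2 : -(2 * ((Real.pi : ℂ) * (k.val / n))) * Complex.I =
      2 * Real.pi * Complex.I * (-k.val) / n := by
    ring
  rw [a1, a2]
  ring

lemma charpoly_eval (n : ℕ) [NeZero n] (hn : 3 ≤ n) (x : ℝ) (hx : x ≠ 1) :
    (cycleConnection n).charpoly.eval x =
      ∏ k : ZMod n, (x - climit (k.val / n)) * (x - -(climit (k.val / n))⁻¹) := by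
  have hx' : (x : ℂ) - 1 ≠ 0 := by
    rw [sub_ne_zero]
    exact_mod_cast hx
  apply Complex.ofReal_injective
  change Complex.ofRealHom _ = _
  rw [Matrix.eval_charpoly, RingHom.map_det, RingHom.mapMatrix_apply]
  have hm : (Matrix.scalar (ZMod n ⊕ ZMod n) x - cycleConnection n).map Complex.ofRealHom =
      Matrix.fromBlocks (((x : ℂ) - 1) • 1) (-(1 + shiftM n)) (-(1 + (shiftM n)ᵀ))
        ((x : ℂ) • 1 - (1 + shiftM n + (shiftM n)ᵀ)) := by
    rw [Matrix.map_sub _ (by simp), conn_blocks n hn]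
    have : (Matrix.scalar (ZMod n ⊕ ZMod n) x).map Complex.ofRealHom =
        Matrix.fromBlocks ((x : ℂ) • 1) 0 0 ((x : ℂ) • 1) := by
      ext i j
      rcases i with i | i <;> rcases j with j | j <;> by_cases h : i = j <;>
        simp [Matrix.diagonal_apply, Matrix.one_apply, h]
    rw [this, sub_eq_add_neg, Matrix.fromBlocks_neg, Matrix.fromBlocks_add, sub_smul]
    simp [sub_eq_add_neg]
  rw [hm]
  letI : Invertible (((x : ℂ) - 1) • (1 : Matrix (ZMod n) (ZMod n) ℂ)) :=
    ⟨((x : ℂ) - 1)⁻¹ • 1, by simp [smul_smul, hx'], by simp [smul_smul, hx']⟩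
  rw [Matrix.det_fromBlocks₁₁]
  have hinv : ⅟(((x : ℂ) - 1) • (1 : Matrix (ZMod n) (ZMod n) ℂ)) = ((x : ℂ) - 1)⁻¹ • 1 := rfl
  rw [hinv, Matrix.det_smul, Matrix.det_one, mul_one, ← Matrix.det_smul]
  have hM : ((x : ℂ) - 1) • ((x : ℂ) • (1 : Matrix (ZMod n) (ZMod n) ℂ)
      - (1 + shiftM n + (shiftM n)ᵀ) -
      -(1 + (shiftM n)ᵀ) * (((x : ℂ) - 1)⁻¹ • 1) * -(1 + shiftM n)) =
      ((x : ℂ) ^ 2 - 1) • (1 : Matrix (ZMod n) (ZMod n) ℂ)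
        - (x : ℂ) • (2 + shiftM n + (shiftM n)ᵀ) := by
    have hB : -(1 + (shiftM n)ᵀ) * (((x : ℂ) - 1)⁻¹ • 1) * -(1 + shiftM n) =
        ((x : ℂ) - 1)⁻¹ • (2 + shiftM n + (shiftM n)ᵀ) := by
      rw [Matrix.mul_smul, Matrix.smul_mul, mul_one, neg_mul_neg]
      congr 1
      rw [add_mul, mul_add, mul_add, shift_orth, one_mul, one_mul, mul_one,
        show (2 : Matrix (ZMod n) (ZMod n) ℂ) = 1 + 1 by norm_num]
      abel
    rw [hB, smul_sub _ _ (_ • (2 + _ + _)), smul_smul, mul_inv_cancel₀ hx',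
      show (2 : Matrix (ZMod n) (ZMod n) ℂ) = 1 + 1 by norm_num]
    module
  rw [hM, det_circ]
  push_cast
  refine Finset.prod_congr rfl fun k _ => ?_
  rw [char_sum]
  have hc : (climit (k.val / n) : ℂ) ≠ 0 := by exact_mod_cast (climit_pos _).ne'
  push_cast
  field_simp
  ring

lemma charpoly_eq (n : ℕ) [NeZero n] (hn : 3 ≤ n) :
    (cycleConnection n).charpoly =
      ((Finset.univ.val.map (Sum.elim (fun k : ZMod n => climit (k.val / n))
        (fun k : ZMod n => -(climit (k.val / n))⁻¹))).map
        fun a => Polynomial.X - Polynomial.C a).prod := by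
  apply Polynomial.eq_of_infinite_eval_eq
  refine Set.Infinite.mono (s := {1}ᶜ) ?_ (Set.finite_singleton (1 : ℝ)).infinite_compl
  intro x hx
  simp only [Set.mem_setOf_eq]
  rw [charpoly_eval n hn x hx, Multiset.map_map]
  change _ = Polynomial.eval x (∏ i, _)
  rw [Polynomial.eval_prod, Fintype.prod_sum_type, ← Finset.prod_mul_distrib]
  simp

lemma eig_sum (n : ℕ) [NeZero n] (hn : 3 ≤ n) (f : ℝ → ℂ) :
    ∑ i, f ((cycleConnection_isHermitian n).eigenvalues i) =
      ∑ k : ZMod n, (f (climit (k.val / n)) + f (-(climit (k.val / n))⁻¹)) := by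
  have h := (cycleConnection_isHermitian n).roots_charpoly_eq_eigenvalues
  rw [charpoly_eq n hn, Polynomial.roots_multiset_prod_X_sub_C] at h
  have h' := congrArg (fun m => (m.map f).sum) h
  simp only [Multiset.map_map] at h'
  change ∑ i, _ = ∑ i, _ at h'
  rw [Fintype.sum_sum_type, ← Finset.sum_add_distrib] at h'
  simpa using h'.symm

lemma zmod_sum (n : ℕ) [NeZero n] (g : ℕ → ℂ) :
    ∑ k : ZMod n, g k.val = ∑ k ∈ Finset.range n, g k := by
  obtain ⟨m, rfl⟩ := Nat.exists_eq_succ_of_ne_zero (NeZero.ne n)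
  rw [Finset.sum_range]
  rfl

lemma riemann (G : ℝ → ℂ) (hG : Continuous G) :
    Filter.Tendsto (fun n : ℕ => (n : ℂ)⁻¹ * ∑ k ∈ Finset.range n, G (k / n)) Filter.atTop
      (nhds (∫ x in (0 : ℝ)..1, G x)) := by
  rw [Metric.tendsto_atTop]
  intro ε hε
  have huc := (isCompact_Icc (a := (0 : ℝ)) (b := 1)).uniformContinuousOn_of_continuous
    hG.continuousOn
  rw [Metric.uniformContinuousOn_iff] at huc
  obtain ⟨δ, hδ, H⟩ := huc (ε / 2) (by positivity)
  obtain ⟨N, hN⟩ := exists_nat_gt (1 / δ)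
  refine ⟨N + 1, fun n hn => ?_⟩
  have hn0 : (0 : ℝ) < n := by
    have : 0 < n := by omega
    exact_mod_cast this
  have hnδ : 1 / (n : ℝ) < δ := by
    have : (N : ℝ) ≤ n := by exact_mod_cast (by omega : N ≤ n)
    rw [div_lt_iff₀ hn0]
    rw [div_lt_iff₀ hδ] at hN
    nlinarith
  have hs := intervalIntegral.sum_integral_adjacent_intervals (f := G)
    (μ := MeasureTheory.volume) (a := fun k : ℕ => (k : ℝ) / n) (n := n)
    (fun k _ => hG.intervalIntegrable _ _)
  simp only [Nat.cast_zero, zero_div, div_self hn0.ne'] at hs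
  rw [dist_comm, dist_eq_norm, ← hs, Finset.mul_sum, ← Finset.sum_sub_distrib]
  have hb : ∀ k ∈ Finset.range n,
      ‖(∫ x in ((k : ℝ) / n)..(((k + 1 : ℕ) : ℝ) / n), G x) - (n : ℂ)⁻¹ * G (k / n)‖
        ≤ ε / 2 * (1 / n) := by
    intro k hk
    have hk' : (k : ℝ) + 1 ≤ n := by exact_mod_cast Finset.mem_range.mp hk
    have hd : ((k + 1 : ℕ) : ℝ) / n - k / n = 1 / n := by
      push_cast
      ring
    have hc : (n : ℂ)⁻¹ * G (k / n) =
        ∫ x in ((k : ℝ) / n)..(((k + 1 : ℕ) : ℝ) / n), G (k / n) := by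
      rw [intervalIntegral.integral_const, hd]
      simp
    rw [hc, ← intervalIntegral.integral_sub (hG.intervalIntegrable _ _) (by simp)]
    have hle : (k : ℝ) / n ≤ ((k + 1 : ℕ) : ℝ) / n := by
      have : 0 ≤ 1 / (n : ℝ) := by positivity
      linarith
    have := intervalIntegral.norm_integral_le_of_norm_le_const (a := (k : ℝ) / n)
      (b := ((k + 1 : ℕ) : ℝ) / n) (C := ε / 2) (f := fun x => G x - G (k / n)) ?_
    · rwa [hd, abs_of_nonneg (by positivity)] at this
    · intro x hx
      rw [Set.uIoc_of_le hle] at hx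
      have h0 : 0 ≤ (k : ℝ) / n := by positivity
      have h1 : ((k + 1 : ℕ) : ℝ) / n ≤ 1 := by
        rw [div_le_one hn0]
        exact_mod_cast hk'
      rw [← dist_eq_norm]
      refine (H x ⟨by linarith [hx.1], by linarith [hx.2]⟩ _ ⟨h0, by linarith⟩ ?_).le
      rw [Real.dist_eq, abs_of_nonneg (by linarith [hx.1])]
      linarith [hx.2]
  refine (norm_sum_le_of_le _ hb).trans_lt ?_
  simp only [Finset.sum_const, Finset.card_range, nsmul_eq_mul]
  field_simp
  linarith

/-- Barycentric limit of the normalized connection zeta functions of the cycle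
complexes: for every `s ∈ ℂ`,
`(1/n)·Σ_i (λ_i^{(n)})²ˢ → ∫_0^1 (c(x)²)ˢ + (c(x)²)^{-s} dx`. -/
theorem cycle_zeta_tendsto (s : ℂ) :
    Filter.Tendsto
      (fun n : ℕ =>
        if h : 0 < n then
          haveI : NeZero n := ⟨h.ne'⟩
          (n : ℂ)⁻¹ * ∑ i : ZMod n ⊕ ZMod n,
            ((((cycleConnection_isHermitian n).eigenvalues i ^ 2 : ℝ)) : ℂ) ^ s
        else 0)
      Filter.atTop
      (nhds (∫ x in (0 : ℝ)..1,
        (((climit x ^ 2 : ℝ)) : ℂ) ^ s + (((climit x ^ 2 : ℝ)) : ℂ) ^ (-s))) := by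
  have hcont : Continuous fun x : ℝ =>
      (((climit x ^ 2 : ℝ)) : ℂ) ^ s + (((climit x ^ 2 : ℝ)) : ℂ) ^ (-s) := by
    have hc : Continuous fun x : ℝ => (((climit x ^ 2 : ℝ)) : ℂ) :=
      Complex.continuous_ofReal.comp (continuous_climit.pow 2)
    have hsl : ∀ x, (((climit x ^ 2 : ℝ)) : ℂ) ∈ Complex.slitPlane := fun x =>
      Complex.ofReal_mem_slitPlane.mpr (pow_pos (climit_pos x) 2)
    exact (hc.cpow continuous_const hsl).add (hc.cpow continuous_const hsl)
  refine (riemann _ hcont).congr' ?_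
  filter_upwards [Filter.eventually_ge_atTop 3] with n hn
  have h : 0 < n := by omega
  haveI : NeZero n := ⟨h.ne'⟩
  rw [dif_pos h]
  congr 1
  rw [eig_sum n hn (fun y => (((y ^ 2 : ℝ)) : ℂ) ^ s),
    zmod_sum n (fun k => (((climit (k / n) ^ 2 : ℝ)) : ℂ) ^ s +
      ((((-(climit (k / n))⁻¹) ^ 2 : ℝ)) : ℂ) ^ s)]
  refine Finset.sum_congr rfl fun k _ => ?_
  congr 1
  rw [neg_sq, inv_pow, Complex.ofReal_inv, Complex.inv_cpow, Complex.cpow_neg]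
  rw [Complex.arg_ofReal_of_nonneg (by positivity)]
  exact Real.pi_pos.ne
end

section
/- For every real t, the following two integral representations of the limiting connection zeta function agree: ∫_0^1 2·cos( t · log( ( √(4·sin⁴(πx) + 1) + 2·sin²(πx) )² ) ) dx = ∫_0^1 [ 2·cos( 2t · log( √(4v² + 1) + 2v ) ) / ( π·√( v·(1 − v) ) ) ] dv. -/
open Real

/-- Change of variables `v = sin²(πx)` relating the two integral
representations of the limiting connection zeta function `z(it)`. -/
theorem limiting_zeta_integral_change_of_variables (t : ℝ) :
    (∫ x in (0 : ℝ)..1,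
        2 * Real.cos (t * Real.log
          ((Real.sqrt (4 * Real.sin (Real.pi * x) ^ 4 + 1)
            + 2 * Real.sin (Real.pi * x) ^ 2) ^ 2)))
      = ∫ v in (0 : ℝ)..1,
          2 * Real.cos (2 * t * Real.log (Real.sqrt (4 * v ^ 2 + 1) + 2 * v))
            / (Real.pi * Real.sqrt (v * (1 - v))) := by
  set F : ℝ → ℝ := fun x => 2 * Real.cos (t * Real.log
          ((Real.sqrt (4 * Real.sin (Real.pi * x) ^ 4 + 1)
            + 2 * Real.sin (Real.pi * x) ^ 2) ^ 2)) with hF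
  set G : ℝ → ℝ := fun v =>
    2 * Real.cos (2 * t * Real.log (Real.sqrt (4 * v ^ 2 + 1) + 2 * v))
            / (Real.pi * Real.sqrt (v * (1 - v))) with hG
  have hFc : Continuous F := by
    have hpos : ∀ x : ℝ, (Real.sqrt (4 * Real.sin (Real.pi * x) ^ 4 + 1)
            + 2 * Real.sin (Real.pi * x) ^ 2) ^ 2 ≠ 0 := by
      intro x
      positivity
    refine continuous_const.mul (Real.continuous_cos.comp (continuous_const.mul ?_))
    exact Continuous.log (by fun_prop) hpos
  have hsym : ∀ x, F (1 - x) = F x := by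
    intro x
    have : Real.sin (Real.pi * (1 - x)) = Real.sin (Real.pi * x) := by
      rw [mul_sub, mul_one, Real.sin_pi_sub]
    simp only [hF, this]
  have h1 : ∫ x in (0 : ℝ)..1, F x = 2 * ∫ x in (0 : ℝ)..(1/2), F x := by
    have h2 : ∫ x in (1/2 : ℝ)..1, F x = ∫ x in (0 : ℝ)..(1/2), F x := by
      have := intervalIntegral.integral_comp_sub_left (a := 0) (b := 1/2) F 1
      simp only [hsym] at this
      rw [this]
      norm_num
    rw [← intervalIntegral.integral_add_adjacent_intervals
      (hFc.intervalIntegrable 0 (1/2)) (hFc.intervalIntegrable (1/2) 1), h2]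
    ring
  have hsc : ∀ x ∈ Set.Ioo (0 : ℝ) (1/2), 0 < Real.sin (Real.pi * x) ∧
      0 < Real.cos (Real.pi * x) := by
    intro x hx
    have hp := Real.pi_pos
    have a1 : 0 < Real.pi * x := mul_pos hp hx.1
    have a2 : Real.pi * x < Real.pi / 2 := by nlinarith [hx.2]
    exact ⟨Real.sin_pos_of_pos_of_lt_pi a1 (by linarith),
      Real.cos_pos_of_mem_Ioo ⟨by linarith, a2⟩⟩
  let f : ℝ → ℝ := fun x => Real.sin (Real.pi * x) ^ 2
  let df : ℝ → ℝ := fun x => 2 * Real.pi * (Real.sin (Real.pi * x) * Real.cos (Real.pi * x))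
  have hder : ∀ x, HasDerivAt f (df x) x := by
    intro x
    have := (((hasDerivAt_id x).const_mul Real.pi).sin).pow 2
    refine HasDerivAt.congr_deriv (f := f) this ?_
    simp [df]
    ring
  have hinj : Set.InjOn f (Set.Ioo (0 : ℝ) (1/2)) := by
    intro x hx y hy hxy
    have hp := Real.pi_pos
    have h3 : Real.sin (Real.pi * x) = Real.sin (Real.pi * y) :=
      (pow_left_inj₀ (hsc x hx).1.le (hsc y hy).1.le two_ne_zero).1 hxy
    have := Real.injOn_sin (x₁ := Real.pi * x) (x₂ := Real.pi * y)
      ⟨by nlinarith [hx.1], by nlinarith [hx.2]⟩ ⟨by nlinarith [hy.1], by nlinarith [hy.2]⟩ h3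
    exact mul_left_cancel₀ hp.ne' this
  have himg : Set.image f (Set.Ioo (0 : ℝ) (1/2)) = Set.Ioo 0 1 := by
    apply Set.Subset.antisymm
    · rintro _ ⟨x, hx, rfl⟩
      obtain ⟨hs, hc⟩ := hsc x hx
      have := Real.sin_sq_add_cos_sq (Real.pi * x)
      exact ⟨pow_pos hs 2, by simp only [f]; nlinarith⟩
    · have := intermediate_value_Ioo (f := f) (a := 0) (b := 1/2) (by norm_num)
        (fun x _ => (hder x).continuousAt.continuousWithinAt)
      have e0 : f 0 = 0 := by simp [f]
      have e1 : f (1/2) = 1 := by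
        have : Real.pi * (1/2) = Real.pi / 2 := by ring
        simp only [f, this]; simp
      rwa [e0, e1] at this
  have hcv := MeasureTheory.integral_image_eq_integral_abs_deriv_smul
    (measurableSet_Ioo) (fun x _ => (hder x).hasDerivWithinAt) hinj G
  rw [himg] at hcv
  rw [h1, intervalIntegral.integral_of_le (by norm_num),
    intervalIntegral.integral_of_le (by norm_num),
    MeasureTheory.integral_Ioc_eq_integral_Ioo, MeasureTheory.integral_Ioc_eq_integral_Ioo, hcv,
    ← MeasureTheory.integral_const_mul]
  apply MeasureTheory.setIntegral_congr_fun measurableSet_Ioo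
  intro x hx
  obtain ⟨hs, hc⟩ := hsc x hx
  have hp := Real.pi_pos
  have e : Real.sqrt (f x * (1 - f x)) = Real.sin (Real.pi * x) * Real.cos (Real.pi * x) := by
    have : f x * (1 - f x) = (Real.sin (Real.pi * x) * Real.cos (Real.pi * x)) ^ 2 := by
      simp only [f]
      rw [← Real.cos_sq']; ring
    rw [this, Real.sqrt_sq (mul_pos hs hc).le]
  have e2 : |df x| = df x := abs_of_pos (by simp only [df]; positivity)
  have e3 : F x = 2 * Real.cos (2 * t * Real.log (Real.sqrt (4 * f x ^ 2 + 1) + 2 * f x)) := by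
    simp only [hF, f, Real.log_pow]
    rw [← pow_mul]
    push_cast
    congr 2
    ring
  simp only [smul_eq_mul, e2, hG]
  rw [e, ← e3]
  simp only [df]
  field_simp
end

section
/- Let A and B be real symmetric n × n matrices, and let α, β : Fin n → ℝ be monotone (nondecreasing) enumerations of their eigenvalues with multiplicity, i.e. charpoly(A) = ∏_i (X − α_i) and charpoly(B) = ∏_i (X − β_i) with α and β monotone. Then Σ_{i=1}^n |α_i − β_i| ≤ Σ_{i,j} |A(i,j) − B(i,j)|. -/
open Matrix Polynomial

theorem exists_diag {n : ℕ} (A : Matrix (Fin n) (Fin n) ℝ) (hA : A.IsHermitian)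
    (α : Fin n → ℝ) (hα : Monotone α)
    (hAα : A.charpoly = ∏ i : Fin n, (Polynomial.X - Polynomial.C (α i))) :
    ∃ P : Matrix (Fin n) (Fin n) ℝ, (∀ x, (P *ᵥ x) ⬝ᵥ (P *ᵥ x) = x ⬝ᵥ x) ∧
      ∀ x, x ⬝ᵥ (A *ᵥ x) = ∑ k, α k * (P *ᵥ x) k ^ 2 := by
  have h1 : Multiset.map α Finset.univ.val = Multiset.map hA.eigenvalues Finset.univ.val := by
    have := hA.charpoly_eq
    rw [hAα] at this
    have h2 := congrArg Polynomial.roots this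
    simp only [RCLike.ofReal_real_eq_id, id] at h2
    rw [Finset.prod_eq_multiset_prod, Finset.prod_eq_multiset_prod] at h2
    have e (f : Fin n → ℝ) : Multiset.map (fun i => (X - C (f i))) Finset.univ.val
      = (Multiset.map f Finset.univ.val).map (fun a => X - C a) := by
      rw [Multiset.map_map]; rfl
    rw [e, e] at h2
    simpa only [Polynomial.roots_multiset_prod_X_sub_C] using h2
  have h5 : ∃ σ : Equiv.Perm (Fin n), α = hA.eigenvalues ∘ σ := by
    refine ⟨Tuple.sort hA.eigenvalues, ?_⟩
    have hs := Tuple.monotone_sort hA.eigenvalues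
    rw [Fin.univ_val_map, Fin.univ_val_map, Multiset.coe_eq_coe] at h1
    have h6 := h1.trans (Equiv.Perm.ofFn_comp_perm (Tuple.sort hA.eigenvalues) hA.eigenvalues).symm
    exact List.ofFn_injective (h6.eq_of_sortedLE hα.sortedLE_ofFn hs.sortedLE_ofFn)
  obtain ⟨σ, hσ⟩ := h5
  set U : Matrix (Fin n) (Fin n) ℝ := (hA.eigenvectorUnitary : Matrix (Fin n) (Fin n) ℝ) with hU
  have hUU : U * Uᵀ = 1 := by
    have := Unitary.mul_star_self_of_mem hA.eigenvectorUnitary.2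
    simpa [star_eq_conjTranspose, conjTranspose_eq_transpose_of_trivial] using this
  have hs : A = U * diagonal hA.eigenvalues * Uᵀ := by
    have := hA.spectral_theorem
    rw [Unitary.conjStarAlgAut_apply] at this
    simpa [star_eq_conjTranspose, conjTranspose_eq_transpose_of_trivial, Function.comp_def] using this
  refine ⟨Uᵀ.submatrix σ id, ?_, ?_⟩
  · intro x
    have : (Uᵀ.submatrix σ id) *ᵥ x = (Uᵀ *ᵥ x) ∘ σ := by ext; rfl
    rw [this]
    have : x ⬝ᵥ x = (Uᵀ *ᵥ x) ⬝ᵥ (Uᵀ *ᵥ x) := by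
      rw [dotProduct_mulVec, vecMul_transpose, mulVec_mulVec, hUU, one_mulVec]
    rw [this]
    simp only [dotProduct]
    exact Equiv.sum_comp σ (fun k => (Uᵀ *ᵥ x) k * (Uᵀ *ᵥ x) k)
  · intro x
    have h3 : (Uᵀ.submatrix σ id) *ᵥ x = (Uᵀ *ᵥ x) ∘ σ := by ext; rfl
    rw [h3]
    have h4 : x ⬝ᵥ (A *ᵥ x) = ∑ k, hA.eigenvalues k * (Uᵀ *ᵥ x) k ^ 2 := by
      conv_lhs => rw [hs]
      rw [← mulVec_mulVec, ← mulVec_mulVec, dotProduct_mulVec, ← mulVec_transpose]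
      simp only [dotProduct, mulVec_diagonal]
      exact Finset.sum_congr rfl fun k _ => by ring
    rw [h4, ← Equiv.sum_comp σ]
    refine Finset.sum_congr rfl fun k _ => ?_
    simp [hσ]

theorem eig_mono {n : ℕ} (A M : Matrix (Fin n) (Fin n) ℝ)
    (hA : A.IsHermitian) (hM : M.IsHermitian)
    (α μ : Fin n → ℝ) (hα : Monotone α) (hμ : Monotone μ)
    (hAα : A.charpoly = ∏ i : Fin n, (Polynomial.X - Polynomial.C (α i)))
    (hMμ : M.charpoly = ∏ i : Fin n, (Polynomial.X - Polynomial.C (μ i)))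
    (hle : ∀ x, x ⬝ᵥ (A *ᵥ x) ≤ x ⬝ᵥ (M *ᵥ x)) (i : Fin n) : α i ≤ μ i := by
  obtain ⟨P, hP, hPA⟩ := exists_diag A hA α hα hAα
  obtain ⟨R, hR, hRM⟩ := exists_diag M hM μ hμ hMμ
  let Q : Matrix (Fin n) (Fin n) ℝ :=
    Matrix.of fun k => if k < i then P k else if i < k then R k else 0
  have hQ : Q.det = 0 := det_eq_zero_of_row_eq_zero i (by intro j; simp [Q])
  obtain ⟨x, hx0, hx⟩ := exists_mulVec_eq_zero_iff.2 hQ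
  have hPk : ∀ k, k < i → (P *ᵥ x) k = 0 := by
    intro k hk
    have := congrFun hx k
    simpa [mulVec, Q, hk] using this
  have hRk : ∀ k, i < k → (R *ᵥ x) k = 0 := by
    intro k hk
    have := congrFun hx k
    simpa [mulVec, Q, hk, hk.not_gt] using this
  have hpos : 0 < x ⬝ᵥ x := by
    have h0 : 0 ≤ x ⬝ᵥ x := Finset.sum_nonneg fun k _ => mul_self_nonneg _
    exact lt_of_le_of_ne h0 fun h => hx0 (dotProduct_self_eq_zero.1 h.symm)
  have h1 : α i * (x ⬝ᵥ x) ≤ x ⬝ᵥ (A *ᵥ x) := by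
    rw [hPA, ← hP, dotProduct, Finset.mul_sum]
    refine Finset.sum_le_sum fun k _ => ?_
    rcases lt_or_ge k i with h | h
    · simp [hPk k h]
    · nlinarith [hα h, sq_nonneg ((P *ᵥ x) k)]
  have h2 : x ⬝ᵥ (M *ᵥ x) ≤ μ i * (x ⬝ᵥ x) := by
    rw [hRM, ← hR, dotProduct, Finset.mul_sum]
    refine Finset.sum_le_sum fun k _ => ?_
    rcases lt_or_ge i k with h | h
    · simp [hRk k h]
    · nlinarith [hμ h, sq_nonneg ((R *ᵥ x) k)]
  exact le_of_mul_le_mul_right (h1.trans ((hle x).trans h2)) hpos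

theorem trace_eq {n : ℕ} (A : Matrix (Fin n) (Fin n) ℝ) (α : Fin n → ℝ)
    (hAα : A.charpoly = ∏ i : Fin n, (Polynomial.X - Polynomial.C (α i))) :
    A.trace = ∑ i, α i := by
  rw [Matrix.trace_eq_sum_roots_charpoly_of_splits]
  · rw [hAα, Finset.prod_eq_multiset_prod]
    have e : Multiset.map (fun i => (X - C (α i))) Finset.univ.val
      = (Multiset.map α Finset.univ.val).map (fun a => X - C a) := by
      rw [Multiset.map_map]; rfl
    rw [e, Polynomial.roots_multiset_prod_X_sub_C]; rfl
  · rw [hAα]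
    exact Polynomial.Splits.prod fun i _ => Polynomial.Splits.X_sub_C _

theorem dd {n : ℕ} (C : Matrix (Fin n) (Fin n) ℝ) (hC : C.IsHermitian) (x : Fin n → ℝ) :
    |x ⬝ᵥ (C *ᵥ x)| ≤ ∑ i, (∑ j, |C i j|) * x i ^ 2 := by
  have hs : ∀ i j, C j i = C i j := fun i j => by simpa using hC.apply i j
  have h1 : |x ⬝ᵥ (C *ᵥ x)| ≤ ∑ i, ∑ j, |C i j| * ((x i ^ 2 + x j ^ 2) / 2) := by
    simp only [dotProduct, mulVec, Finset.mul_sum]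
    refine (Finset.abs_sum_le_sum_abs _ _).trans (Finset.sum_le_sum fun i _ => ?_)
    refine (Finset.abs_sum_le_sum_abs _ _).trans (Finset.sum_le_sum fun j _ => ?_)
    rw [abs_mul, abs_mul]
    nlinarith [sq_nonneg (|x i| - |x j|), abs_nonneg (C i j), sq_abs (x i), sq_abs (x j),
      mul_nonneg (abs_nonneg (C i j)) (sq_nonneg (|x i| - |x j|))]
  refine h1.trans (le_of_eq ?_)
  have h2 : ∑ i, ∑ j, |C i j| * x j ^ 2 = ∑ i, ∑ j, |C i j| * x i ^ 2 := by
    rw [Finset.sum_comm]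
    simp only [hs]
  have h3 : ∑ i, ∑ j, |C i j| * ((x i ^ 2 + x j ^ 2) / 2) =
    (∑ i, ∑ j, |C i j| * x i ^ 2) / 2 + (∑ i, ∑ j, |C i j| * x j ^ 2) / 2 := by
    simp only [Finset.sum_div, ← Finset.sum_add_distrib]
    exact Finset.sum_congr rfl fun i _ => Finset.sum_congr rfl fun j _ => by ring
  rw [h3, h2]
  simp only [Finset.sum_mul]
  ring

/-- Lidskii–Last inequality: if `α` and `β` are monotone enumerations of the
eigenvalues (with multiplicity) of real symmetric matrices `A` and `B`, then
the ℓ¹-distance of the eigenvalue sequences is bounded by the entrywise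
ℓ¹-distance of the matrices. -/
theorem lidskii_last_inequality
    {n : ℕ} (A B : Matrix (Fin n) (Fin n) ℝ)
    (hA : A.IsHermitian) (hB : B.IsHermitian)
    (α β : Fin n → ℝ) (hα : Monotone α) (hβ : Monotone β)
    (hAα : A.charpoly = ∏ i : Fin n, (Polynomial.X - Polynomial.C (α i)))
    (hBβ : B.charpoly = ∏ i : Fin n, (Polynomial.X - Polynomial.C (β i))) :
    ∑ i : Fin n, |α i - β i| ≤ ∑ i : Fin n, ∑ j : Fin n, |A i j - B i j| := by
  let d : Fin n → ℝ := fun i => ∑ j, |(A - B) i j|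
  let M : Matrix (Fin n) (Fin n) ℝ := (1 / 2 : ℝ) • (A + B + diagonal d)
  have hM : M.IsHermitian := by
    have h := (hA.add hB).add (isHermitian_diagonal d)
    ext i j
    have := h.apply i j
    simp only [star_trivial] at this
    simp only [M, conjTranspose_apply, Matrix.smul_apply, star_trivial, this]
  let τ := Tuple.sort hM.eigenvalues
  let μ : Fin n → ℝ := hM.eigenvalues ∘ τ
  have hμ : Monotone μ := Tuple.monotone_sort _
  have hMμ : M.charpoly = ∏ i : Fin n, (Polynomial.X - Polynomial.C (μ i)) := by
    rw [hM.charpoly_eq, ← Equiv.prod_comp τ]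
    rfl
  have hq : ∀ x, x ⬝ᵥ (M *ᵥ x) =
      (x ⬝ᵥ (A *ᵥ x) + x ⬝ᵥ (B *ᵥ x) + ∑ i, d i * x i ^ 2) / 2 := by
    intro x
    have : x ⬝ᵥ (diagonal d *ᵥ x) = ∑ i, d i * x i ^ 2 := by
      simp only [dotProduct, mulVec_diagonal]
      exact Finset.sum_congr rfl fun k _ => by ring
    simp only [M, smul_mulVec, add_mulVec, dotProduct_smul, dotProduct_add, this, smul_eq_mul]
    ring
  have hdd : ∀ x, |x ⬝ᵥ (A *ᵥ x) - x ⬝ᵥ (B *ᵥ x)| ≤ ∑ i, d i * x i ^ 2 := by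
    intro x
    have := dd (A - B) (hA.sub hB) x
    rwa [sub_mulVec, dotProduct_sub] at this
  have hAM := eig_mono A M hA hM α μ hα hμ hAα hMμ (fun x => by
    rw [hq]; linarith [abs_le.1 (hdd x)])
  have hBM := eig_mono B M hB hM β μ hβ hμ hBβ hMμ (fun x => by
    rw [hq]; linarith [abs_le.1 (hdd x)])
  have htr : ∑ i, (2 * μ i - α i - β i) = ∑ i, d i := by
    rw [Finset.sum_sub_distrib, Finset.sum_sub_distrib, ← Finset.mul_sum,
      ← trace_eq M μ hMμ, ← trace_eq A α hAα, ← trace_eq B β hBβ]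
    simp only [M, trace_smul, trace_add, trace_diagonal, smul_eq_mul]
    ring
  calc ∑ i, |α i - β i| ≤ ∑ i, (2 * μ i - α i - β i) :=
        Finset.sum_le_sum fun i _ => abs_le.2 ⟨by linarith [hAM i, hBM i], by
          linarith [hAM i, hBM i]⟩
    _ = ∑ i, d i := htr
    _ = _ := rfl
end

section
/- Let G and H be one-dimensional finite abstract simplicial complexes with connection Laplacians L_G and L_H, and let K = L_G ⊗ L_H be their Kronecker product (a real symmetric matrix, the connection operator of the product complex). Let κ_1, …, κ_M be the eigenvalues of K with multiplicity. Then the functional equation holds for the product: for every s ∈ ℂ, Σ_{k=1}^M (κ_k² : ℂ)^{-s} = Σ_{k=1}^M (κ_k² : ℂ)^{s}. -/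
open Matrix

noncomputable def zfeL {v e : Type*} [Fintype v] [DecidableEq v] [Fintype e] [DecidableEq e]
    (B : Matrix v e ℝ) : Matrix (v ⊕ e) (v ⊕ e) ℝ := fromBlocks 1 B Bᵀ (Bᵀ * B - 1)

lemma zfe_det {v e : Type*} [Fintype v] [DecidableEq v] [Fintype e] [DecidableEq e]
    (B : Matrix v e ℝ) (μ : ℝ) (h1 : μ ≠ 1) (h2 : μ ≠ -1) :
    (zfeL B).charpoly.eval μ = (μ - 1) ^ Fintype.card v * (μ + 1) ^ Fintype.card e *
      (1 - (μ / (μ ^ 2 - 1)) • (Bᵀ * B)).det := by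
  have a1 : μ - 1 ≠ 0 := sub_ne_zero.2 h1
  have a2 : μ + 1 ≠ 0 := fun h => h2 (by linarith)
  have a3 : μ ^ 2 - 1 ≠ 0 := by
    have : μ ^ 2 - 1 = (μ - 1) * (μ + 1) := by ring
    rw [this]; exact mul_ne_zero a1 a2
  rw [Matrix.eval_charpoly]
  have hb : (Matrix.scalar (v ⊕ e) μ - zfeL B) =
      fromBlocks ((μ - 1) • (1 : Matrix v v ℝ)) (-B) (-Bᵀ) ((μ + 1) • (1 : Matrix e e ℝ) - Bᵀ * B) := by
    ext i j
    rcases i with i | i <;> rcases j with j | j <;>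
      simp [zfeL, Matrix.scalar_apply, Matrix.diagonal_apply, Matrix.one_apply] <;>
      split_ifs <;> ring
  rw [hb]
  let _ : Invertible ((μ - 1) • (1 : Matrix v v ℝ)) :=
    ⟨(μ - 1)⁻¹ • 1, by simp [smul_smul, a1], by simp [smul_smul, a1]⟩
  have hi : ⅟ ((μ - 1) • (1 : Matrix v v ℝ)) = (μ - 1)⁻¹ • 1 := rfl
  rw [Matrix.det_fromBlocks₁₁, hi]
  have hc : (μ + 1) • (1 : Matrix e e ℝ) - Bᵀ * B - -Bᵀ * ((μ - 1)⁻¹ • (1 : Matrix v v ℝ)) * -B =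
      (μ + 1) • (1 - (μ / (μ ^ 2 - 1)) • (Bᵀ * B)) := by
    simp only [Matrix.mul_smul, Matrix.mul_one, Matrix.smul_mul, Matrix.neg_mul, Matrix.mul_neg, neg_neg,
      smul_neg, smul_sub, smul_smul]
    ext i j
    simp only [Matrix.sub_apply, Matrix.smul_apply, smul_eq_mul]
    field_simp
    ring
  rw [hc, Matrix.det_smul, Matrix.det_smul, Matrix.det_one]
  ring

open Polynomial in
lemma zfe_charpoly {v e : Type*} [Fintype v] [DecidableEq v] [Fintype e] [DecidableEq e]
    (B : Matrix v e ℝ) :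
    (zfeL B).charpoly * ((X - C 1) ^ Fintype.card e * (X - C (-1)) ^ Fintype.card v) =
    (zfeL (-Bᵀ)).charpoly * ((X - C 1) ^ Fintype.card v * (X - C (-1)) ^ Fintype.card e) := by
  apply Polynomial.eq_of_infinite_eval_eq
  apply Set.Infinite.mono (s := Set.Ioi (1:ℝ)) _ (Set.Ioi_infinite 1)
  intro μ hμ
  have hμ : 1 < μ := hμ
  simp only [Set.mem_ofPred_eq, eval_mul, eval_pow, eval_sub, eval_X, eval_C]
  rw [zfe_det B μ (by linarith) (by linarith), zfe_det (-Bᵀ) μ (by linarith) (by linarith)]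
  have : (1 - (μ / (μ ^ 2 - 1)) • ((-Bᵀ)ᵀ * (-Bᵀ))).det = (1 - (μ / (μ ^ 2 - 1)) • (Bᵀ * B)).det := by
    have := Matrix.det_one_sub_mul_comm ((μ / (μ ^ 2 - 1)) • Bᵀ) B
    rw [Matrix.smul_mul, Matrix.mul_smul] at this
    rw [this]; simp
  rw [this]; ring

lemma zfe_roots {n : Type*} [Fintype n] [DecidableEq n] (A P Q : Matrix n n ℝ) (d : n → ℝ)
    (hPQ : P * Q = 1) (hA : A = P * diagonal d * Q) :
    A.charpoly.roots = Finset.univ.val.map d := by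
  have hQP : Q * P = 1 := mul_eq_one_comm.1 hPQ
  rw [hA, Matrix.charpoly_mul_comm, ← mul_assoc, hQP, one_mul, Matrix.charpoly_diagonal]
  have := Polynomial.roots_multiset_prod_X_sub_C (Finset.univ.val.map d)
  rw [Multiset.map_map] at this
  exact this

/-- main spectral symmetry -/
lemma zfe_sum_s18 {v e n : Type*} [Fintype v] [DecidableEq v] [Fintype e] [DecidableEq e]
    [Fintype n] [DecidableEq n] (B : Matrix v e ℝ) (σ : v ⊕ e ≃ n) (A P Q : Matrix n n ℝ) (d : n → ℝ)
    (hPQ : P * Q = 1) (hA : A = P * diagonal d * Q) (hAB : A.submatrix σ σ = zfeL B) :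
    (∀ i, d i ≠ 0) ∧ ∀ f : ℝ → ℂ, ∑ i, f (d i ^ 2) = ∑ i, f ((d i)⁻¹ ^ 2) := by
  have hQP : Q * P = 1 := mul_eq_one_comm.1 hPQ
  let N : Matrix (v ⊕ e) (v ⊕ e) ℝ := fromBlocks (1 - B * Bᵀ) B Bᵀ (-1)
  have hLN : zfeL B * N = 1 := by
    simp only [zfeL, N, fromBlocks_multiply]
    rw [← fromBlocks_one]
    congr 1 <;> simp [Matrix.mul_sub, Matrix.sub_mul, Matrix.mul_assoc]
  have hA2 : A = (zfeL B).submatrix σ.symm σ.symm := by rw [← hAB]; simp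
  have hAN : A * N.submatrix σ.symm σ.symm = 1 := by
    rw [hA2, Matrix.submatrix_mul_equiv, hLN]; simp
  have hd : ∀ i, d i ≠ 0 := by
    intro i h0
    have h : diagonal d * (Q * N.submatrix σ.symm σ.symm * P) = 1 := by
      calc _ = (Q * P) * diagonal d * (Q * N.submatrix σ.symm σ.symm * P) := by rw [hQP, one_mul]
        _ = Q * ((P * diagonal d * Q) * N.submatrix σ.symm σ.symm) * P := by noncomm_ring
        _ = 1 := by rw [← hA, hAN, mul_one, hQP]
    have := congrFun (congrFun h i) i
    simp [Matrix.diagonal_mul, h0] at this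
  refine ⟨hd, fun f => ?_⟩
  have hinv : N.submatrix σ.symm σ.symm = P * diagonal (fun i => (d i)⁻¹) * Q := by
    have h : (P * diagonal (fun i => (d i)⁻¹) * Q) * A = 1 := by
      calc _ = P * diagonal (fun i => (d i)⁻¹) * (Q * P) * diagonal d * Q := by rw [hA]; noncomm_ring
        _ = P * (diagonal (fun i => (d i)⁻¹) * diagonal d) * Q := by rw [hQP]; noncomm_ring
        _ = 1 := by
          rw [Matrix.diagonal_mul_diagonal]; simp [hd, hPQ]
    exact (left_inv_eq_right_inv h hAN).symm
  have r1 : (zfeL B).charpoly.roots = Finset.univ.val.map d := by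
    rw [← zfe_roots A P Q d hPQ hA, hA2]
    exact congrArg _ (Matrix.charpoly_reindex σ (zfeL B)).symm
  have r2 : (zfeL (-Bᵀ)).charpoly.roots = Finset.univ.val.map (fun i => -(d i)⁻¹) := by
    rw [← zfe_roots (-N.submatrix σ.symm σ.symm) P Q _ hPQ (by
      rw [hinv]
      rw [show diagonal (fun i => -(d i)⁻¹) = - diagonal (fun i => (d i)⁻¹) by
        rw [Matrix.diagonal_neg]]
      rw [Matrix.mul_neg, Matrix.neg_mul])]
    have hs : -N.submatrix σ.symm σ.symm =
        Matrix.reindex ((Equiv.sumComm e v).trans σ) ((Equiv.sumComm e v).trans σ) (zfeL (-Bᵀ)) := by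
      have : zfeL (-Bᵀ) = (-N).submatrix (Equiv.sumComm e v) (Equiv.sumComm e v) := by
        ext i j
        rcases i with i | i <;> rcases j with j | j <;> simp [zfeL, N]
      rw [this]
      ext i j
      simp
    rw [hs, Matrix.charpoly_reindex]
  have hc := congrArg Polynomial.roots (zfe_charpoly B)
  have nz : ∀ a b : ℕ, ((Polynomial.X - Polynomial.C (1:ℝ)) ^ a * (Polynomial.X - Polynomial.C (-1:ℝ)) ^ b) ≠ 0 :=
    fun a b => mul_ne_zero (pow_ne_zero _ (Polynomial.X_sub_C_ne_zero _)) (pow_ne_zero _ (Polynomial.X_sub_C_ne_zero _))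
  rw [Polynomial.roots_mul (mul_ne_zero (Matrix.charpoly_monic _).ne_zero (nz _ _)),
    Polynomial.roots_mul (mul_ne_zero (Matrix.charpoly_monic _).ne_zero (nz _ _)),
    Polynomial.roots_mul (nz _ _), Polynomial.roots_mul (nz _ _), r1, r2] at hc
  simp only [Polynomial.roots_pow, Polynomial.roots_X_sub_C] at hc
  have hf := congrArg (fun m => (Multiset.map (fun x : ℝ => f (x ^ 2)) m).sum) hc
  simp only [Multiset.map_add, Multiset.sum_add, Multiset.map_nsmul, Multiset.sum_nsmul,
    Multiset.map_singleton, Multiset.sum_singleton, Multiset.map_map, Function.comp_def,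
    even_two.neg_pow] at hf
  rw [add_comm (Fintype.card e • _)] at hf
  exact add_right_cancel hf

lemma zfe_cl {V : Type*} [DecidableEq V] (G : Finset (Finset V)) (x y : G) :
    connectionLaplacian G x y = if (x.1 ∩ y.1).Nonempty then 1 else 0 := rfl

lemma zfe_inter {V : Type*} [Fintype V] [DecidableEq V] (G : Finset (Finset V))
    (hG : IsSimplicialComplex G) (a b : G) :
    ∑ x : {x : G // x.1.card = 1}, connectionLaplacian G x.1 a * connectionLaplacian G x.1 b =
      ((a.1 ∩ b.1).card : ℝ) := by
  have h : ∀ x : {x : G // x.1.card = 1},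
      connectionLaplacian G x.1 a * connectionLaplacian G x.1 b =
        if x.1.1 ⊆ a.1 ∩ b.1 then 1 else 0 := by
    rintro ⟨⟨x, hx⟩, h1⟩
    obtain ⟨w, rfl⟩ := Finset.card_eq_one.1 h1
    by_cases ha : w ∈ a.1 <;> by_cases hb : w ∈ b.1 <;>
      simp [zfe_cl, ha, hb]
  rw [Finset.sum_congr rfl (fun x _ => h x), Finset.sum_boole]
  congr 1
  symm
  refine Finset.card_bij (fun w hw => ⟨⟨{w}, hG.2 a.1 a.2 {w} (by simp)
    (by simpa using (Finset.mem_inter.1 hw).1)⟩, by simp⟩) ?_ ?_ ?_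
  · intro w hw
    simpa using hw
  · intro w _ w' _ h
    simpa using h
  · rintro ⟨⟨x, hx⟩, h1⟩ h
    obtain ⟨w, rfl⟩ := Finset.card_eq_one.1 h1
    exact ⟨w, by simpa using h, rfl⟩

lemma zfe_block {V : Type*} [Fintype V] [DecidableEq V] (G : Finset (Finset V))
    (hG : IsSimplicialComplex G) (hG1 : IsOneDimensional G) :
    (connectionLaplacian G).submatrix (Equiv.sumCompl (fun x : G => x.1.card = 1))
      (Equiv.sumCompl (fun x : G => x.1.card = 1)) =
    zfeL ((connectionLaplacian G).submatrix
      (fun x : {x : G // x.1.card = 1} => x.1) (fun y : {x : G // ¬ x.1.card = 1} => y.1)) := by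
  ext i j
  rcases i with i | i <;> rcases j with j | j
  · obtain ⟨⟨x, hx⟩, h1⟩ := i
    obtain ⟨⟨y, hy⟩, h2⟩ := j
    obtain ⟨a, rfl⟩ := Finset.card_eq_one.1 h1
    obtain ⟨b, rfl⟩ := Finset.card_eq_one.1 h2
    by_cases hab : a = b <;>
      simp [zfeL, zfe_cl, Matrix.one_apply, hab]
  · simp [zfeL]
  · simp [zfeL, zfe_cl, Finset.inter_comm]
  · have hin := zfe_inter G hG i.1 j.1
    have hc : ∀ z : {x : G // ¬ x.1.card = 1}, z.1.1.card = 2 := by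
      intro z
      have h1 := hG1.1 z.1.1 z.1.2
      have h2 := Finset.card_pos.2 (hG.1 z.1.1 z.1.2)
      have h3 := z.2
      omega
    simp only [zfeL, submatrix_apply, Equiv.sumCompl_apply_inr, fromBlocks_apply₂₂, Matrix.sub_apply,
      Matrix.mul_apply, Matrix.transpose_apply, hin, Matrix.one_apply]
    by_cases hij : i = j
    · subst hij
      have : i.1.1.Nonempty := hG.1 _ i.1.2
      simp [zfe_cl, this, hc i]
      norm_num
    · have hlt : (i.1.1 ∩ j.1.1).card < 2 := by
        by_contra hge
        have e1 : i.1.1 ∩ j.1.1 = i.1.1 :=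
          Finset.eq_of_subset_of_card_le Finset.inter_subset_left (by rw [hc i]; omega)
        have e2 : i.1.1 ∩ j.1.1 = j.1.1 :=
          Finset.eq_of_subset_of_card_le Finset.inter_subset_right (by rw [hc j]; omega)
        exact hij (Subtype.ext (Subtype.ext (e1.symm.trans e2)))
      simp only [zfe_cl, hij, if_false, sub_zero]
      split_ifs with h
      · have := Finset.card_pos.2 h
        have : (i.1.1 ∩ j.1.1).card = 1 := by omega
        simp [this]
      · rw [Finset.not_nonempty_iff_eq_empty.1 h]; simp

lemma zfe_complex {V : Type*} [Fintype V] [DecidableEq V] (G : Finset (Finset V))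
    (hG : IsSimplicialComplex G) (hG1 : IsOneDimensional G) :
    ∃ (P Q : Matrix G G ℝ) (d : G → ℝ), P * Q = 1 ∧
      connectionLaplacian G = P * diagonal d * Q ∧ (∀ i, d i ≠ 0) ∧
      ∀ f : ℝ → ℂ, ∑ i, f (d i ^ 2) = ∑ i, f ((d i)⁻¹ ^ 2) := by
  have hh : (connectionLaplacian G).IsHermitian := by
    ext i j
    simp [zfe_cl, Finset.inter_comm]
  have hsp := hh.spectral_theorem
  rw [Unitary.conjStarAlgAut_apply] at hsp
  have hU : (hh.eigenvectorUnitary : Matrix G G ℝ) * star (hh.eigenvectorUnitary : Matrix G G ℝ) = 1 :=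
    Unitary.coe_mul_star_self _
  exact ⟨_, _, _, hU, hsp, zfe_sum_s18 _ _ _ _ _ _ hU hsp (zfe_block G hG hG1)⟩

/-- The functional equation holds for the Kronecker product of the connection
Laplacians of two one-dimensional complexes: for every `s`,
`Σ_k (κ_k²)^{-s} = Σ_k (κ_k²)^{s}`. -/
theorem zeta_functional_equation_kronecker
    {V W : Type*} [Fintype V] [DecidableEq V] [Fintype W] [DecidableEq W]
    (G : Finset (Finset V)) (H : Finset (Finset W))
    (hG : IsSimplicialComplex G) (hH : IsSimplicialComplex H)
    (hG1 : IsOneDimensional G) (hH1 : IsOneDimensional H)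
    (hK : (Matrix.kroneckerMap (· * ·)
        (connectionLaplacian G) (connectionLaplacian H)).IsHermitian)
    (s : ℂ) :
    ∑ p : G × H, (((hK.eigenvalues p ^ 2 : ℝ)) : ℂ) ^ (-s)
      = ∑ p : G × H, (((hK.eigenvalues p ^ 2 : ℝ)) : ℂ) ^ s := by
  obtain ⟨P, Q, d, hPQ, hA, hd, hs⟩ := zfe_complex G hG hG1
  obtain ⟨P', Q', d', hPQ', hA', hd', hs'⟩ := zfe_complex H hH hH1
  have hroots := zfe_roots _ (kroneckerMap (· * ·) P P') (kroneckerMap (· * ·) Q Q')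
    (fun p : G × H => d p.1 * d' p.2)
    (by
      have := Matrix.mul_kronecker_mul P Q P' Q'
      rw [hPQ, hPQ', Matrix.one_kronecker_one] at this
      exact this.symm)
    (show kroneckerMap (· * ·) (connectionLaplacian G) (connectionLaplacian H) = _ by
      rw [hA, hA']
      have h1 := Matrix.mul_kronecker_mul (P * diagonal d) Q (P' * diagonal d') Q'
      have h2 := Matrix.mul_kronecker_mul P (diagonal d) P' (diagonal d')
      have h3 := Matrix.diagonal_kronecker_diagonal d d'
      rw [h2, h3] at h1
      exact h1)
  rw [hK.roots_charpoly_eq_eigenvalues] at hroots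
  have key : ∀ f : ℝ → ℂ, ∑ p : G × H, f (hK.eigenvalues p) = ∑ i, ∑ j, f (d i * d' j) := by
    intro f
    have := congrArg (fun m => (Multiset.map f m).sum) hroots
    simp only [Multiset.map_map, Function.comp_def, RCLike.ofReal_real_eq_id, id] at this
    rw [← Fintype.sum_prod_type' (fun i j => f (d i * d' j))]
    exact this
  rw [key (fun x => (((x ^ 2 : ℝ)) : ℂ) ^ (-s)), key (fun x => (((x ^ 2 : ℝ)) : ℂ) ^ s)]
  have e1 : ∑ i, ∑ j, ((((d i * d' j) ^ 2 : ℝ)) : ℂ) ^ s =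
      ∑ i, ∑ j, (((d i ^ 2 * (d' j)⁻¹ ^ 2 : ℝ)) : ℂ) ^ s := by
    refine Finset.sum_congr rfl fun i _ => ?_
    have := hs' (fun x => (((d i ^ 2 * x : ℝ)) : ℂ) ^ s)
    rw [← this]
    simp only [mul_pow]
  have e2 := hs (fun x => ∑ j, (((x * (d' j)⁻¹ ^ 2 : ℝ)) : ℂ) ^ s)
  rw [e1, e2]
  refine Finset.sum_congr rfl fun i _ => Finset.sum_congr rfl fun j _ => ?_
  rw [Complex.cpow_neg, ← Complex.inv_cpow_ofReal_nonneg (sq_nonneg _), ← Complex.ofReal_inv]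
  congr 2
  rw [← mul_pow, ← mul_inv, inv_pow]
end
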